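/- Borwein's conjecture (Wang's theorem): for every nonnegative integer N, the polynomial G(N,N;4/3,5/3,3) = ∑_{j∈ℤ} (−1)^j q^{j(9j+1)/2} [2N choose N−3j]_q has nonnegative coefficients. -/

import Mathlib

open LaurentPolynomial Finset

noncomputable section

/-- The Gaussian binomial coefficient `[m choose n]_q` as a polynomial in `q`,
defined via the `q`-Pascal recurrence; it equals `(q;q)_m/((q;q)_n (q;q)_{m-n})`
for `0 ≤ n ≤ m`. -/
def gb : ℕ → ℕ → Polynomial ℤ
  | _, 0 => 1
  | 0, _ + 1 => 0
  | m + 1, n + 1 => gb m n + Polynomial.X ^ (n + 1) * gb m (n + 1)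

/-- `[m choose n]_q` with integer indices, zero unless `0 ≤ n ≤ m`,
viewed as a Laurent polynomial in `q`. -/
def qbin (m n : ℤ) : LaurentPolynomial ℤ :=
  if 0 ≤ n ∧ n ≤ m then (gb m.toNat n.toNat).toLaurent else 0

/-- A Laurent polynomial is a polynomial in `q` with nonnegative coefficients. -/
def IsNonneg (x : LaurentPolynomial ℤ) : Prop :=
  ∃ P : Polynomial ℤ, (∀ n, 0 ≤ P.coeff n) ∧ P.toLaurent = x

/-- The triangular number `T(j) = j(j+1)/2`. -/
def tri (j : ℤ) : ℤ := j * (j + 1) / 2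

section

open Complex

theorem norm_taylor_two_le_of_nonneg {f f1 f2 f3 : ℝ → ℂ} {K X : ℝ}
    (h0 : ∀ x ∈ Set.Icc 0 X, HasDerivAt f (f1 x) x)
    (h1 : ∀ x ∈ Set.Icc 0 X, HasDerivAt f1 (f2 x) x)
    (h2 : ∀ x ∈ Set.Icc 0 X, HasDerivAt f2 (f3 x) x)
    (hK : ∀ x ∈ Set.Icc 0 X, ‖f3 x‖ ≤ K) :
    ∀ x ∈ Set.Icc 0 X, ‖f x - f 0 - x * f1 0 - x ^ 2 / 2 * f2 0‖ ≤ K * x ^ 3 / 6 := by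
  have key : ∀ {g g1 : ℝ → ℂ} {B B1 : ℝ → ℝ},
      (∀ x ∈ Set.Icc 0 X, HasDerivAt g (g1 x) x) → (∀ x, HasDerivAt B (B1 x) x) →
      g 0 = 0 → B 0 = 0 → (∀ x ∈ Set.Icc 0 X, ‖g1 x‖ ≤ B1 x) →
      ∀ x ∈ Set.Icc 0 X, ‖g x‖ ≤ B x := by
    intro g g1 B B1 hg hB hg0 hB0 hle
    exact fun x hx => image_norm_le_of_norm_deriv_right_le_deriv_boundary
      (fun y hy => (hg y hy).continuousAt.continuousWithinAt)
      (fun y hy => (hg y ⟨hy.1, hy.2.le⟩).hasDerivWithinAt) (by simp [hg0, hB0]) hB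
      (fun y hy => hle y ⟨hy.1, hy.2.le⟩) hx
  have hx' : ∀ x : ℝ, HasDerivAt (fun y : ℝ => (y : ℂ)) 1 x := fun x => by
    simpa using (hasDerivAt_id x).ofReal_comp
  have s2 := key (g := fun x => f2 x - f2 0) (g1 := f3) (B := fun x => K * x) (B1 := fun _ => K)
    (fun x hx => (h2 x hx).sub_const _)
    (fun x => by simpa using (hasDerivAt_id x).const_mul K) (by simp) (by simp) hK
  have s1 := key (g := fun x => f1 x - f1 0 - x * f2 0) (g1 := fun x => f2 x - f2 0)
    (B := fun x => K * x ^ 2 / 2) (B1 := fun x => K * x)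
    (fun x hx => by
      have := ((h1 x hx).sub_const (f1 0)).sub ((hx' x).mul_const (f2 0))
      refine this.congr_deriv ?_
      simp)
    (fun x => by
      have := (((hasDerivAt_id x).pow 2).const_mul K).div_const 2
      refine this.congr_deriv ?_
      simp; ring) (by simp) (by simp) s2
  exact key (g := fun x => f x - f 0 - x * f1 0 - x ^ 2 / 2 * f2 0)
    (g1 := fun x => f1 x - f1 0 - x * f2 0)
    (B := fun x => K * x ^ 3 / 6) (B1 := fun x => K * x ^ 2 / 2)
    (fun x hx => by
      have := (((h0 x hx).sub_const (f 0)).sub ((hx' x).mul_const (f1 0))).sub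
        (((((hx' x).pow 2)).div_const 2).mul_const (f2 0))
      refine this.congr_deriv ?_
      simp)
    (fun x => by
      have := (((hasDerivAt_id x).pow 3).const_mul K).div_const 6
      refine this.congr_deriv ?_
      simp; ring) (by simp) (by simp) s1

theorem norm_taylor_two_le {f f1 f2 f3 : ℝ → ℂ} {K X : ℝ}
    (h0 : ∀ x, |x| ≤ X → HasDerivAt f (f1 x) x)
    (h1 : ∀ x, |x| ≤ X → HasDerivAt f1 (f2 x) x)
    (h2 : ∀ x, |x| ≤ X → HasDerivAt f2 (f3 x) x)
    (hK : ∀ x, |x| ≤ X → ‖f3 x‖ ≤ K) {x : ℝ} (hx : |x| ≤ X) :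
    ‖f x - f 0 - x * f1 0 - x ^ 2 / 2 * f2 0‖ ≤ K * |x| ^ 3 / 6 := by
  rcases le_total 0 x with h | h
  · rw [abs_of_nonneg h] at hx ⊢
    have A : ∀ y ∈ Set.Icc 0 X, |y| ≤ X := fun y hy => by rw [abs_of_nonneg hy.1]; exact hy.2
    exact norm_taylor_two_le_of_nonneg (fun y hy => h0 y (A y hy)) (fun y hy => h1 y (A y hy))
      (fun y hy => h2 y (A y hy)) (fun y hy => hK y (A y hy)) x ⟨h, hx⟩
  · rw [abs_of_nonpos h] at hx ⊢
    have A : ∀ y ∈ Set.Icc 0 X, |-y| ≤ X := fun y hy => by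
      rw [abs_neg, abs_of_nonneg hy.1]; exact hy.2
    have N : ∀ {g : ℝ → ℂ} {g1 : ℂ} {y : ℝ}, HasDerivAt g g1 (-y) →
        HasDerivAt (fun y => g (-y)) (-g1) y := fun {g g1 y} hg => by
      have := HasDerivAt.scomp y hg (hasDerivAt_neg y)
      rw [neg_one_smul] at this
      exact this
    have := norm_taylor_two_le_of_nonneg (f := fun y => f (-y)) (f1 := fun y => -f1 (-y))
      (f2 := fun y => f2 (-y)) (f3 := fun y => -f3 (-y)) (K := K) (X := X)
      (fun y hy => N (h0 (-y) (A y hy)))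
      (fun y hy => by simpa only [neg_neg] using (N (h1 (-y) (A y hy))).fun_neg)
      (fun y hy => N (h2 (-y) (A y hy)))
      (fun y hy => by simpa using hK (-y) (A y hy)) (-x) ⟨by linarith, hx⟩
    simpa using this

/-- The weight `ρ / (1 + ρ + ρ²)`. -/
def wt (ρ : ℝ) : ℝ := ρ / (1 + ρ + ρ ^ 2)

theorem log_one_sub_taylor {u₀ : ℂ} {K X : ℝ}
    (hre : ∀ y : ℝ, |y| ≤ X → 0 < (1 - u₀ * exp (y * I)).re)
    (hK : ∀ y : ℝ, |y| ≤ X → ‖u₀ * exp (y * I) * (1 + u₀ * exp (y * I))‖ ≤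
      K * ‖1 - u₀ * exp (y * I)‖ ^ 3) {y : ℝ} (hy : |y| ≤ X) :
    ‖log (1 - u₀ * exp (y * I)) - log (1 - u₀) - y * (-I * u₀ / (1 - u₀)) -
      y ^ 2 / 2 * (u₀ / (1 - u₀) ^ 2)‖ ≤ K * |y| ^ 3 / 6 := by
  have hu : ∀ x : ℝ, HasDerivAt (fun x : ℝ => u₀ * exp (x * I)) (u₀ * exp (x * I) * I) x :=
    fun x => by
      have h1 : HasDerivAt (fun x : ℝ => (x : ℂ) * I) I x := by
        simpa using (hasDerivAt_id x).ofReal_comp.mul_const I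
      have := (h1.cexp).const_mul u₀
      exact this.congr_deriv (by ring)
  have hv : ∀ x : ℝ, HasDerivAt (fun x : ℝ => 1 - u₀ * exp (x * I)) (-(u₀ * exp (x * I) * I)) x :=
    fun x => (hu x).const_sub 1
  have hne : ∀ x : ℝ, |x| ≤ X → 1 - u₀ * exp (x * I) ≠ 0 := fun x hx h0 => by
    have := hre x hx
    rw [h0] at this
    simp at this
  have := norm_taylor_two_le (f := fun x : ℝ => log (1 - u₀ * exp (x * I)))
    (f1 := fun x : ℝ => -I * (u₀ * exp (x * I)) / (1 - u₀ * exp (x * I)))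
    (f2 := fun x : ℝ => (u₀ * exp (x * I)) / (1 - u₀ * exp (x * I)) ^ 2)
    (f3 := fun x : ℝ => I * (u₀ * exp (x * I) * (1 + u₀ * exp (x * I))) /
      (1 - u₀ * exp (x * I)) ^ 3) (K := K) (X := X)
    (fun x hx => ((hv x).clog_real (Or.inl (hre x hx))).congr_deriv (by ring))
    (fun x hx => by
      have h := hne x hx
      refine (((hu x).const_mul (-I)).fun_div (hv x) h).congr_deriv ?_
      rw [div_left_inj' (pow_ne_zero 2 h)]
      linear_combination (-(u₀ * exp (x * I))) * I_sq)
    (fun x hx => by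
      have h := hne x hx
      refine ((hu x).fun_div ((hv x).fun_pow 2) (pow_ne_zero 2 h)).congr_deriv ?_
      field_simp
      push_cast
      ring)
    (fun x hx => by
      rw [norm_div, norm_pow, norm_mul, norm_I, one_mul, div_le_iff₀]
      · exact hK x hx
      · exact pow_pos (norm_pos_iff.2 (hne x hx)) 3) hy
  simpa using this

theorem normSq_one_sub (u : ℂ) : ‖1 - u‖ ^ 2 = 1 + ‖u‖ ^ 2 - 2 * u.re := by
  rw [← normSq_eq_norm_sq, ← normSq_eq_norm_sq, normSq_apply, normSq_apply]
  simp; ring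

theorem normSq_one_add (u : ℂ) : ‖1 + u‖ ^ 2 = 1 + ‖u‖ ^ 2 + 2 * u.re := by
  rw [← normSq_eq_norm_sq, ← normSq_eq_norm_sq, normSq_apply, normSq_apply]
  simp; ring

theorem norm_third_le {u : ℂ} {ρ : ℝ} (hu : ‖u‖ = ρ) (h0 : 0 < ρ) (h1 : ρ ≤ 1)
    (h : u.re ≤ ρ * (84 / 1000) ∨ ρ ≤ 1 / 10) :
    ‖u * (1 + u)‖ ≤ (18 / 10 * wt ρ) * ‖1 - u‖ ^ 3 := by
  have hq : 0 < 1 + ρ + ρ ^ 2 := by positivity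
  rw [norm_mul, hu, wt, mul_div_assoc', div_mul_eq_mul_div, le_div_iff₀ hq]
  suffices H : ‖1 + u‖ * (1 + ρ + ρ ^ 2) ≤ 18 / 10 * ‖1 - u‖ ^ 3 by nlinarith
  rcases h with h | h
  · apply abs_le_of_sq_le_sq' _ (by positivity) |>.2
    have e1 := normSq_one_sub u
    have e2 := normSq_one_add u
    rw [hu] at e1 e2
    have hD : 1 + ρ ^ 2 - 168 / 1000 * ρ ≤ ‖1 - u‖ ^ 2 := by linarith
    have hE : ‖1 + u‖ ^ 2 ≤ 1 + ρ ^ 2 + 168 / 1000 * ρ := by linarith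
    have hD0 : 0 < 1 + ρ ^ 2 - 168 / 1000 * ρ := by nlinarith
    have hs : 2 * ρ ≤ 1 + ρ ^ 2 := by nlinarith [sq_nonneg (1 - ρ)]
    have hD3 : (1 + ρ ^ 2 - 168 / 1000 * ρ) ^ 3 ≤ (‖1 - u‖ ^ 2) ^ 3 := by gcongr
    have key : (1 + ρ ^ 2 + 168 / 1000 * ρ) * (1 + ρ + ρ ^ 2) ^ 2 ≤
        (18 / 10) ^ 2 * (1 + ρ ^ 2 - 168 / 1000 * ρ) ^ 3 := by
      obtain ⟨d, hd⟩ : ∃ d, d = 1 + ρ ^ 2 - 2 * ρ := ⟨_, rfl⟩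
      have hd0 : 0 ≤ d := by linarith
      have e : 1 + ρ ^ 2 = d + 2 * ρ := by linarith
      have e' : 1 + ρ + ρ ^ 2 = d + 3 * ρ := by linarith
      rw [e, e']
      have := mul_nonneg hd0 h0.le
      have a1 : 0 ≤ d ^ 3 := by positivity
      have a2 : 0 ≤ d ^ 2 * ρ := by positivity
      have a3 : 0 ≤ d * ρ ^ 2 := by positivity
      have a4 : 0 ≤ ρ ^ 3 := by positivity
      nlinarith
    calc (‖1 + u‖ * (1 + ρ + ρ ^ 2)) ^ 2 = ‖1 + u‖ ^ 2 * (1 + ρ + ρ ^ 2) ^ 2 := by ring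
      _ ≤ (1 + ρ ^ 2 + 168 / 1000 * ρ) * (1 + ρ + ρ ^ 2) ^ 2 := by gcongr
      _ ≤ _ := key
      _ ≤ (18 / 10) ^ 2 * (‖1 - u‖ ^ 2) ^ 3 := by gcongr
      _ = _ := by ring
  · have a1 : ‖1 + u‖ ≤ 1 + ρ := by simpa [hu] using norm_add_le 1 u
    have a2 : 1 - ρ ≤ ‖1 - u‖ := by simpa [hu] using norm_sub_norm_le 1 u
    have a3 : (1 - ρ) ^ 3 ≤ ‖1 - u‖ ^ 3 := pow_le_pow_left₀ (by linarith) a2 3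
    have a4 : (9 / 10 : ℝ) ^ 3 ≤ (1 - ρ) ^ 3 := pow_le_pow_left₀ (by norm_num) (by linarith) 3
    calc ‖1 + u‖ * (1 + ρ + ρ ^ 2) ≤ (11 / 10) * (1 + 1 / 10 + (1 / 10) ^ 2) := by
          gcongr; linarith
      _ ≤ 18 / 10 * (9 / 10) ^ 3 := by norm_num
      _ ≤ _ := by linarith

theorem neg_half_cos_add_sin_le {y : ℝ} (hy : |y| ≤ 6 / 10) :
    -(1 / 2) * Real.cos y + √3 / 2 * |Real.sin y| ≤ 84 / 1000 := by
  have h1 : 1 - y ^ 2 / 2 ≤ Real.cos y := Real.one_sub_sq_div_two_le_cos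
  have h2 : |Real.sin y| ≤ |y| - |y| ^ 3 / 6 + |y| ^ 5 / 100 := by
    have hb := Real.sin_bound (x := |y|) (by rw [abs_abs]; linarith)
    rw [abs_abs] at hb
    have : |Real.sin y| = Real.sin |y| := by
      rcases abs_cases y with ⟨h, h'⟩ | ⟨h, h'⟩
      · rw [h] at hy ⊢
        exact abs_of_nonneg (Real.sin_nonneg_of_nonneg_of_le_pi h' (by linarith [Real.pi_gt_three]))
      · rw [h] at hy ⊢
        rw [Real.sin_neg, abs_of_nonpos]
        exact Real.sin_nonpos_of_nonpos_of_neg_pi_le h'.le (by linarith [Real.pi_gt_three])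
    rw [this]
    linarith [(abs_le.1 hb).2]
  have h3 : √3 ≤ 17321 / 10000 := by
    rw [Real.sqrt_le_left (by norm_num)]; norm_num
  have h4 : √3 / 2 * |Real.sin y| ≤ 17321 / 20000 *
      (|y| - |y| ^ 3 / 6 + |y| ^ 5 / 100) := by
    have := abs_nonneg (Real.sin y)
    nlinarith [Real.sqrt_nonneg 3]
  have h5 : y ^ 2 = |y| ^ 2 := (sq_abs y).symm
  rw [h5] at h1
  have h0 := abs_nonneg y
  generalize |y| = v at *
  have b3 : v ^ 5 ≤ 36 / 100 * v ^ 3 := by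
    have : v ^ 2 ≤ 36 / 100 := by nlinarith
    nlinarith [pow_nonneg h0 3]
  have b2 : 0 ≤ (6 / 10 - v) * v := mul_nonneg (by linarith) h0
  have b4 : 0 ≤ (6 / 10 - v) * v ^ 2 := mul_nonneg (by linarith) (by positivity)
  nlinarith

/-- A cubic-error expansion of the factor `1 - ρ ω e^{iy}` for a primitive cube root of unity `ω`.
    -/
theorem factor_expansion {ρ y : ℝ} {ω : ℂ} (hre : ω.re = -1 / 2) (him : |ω.im| = √3 / 2)
    (h0 : 0 < ρ) (h1 : ρ ≤ 1) (hy : |y| ≤ 6 / 10 ∨ ρ ≤ 1 / 10) :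
    ∃ e : ℂ, ‖e‖ ≤ 3 / 10 * wt ρ * |y| ^ 3 ∧
      1 - ρ * ω * exp (y * I) = exp (log (1 - ρ * ω) + y * (-I * (ρ * ω) / (1 - ρ * ω)) +
        y ^ 2 / 2 * (ρ * ω / (1 - ρ * ω) ^ 2) + e) := by
  have hω : ‖ω‖ = 1 := by
    have : ‖ω‖ ^ 2 = 1 := by
      rw [← normSq_eq_norm_sq, normSq_apply, hre, ← abs_mul_abs_self ω.im, him]
      nlinarith [Real.sq_sqrt (show (0 : ℝ) ≤ 3 by norm_num)]
    nlinarith [norm_nonneg ω]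
  have hn : ∀ x : ℝ, ‖ρ * ω * exp (x * I)‖ = ρ := fun x => by
    rw [norm_mul, norm_mul, hω, norm_exp_ofReal_mul_I, norm_real, Real.norm_of_nonneg h0.le]
    ring
  have hR : ∀ x : ℝ, |x| ≤ |y| →
      (ρ * ω * exp (x * I)).re ≤ ρ * (84 / 1000) ∨ ρ ≤ 1 / 10 := fun x hx => by
    rcases hy with hy | hy
    · left
      have := neg_half_cos_add_sin_le (hx.trans hy)
      have e : (ρ * ω * exp (x * I)).re = ρ * (-(1 / 2) * Real.cos x - ω.im * Real.sin x) := by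
        rw [mul_assoc, re_ofReal_mul, mul_re, exp_ofReal_mul_I_re, exp_ofReal_mul_I_im, hre]
        ring
      rw [e]
      apply mul_le_mul_of_nonneg_left _ h0.le
      have h2 : -(ω.im * Real.sin x) ≤ √3 / 2 * |Real.sin x| := by
        rw [← him, ← abs_mul]
        exact neg_le_abs _
      linarith
    · exact Or.inr hy
  have hpos : ∀ x : ℝ, |x| ≤ |y| → 0 < (1 - ρ * ω * exp (x * I)).re := fun x hx => by
    rw [sub_re, one_re]
    have h2 := re_le_norm (ρ * ω * exp (x * I))
    rw [hn] at h2
    rcases hR x hx with h | h <;> nlinarith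
  have T := log_one_sub_taylor (u₀ := ρ * ω) hpos
    (fun x hx => norm_third_le (hn x) h0 h1 (hR x hx)) le_rfl
  refine ⟨_, T.trans (by linarith [mul_nonneg (show 0 ≤ wt ρ by unfold wt; positivity) (pow_nonneg (abs_nonneg y) 3)]), ?_⟩
  have hne : 1 - ρ * ω * exp (y * I) ≠ 0 := fun h => by
    have := hpos y le_rfl
    rw [h] at this
    simp at this
  conv_lhs => rw [← exp_log hne]
  congr 1
  ring

/-- The function `ρ (1 - ρ²) / (1 + ρ + ρ²)²`. -/
def kt (ρ : ℝ) : ℝ := ρ * (1 - ρ ^ 2) / (1 + ρ + ρ ^ 2) ^ 2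

/-- The function `(ρ / 2 + ρ²) / (1 + ρ + ρ²)`. -/
def ht (ρ : ℝ) : ℝ := (ρ / 2 + ρ ^ 2) / (1 + ρ + ρ ^ 2)

/-- Minus the argument of `1 - ρ e^{2πi/3}`. -/
def at3 (ρ : ℝ) : ℝ := Real.arctan (√3 * ρ / (2 + ρ))

theorem wt_nonneg {ρ : ℝ} (h : 0 ≤ ρ) : 0 ≤ wt ρ := by unfold wt; positivity

theorem log_one_sub_root {ρ s : ℝ} {ω : ℂ} (hre : ω.re = -1 / 2) (him : ω.im = s * (√3 / 2))
    (hs : s = 1 ∨ s = -1) (h0 : 0 < ρ) :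
    log (1 - ρ * ω) = (Real.log (1 + ρ + ρ ^ 2) / 2 : ℝ) + ((-s * at3 ρ : ℝ) : ℂ) * I := by
  have hR : (1 - ρ * ω).re = 1 + ρ / 2 := by simp [hre]; ring
  have hI : (1 - ρ * ω).im = -s * (√3 / 2 * ρ) := by simp [him]; ring
  have hs2 : s ^ 2 = 1 := by rcases hs with h | h <;> simp [h]
  apply Complex.ext
  · rw [log_re]
    have : ‖1 - ρ * ω‖ = √(1 + ρ + ρ ^ 2) := by
      rw [← Real.sqrt_sq (norm_nonneg _), ← normSq_eq_norm_sq, normSq_apply, hR, hI]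
      congr 1
      have := Real.sq_sqrt (show (0 : ℝ) ≤ 3 by norm_num)
      linear_combination s ^ 2 * ρ ^ 2 / 4 * this + 3 / 4 * ρ ^ 2 * hs2
    rw [this, Real.log_sqrt (by positivity)]
    simp
  · rw [log_im]
    have h1 : |arg (1 - ρ * ω)| < Real.pi / 2 :=
      abs_arg_lt_pi_div_two_iff.2 (Or.inl (by rw [hR]; positivity))
    have h2 := Real.arctan_eq_of_tan_eq (tan_arg (1 - ρ * ω)) (abs_lt.1 h1)
    rw [← h2, hR, hI]
    have e : -s * (√3 / 2 * ρ) / (1 + ρ / 2) = -s * (√3 * ρ / (2 + ρ)) := by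
      field_simp
    rw [e, at3]
    rcases hs with rfl | rfl <;> simp [Real.arctan_neg, -ofReal_arctan]

theorem one_sub_root_ne_zero {ρ : ℝ} {ω : ℂ} (hre : ω.re = -1 / 2) (h0 : 0 < ρ) :
    1 - ρ * ω ≠ 0 := fun h => by
  have : (1 - ρ * ω).re = 1 + ρ / 2 := by simp [hre]; ring
  rw [h] at this
  simp at this
  linarith

theorem factor_exp {ρ y s : ℝ} {ω : ℂ} (hre : ω.re = -1 / 2) (him : ω.im = s * (√3 / 2))
    (hs : s = 1 ∨ s = -1) (h0 : 0 < ρ) (h1 : ρ ≤ 1) (hy : |y| ≤ 6 / 10 ∨ ρ ≤ 1 / 10) :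
    ∃ a b : ℝ, |a| ≤ 3 / 10 * wt ρ * |y| ^ 3 ∧ |b| ≤ 3 / 10 * wt ρ * |y| ^ 3 ∧
      1 - ρ * ω * exp (y * I) = exp (
        (Real.log (1 + ρ + ρ ^ 2) / 2 + s * (√3 / 2) * (y * wt ρ) -
          y ^ 2 / 4 * (wt ρ + 3 * wt ρ ^ 2) + a : ℝ) +
        ((-s * at3 ρ + y * ht ρ + s * (√3 / 4) * (y ^ 2 * kt ρ) + b : ℝ) : ℂ) * I) := by
  have hs2 : s ^ 2 = 1 := by rcases hs with h | h <;> simp [h]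
  have h3 := Real.sq_sqrt (show (0 : ℝ) ≤ 3 by norm_num)
  have him' : |ω.im| = √3 / 2 := by
    have : (0 : ℝ) ≤ √3 / 2 := by positivity
    rcases hs with h | h <;> simp [him, h, abs_of_nonneg this]
  obtain ⟨e, he, hE⟩ := factor_expansion hre him' h0 h1 hy
  refine ⟨e.re, e.im, (abs_re_le_norm e).trans he, (abs_im_le_norm e).trans he, ?_⟩
  rw [hE, log_one_sub_root hre him hs h0]
  congr 1
  have hne := one_sub_root_ne_zero hre h0
  have hq : (1 + ρ + ρ ^ 2) ≠ 0 := by positivity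
  obtain ⟨κ, hκ⟩ : ∃ κ : ℂ, κ = (s * (√3 / 2) : ℝ) * I := ⟨_, rfl⟩
  have hω : ω = -1 / 2 + κ := by
    rw [hκ]
    apply Complex.ext <;> simp [hre, him]
  have hqC : (1 + (ρ : ℂ) + (ρ : ℂ) ^ 2) ≠ 0 := by exact_mod_cast hq
  have hs2C : (s : ℂ) ^ 2 = 1 := by exact_mod_cast hs2
  have h3C : ((√3 : ℝ) : ℂ) ^ 2 = 3 := by exact_mod_cast h3
  have hκ2 : κ ^ 2 = -3 / 4 := by
    rw [hκ]
    push_cast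
    linear_combination (s : ℂ) ^ 2 * (√3 : ℝ) ^ 2 / 4 * I_sq - (√3 : ℝ) ^ 2 / 4 * hs2C - h3C / 4
  have hinv : ρ * ω / (1 - ρ * ω) = -(ht ρ : ℂ) + κ * (wt ρ : ℂ) := by
    rw [div_eq_iff hne, hω, ht, wt]
    push_cast
    field_simp
    linear_combination (4 * ρ ^ 2 : ℂ) * hκ2
  have hinv2 : ρ * ω / (1 - ρ * ω) ^ 2 =
      -(1 / 2) * ((wt ρ : ℂ) + 3 * (wt ρ : ℂ) ^ 2) + κ * (kt ρ : ℂ) := by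
    rw [div_eq_iff (pow_ne_zero 2 hne), hω, kt, wt]
    push_cast
    field_simp
    linear_combination ρ * (-8 * ρ ^ 2 * (-(1 + 4 * ρ + ρ ^ 2) / 2 + (1 - ρ ^ 2) * κ) + 8 * (1 - ρ
        ^ 2) * (2 * ρ + ρ ^ 2) : ℂ) * hκ2
  rw [mul_div_assoc, hinv, hinv2]
  conv_lhs => rw [← re_add_im e]
  push_cast
  push_cast at hκ
  linear_combination (y ^ 2 / 2 * kt ρ - I * y * wt ρ : ℂ) * hκ - (y * wt ρ * s * √3 / 2) * I_sq

/-- The complex-analytic form of the Borwein product. -/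
def bz (n : ℕ) (z : ℂ) : ℂ := ∏ i ∈ range n, (1 - z ^ (3 * i + 1)) * (1 - z ^ (3 * i + 2))

/-- The logarithm of the modulus of the Borwein product at `r e^{2πi/3}`. -/
def logN (n : ℕ) (r : ℝ) : ℝ := ∑ i ∈ range n,
  (Real.log (1 + r ^ (3 * i + 1) + (r ^ (3 * i + 1)) ^ 2) / 2 +
    Real.log (1 + r ^ (3 * i + 2) + (r ^ (3 * i + 2)) ^ 2) / 2)

/-- Upper bound for the weighted power sum `∑ a ^ k wt (r ^ a)` over `3 ∤ a`. -/
def powSum (k n : ℕ) (r : ℝ) : ℝ :=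
  ∑ i ∈ range n, 2 * ((3 * i + 2 : ℕ) : ℝ) ^ k * wt (r ^ (3 * i + 1))

/-- The real drift coefficient at the saddle point. -/
def drift (n : ℕ) (r : ℝ) : ℝ := ∑ i ∈ range n,
  √3 / 2 * (((3 * i + 1 : ℕ) : ℝ) * wt (r ^ (3 * i + 1)) -
    ((3 * i + 2 : ℕ) : ℝ) * wt (r ^ (3 * i + 2)))

/-- The weighted sum fixed by the saddle point equation. -/
def saddle (n : ℕ) (r : ℝ) : ℝ := ∑ i ∈ range n,
  (((3 * i + 1 : ℕ) : ℝ) * ht (r ^ (3 * i + 1)) + ((3 * i + 2 : ℕ) : ℝ) * ht (r ^ (3 * i + 2)))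

theorem wt_mono {x y : ℝ} (hx : 0 ≤ x) (hxy : x ≤ y) (hy : y ≤ 1) : wt x ≤ wt y := by
  unfold wt
  rw [div_le_div_iff₀ (by positivity) (by nlinarith)]
  nlinarith [mul_nonneg (sub_nonneg.2 hxy) (show 0 ≤ 1 - x * y by nlinarith)]

theorem wt_le_third {x : ℝ} (hx : 0 ≤ x) : wt x ≤ 1 / 3 := by
  unfold wt
  rw [div_le_div_iff₀ (by positivity) (by positivity)]
  nlinarith [sq_nonneg (x - 1)]

theorem mul_wt_le {r x : ℝ} (hr : 0 ≤ r) (hr1 : r ≤ 1) (hx : 0 ≤ x) : r * wt x ≤ wt (r * x) := by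
  unfold wt
  rw [mul_div_assoc']
  apply div_le_div_of_nonneg_left (by positivity) (by positivity)
  have h1 : r * x ≤ x := by nlinarith
  nlinarith [mul_nonneg hr hx]

theorem at3_mono {x y : ℝ} (hx : 0 ≤ x) (hxy : x ≤ y) : at3 x ≤ at3 y := by
  have hy : 0 ≤ y := hx.trans hxy
  unfold at3
  apply Real.arctan_mono
  rw [div_le_div_iff₀ (by positivity) (by positivity)]
  nlinarith [Real.sqrt_nonneg 3, mul_le_mul_of_nonneg_left hxy (Real.sqrt_nonneg 3)]

theorem at3_nonneg {x : ℝ} (hx : 0 ≤ x) : 0 ≤ at3 x := Real.arctan_nonneg.2 (by positivity)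

theorem at3_le {x : ℝ} (hx : 0 ≤ x) (hx1 : x ≤ 1) : at3 x ≤ Real.pi / 6 := by
  refine (at3_mono hx hx1).trans ?_
  rw [← Real.arctan_inv_sqrt_three, at3]
  apply Real.arctan_mono
  have h3 := Real.sq_sqrt (show (0 : ℝ) ≤ 3 by norm_num)
  have : (0 : ℝ) < √3 := by positivity
  rw [div_le_iff₀ (by norm_num), inv_mul_eq_div, le_div_iff₀ this]
  nlinarith

/-- Alternating sums of an antitone function along residues `1, 2` modulo `3`. -/
theorem sum_sub_mem_of_antitone {f : ℕ → ℝ} (hf : Antitone f) (n : ℕ) :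
    0 ≤ ∑ i ∈ range n, (f (3 * i + 1) - f (3 * i + 2)) ∧
      ∑ i ∈ range n, (f (3 * i + 1) - f (3 * i + 2)) ≤ f 1 - f (3 * n + 1) := by
  induction n with
  | zero => simp
  | succ n ih =>
    rw [sum_range_succ]
    have h1 := hf (show 3 * n + 1 ≤ 3 * n + 2 by omega)
    have h2 := hf (show 3 * n + 2 ≤ 3 * (n + 1) + 1 by omega)
    constructor <;> linarith [ih.1, ih.2]

theorem antitone_pow {r : ℝ} (h0 : 0 ≤ r) (h1 : r ≤ 1) : Antitone fun a : ℕ => r ^ a :=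
  fun _ _ h => pow_le_pow_of_le_one h0 h1 h

/-- The ratio `kt / wt`. -/
def gt (ρ : ℝ) : ℝ := (1 - ρ ^ 2) / (1 + ρ + ρ ^ 2)

theorem kt_eq (ρ : ℝ) : kt ρ = wt ρ * gt ρ := by
  unfold kt wt gt
  rw [div_mul_div_comm, sq (1 + ρ + ρ ^ 2)]

theorem gt_step {r ρ : ℝ} (hr : 0 ≤ r) (hr1 : r ≤ 1) (h0 : 0 ≤ ρ) (h1 : ρ ≤ 1) :
    gt ρ ≤ gt (r * ρ) ∧ gt (r * ρ) ≤ gt ρ + (1 - r) := by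
  have hq : 0 < 1 + ρ + ρ ^ 2 := by positivity
  have hq' : 0 < 1 + r * ρ + (r * ρ) ^ 2 := by positivity
  have e : gt (r * ρ) - gt ρ = (1 - r) * (ρ * (1 + 2 * ρ + 2 * (r * ρ) + ρ * (r * ρ)) /
      ((1 + ρ + ρ ^ 2) * (1 + r * ρ + (r * ρ) ^ 2))) := by
    unfold gt
    field_simp
    ring
  have b0 : 0 ≤ ρ * (1 + 2 * ρ + 2 * (r * ρ) + ρ * (r * ρ)) /
      ((1 + ρ + ρ ^ 2) * (1 + r * ρ + (r * ρ) ^ 2)) := by positivity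
  have b1 : ρ * (1 + 2 * ρ + 2 * (r * ρ) + ρ * (r * ρ)) /
      ((1 + ρ + ρ ^ 2) * (1 + r * ρ + (r * ρ) ^ 2)) ≤ 1 := by
    rw [div_le_one (by positivity)]
    have hx : 0 ≤ r * ρ := by positivity
    generalize r * ρ = x at *
    nlinarith [mul_nonneg hx (sub_nonneg.2 h1), mul_nonneg hq.le (sq_nonneg x)]
  constructor <;> nlinarith

theorem gt_nonneg {ρ : ℝ} (h0 : 0 ≤ ρ) (h1 : ρ ≤ 1) : 0 ≤ gt ρ := by
  unfold gt
  apply div_nonneg <;> nlinarith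

theorem gt_pow_le {r : ℝ} (hr : 0 ≤ r) (hr1 : r ≤ 1) (a : ℕ) : gt (r ^ a) ≤ a * (1 - r) := by
  induction a with
  | zero => simp [gt]
  | succ a ih =>
    rw [pow_succ']
    have := (gt_step hr hr1 (pow_nonneg hr a) (pow_le_one₀ hr hr1)).2
    push_cast
    linarith

theorem abs_sq_mul_kt_sub_le {r : ℝ} (hr : 0 ≤ r) (hr1 : r ≤ 1) (a : ℕ) :
    |(a : ℝ) ^ 2 * kt (r ^ a) - ((a + 1 : ℕ) : ℝ) ^ 2 * kt (r ^ (a + 1))| ≤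
      3 * (1 - r) * (((a + 1 : ℕ) : ℝ) ^ 2 * wt (r ^ a)) := by
  have p0 := pow_nonneg hr a
  have p1 : r ^ a ≤ 1 := pow_le_one₀ hr hr1
  have G := gt_step hr hr1 p0 p1
  have G2 := gt_pow_le hr hr1 (a + 1)
  have W1 := mul_wt_le hr hr1 p0
  have W2 : wt (r * r ^ a) ≤ wt (r ^ a) := wt_mono (by positivity) (by nlinarith) p1
  have g0 := gt_nonneg p0 p1
  have g2 : gt (r ^ a) ≤ 1 := by
    unfold gt
    rw [div_le_one (by positivity)]
    nlinarith
  have w0 := wt_nonneg p0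
  have w1 : 0 ≤ wt (r * r ^ a) := wt_nonneg (by positivity)
  rw [pow_succ' r a] at G2 ⊢
  rw [kt_eq, kt_eq]
  push_cast at G2 ⊢
  have ha : (0 : ℝ) ≤ a := Nat.cast_nonneg a
  generalize wt (r ^ a) = w at *
  generalize wt (r * r ^ a) = w' at *
  generalize gt (r ^ a) = g at *
  generalize gt (r * r ^ a) = g' at *
  generalize (a : ℝ) = x at *
  have hd : 0 ≤ 1 - r := by linarith
  have wd : 0 ≤ w * (1 - r) := by positivity
  rw [abs_le]
  constructor
  · have s1 : w' * g' ≤ w * g' := by nlinarith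
    have s2 : w * g' ≤ w * (g + (1 - r)) := by nlinarith
    have s3 : w * g' ≤ w * ((x + 1) * (1 - r)) := by nlinarith
    have s4 : x ^ 2 * (w * g') ≤ x ^ 2 * (w * (g + (1 - r))) := by gcongr
    have s5 : (2 * x + 1) * (w * g') ≤ (2 * x + 1) * (w * ((x + 1) * (1 - r))) := by gcongr
    have s6 : (x + 1) ^ 2 * (w' * g') ≤ (x + 1) ^ 2 * (w * g') := by gcongr
    nlinarith [mul_nonneg ha wd]
  · have s1 : w * g - w' * g' ≤ w * (1 - r) := by
      have : w' * g ≤ w' * g' := by nlinarith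
      have : (w - w') * g ≤ (w - w') * 1 := by
        apply mul_le_mul_of_nonneg_left g2; linarith
      nlinarith
    have s2 : (x + 1) ^ 2 * (w * g - w' * g') ≤ (x + 1) ^ 2 * (w * (1 - r)) := by gcongr
    have s3 : x ^ 2 * (w * g) ≤ (x + 1) ^ 2 * (w * g) := by gcongr; linarith
    nlinarith [mul_nonneg (sq_nonneg (x + 1)) wd]

/-- The primitive cube root of unity `e^{2πi/3}`. -/
def om : ℂ := ⟨-1 / 2, √3 / 2⟩

theorem om_sq : om ^ 2 = ⟨-1 / 2, -(√3 / 2)⟩ := by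
  have h3 := Real.sq_sqrt (show (0 : ℝ) ≤ 3 by norm_num)
  apply Complex.ext
  · rw [sq, mul_re]; simp only [om]; linarith
  · rw [sq, mul_im]; simp only [om]; ring

theorem om_cube : om ^ 3 = 1 := by
  have h3 := Real.sq_sqrt (show (0 : ℝ) ≤ 3 by norm_num)
  rw [pow_succ, om_sq]
  apply Complex.ext
  · rw [mul_re]; simp only [om, one_re]; linarith
  · rw [mul_im]; simp only [om, one_im]; ring

theorem om_pow_one (i : ℕ) : om ^ (3 * i + 1) = om := by
  rw [pow_succ, pow_mul, om_cube, one_pow, one_mul]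

theorem om_pow_two (i : ℕ) : om ^ (3 * i + 2) = om ^ 2 := by
  rw [pow_add, pow_mul, om_cube, one_pow, one_mul]

theorem mul_om_exp_pow (r θ : ℝ) (k : ℕ) :
    (r * om * exp (θ * I)) ^ k = ((r ^ k : ℝ) : ℂ) * om ^ k * exp (((k * θ : ℝ) : ℂ) * I) := by
  rw [mul_pow, mul_pow, ← exp_nat_mul]
  push_cast
  rw [mul_assoc (k : ℂ)]

theorem pair_exp {r θ : ℝ} (hr : 0 < r) (hr1 : r ≤ 1) (i : ℕ)
    (h1 : ((3 * i + 1 : ℕ) : ℝ) * |θ| ≤ 6 / 10 ∨ r ^ (3 * i + 1) ≤ 1 / 10)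
    (h2 : ((3 * i + 2 : ℕ) : ℝ) * |θ| ≤ 6 / 10 ∨ r ^ (3 * i + 2) ≤ 1 / 10) :
    ∃ U V : ℝ, (1 - (r * om * exp (θ * I)) ^ (3 * i + 1)) *
        (1 - (r * om * exp (θ * I)) ^ (3 * i + 2)) = exp (U + V * I) ∧
      Real.log (1 + r ^ (3 * i + 1) + (r ^ (3 * i + 1)) ^ 2) / 2 +
        Real.log (1 + r ^ (3 * i + 2) + (r ^ (3 * i + 2)) ^ 2) / 2 +
        θ * (√3 / 2 * (((3 * i + 1 : ℕ) : ℝ) * wt (r ^ (3 * i + 1)) -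
          ((3 * i + 2 : ℕ) : ℝ) * wt (r ^ (3 * i + 2)))) -
        θ ^ 2 / 2 * (2 * ((3 * i + 2 : ℕ) : ℝ) ^ 2 * wt (r ^ (3 * i + 1))) -
        3 / 10 * |θ| ^ 3 * (2 * ((3 * i + 2 : ℕ) : ℝ) ^ 3 * wt (r ^ (3 * i + 1))) ≤ U ∧
      |V - θ * (((3 * i + 1 : ℕ) : ℝ) * ht (r ^ (3 * i + 1)) +
          ((3 * i + 2 : ℕ) : ℝ) * ht (r ^ (3 * i + 2))) +
          (at3 (r ^ (3 * i + 1)) - at3 (r ^ (3 * i + 2)))| ≤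
        65 / 100 * (1 - r) * θ ^ 2 * (2 * ((3 * i + 2 : ℕ) : ℝ) ^ 2 * wt (r ^ (3 * i + 1))) +
        3 / 10 * |θ| ^ 3 * (2 * ((3 * i + 2 : ℕ) : ℝ) ^ 3 * wt (r ^ (3 * i + 1))) := by
  have hab : ∀ k : ℕ, |(k : ℝ) * θ| = (k : ℝ) * |θ| := fun k => by
    rw [abs_mul, Nat.abs_cast]
  obtain ⟨a1, b1, ha1, hb1, e1⟩ := factor_exp (ρ := r ^ (3 * i + 1)) (s := 1) (ω := om)
    (y := ((3 * i + 1 : ℕ) : ℝ) * θ) rfl (by simp [om]) (Or.inl rfl) (by positivity)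
    (pow_le_one₀ hr.le hr1) (by rw [hab]; exact h1)
  obtain ⟨a2, b2, ha2, hb2, e2⟩ := factor_exp (ρ := r ^ (3 * i + 2)) (s := -1) (ω := om ^ 2)
    (y := ((3 * i + 2 : ℕ) : ℝ) * θ) (by rw [om_sq]) (by rw [om_sq]; simp) (Or.inr rfl)
    (by positivity) (pow_le_one₀ hr.le hr1) (by rw [hab]; exact h2)
  have K := abs_sq_mul_kt_sub_le hr.le hr1 (3 * i + 1)
  rw [hab] at ha1 hb1 ha2 hb2
  have hx1 : ((3 * i + 1 : ℕ) : ℝ) + 1 = ((3 * i + 2 : ℕ) : ℝ) := by push_cast; ring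
  rw [mul_om_exp_pow, mul_om_exp_pow, om_pow_one, om_pow_two, e1, e2, ← exp_add]
  have w1 : 0 ≤ wt (r ^ (3 * i + 1)) := wt_nonneg (by positivity)
  have w2 : 0 ≤ wt (r ^ (3 * i + 2)) := wt_nonneg (by positivity)
  have w3 : wt (r ^ (3 * i + 2)) ≤ wt (r ^ (3 * i + 1)) :=
    wt_mono (by positivity) (antitone_pow hr.le hr1 (by omega)) (pow_le_one₀ hr.le hr1)
  have w4 : wt (r ^ (3 * i + 1)) ≤ 1 / 3 := wt_le_third (by positivity)
  have ec : ((3 * i + 2 : ℕ) : ℝ) = ((3 * i + 1 : ℕ) : ℝ) + 1 := by push_cast; ring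
  have ec2 : (((3 * i + 1 : ℕ) + 1 : ℕ) : ℝ) = ((3 * i + 1 : ℕ) : ℝ) + 1 := by push_cast; ring
  rw [ec2, show 3 * i + 1 + 1 = 3 * i + 2 by ring] at K
  rw [ec] at ha2 hb2 ⊢
  have x0 : (0 : ℝ) ≤ ((3 * i + 1 : ℕ) : ℝ) := Nat.cast_nonneg _
  generalize ((3 * i + 1 : ℕ) : ℝ) = x at *
  generalize wt (r ^ (3 * i + 1)) = w at *
  generalize wt (r ^ (3 * i + 2)) = w' at *
  have v0 := abs_nonneg θ
  have hθ : θ ^ 2 = |θ| ^ 2 := (sq_abs θ).symm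
  have cub : ∀ c : ℝ, (c * |θ|) ^ 3 = c ^ 3 * |θ| ^ 3 := fun c => mul_pow _ _ _
  rw [cub] at ha1 hb1 ha2 hb2
  have v3 : 0 ≤ |θ| ^ 3 := by positivity
  have c1 : w * x ^ 3 ≤ w * (x + 1) ^ 3 := by gcongr; linarith
  have c2 : w' * (x + 1) ^ 3 ≤ w * (x + 1) ^ 3 := by gcongr
  have c1' := mul_le_mul_of_nonneg_right c1 v3
  have c2' := mul_le_mul_of_nonneg_right c2 v3
  have d1 : x ^ 2 * (w + 3 * w ^ 2) ≤ (x + 1) ^ 2 * (2 * w) := by gcongr <;> nlinarith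
  have d2 : (x + 1) ^ 2 * (w' + 3 * w' ^ 2) ≤ (x + 1) ^ 2 * (2 * w) := by gcongr; nlinarith
  have d1' := mul_le_mul_of_nonneg_left d1 (sq_nonneg θ)
  have d2' := mul_le_mul_of_nonneg_left d2 (sq_nonneg θ)
  have A1 := abs_le.1 ha1
  have A2 := abs_le.1 ha2
  have B1 := abs_le.1 hb1
  have B2 := abs_le.1 hb2
  refine ⟨Real.log (1 + r ^ (3 * i + 1) + (r ^ (3 * i + 1)) ^ 2) / 2 +
      1 * (√3 / 2) * (x * θ * w) - (x * θ) ^ 2 / 4 * (w + 3 * w ^ 2) + a1 +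
      (Real.log (1 + r ^ (3 * i + 2) + (r ^ (3 * i + 2)) ^ 2) / 2 +
      -1 * (√3 / 2) * ((x + 1) * θ * w') - ((x + 1) * θ) ^ 2 / 4 * (w' + 3 * w' ^ 2) + a2),
    -1 * at3 (r ^ (3 * i + 1)) + x * θ * ht (r ^ (3 * i + 1)) +
      1 * (√3 / 4) * ((x * θ) ^ 2 * kt (r ^ (3 * i + 1))) + b1 +
      (- -1 * at3 (r ^ (3 * i + 2)) + (x + 1) * θ * ht (r ^ (3 * i + 2)) +
      -1 * (√3 / 4) * (((x + 1) * θ) ^ 2 * kt (r ^ (3 * i + 2))) + b2), ?_, ?_, ?_⟩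
  · congr 1
    push_cast
    ring
  · nlinarith only [A1.1, A2.1, c1', c2', d1', d2']
  · have h3 : √3 ≤ 1.7333 := by
      rw [Real.sqrt_le_left (by norm_num)]; norm_num
    have h30 := Real.sqrt_nonneg 3
    have Q := mul_nonneg (sq_nonneg θ) (mul_nonneg (mul_nonneg (by norm_num : (0 : ℝ) ≤ 3)
      (sub_nonneg.2 hr1)) (mul_nonneg (sq_nonneg (x + 1)) w1))
    have K' := mul_le_mul_of_nonneg_left K (show 0 ≤ √3 / 4 * θ ^ 2 by positivity)
    have Q' := mul_le_mul_of_nonneg_left h3 Q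
    have ad : ∀ A B : ℝ, |A| ≤ B → √3 / 4 * θ ^ 2 * |A| = |√3 / 4 * θ ^ 2 * A| := by
      intro A B _
      rw [abs_mul, abs_of_nonneg (show 0 ≤ √3 / 4 * θ ^ 2 by positivity)]
    rw [ad _ _ K] at K'
    obtain ⟨K1, K2⟩ := abs_le.1 K'
    rw [abs_le]
    constructor
    · nlinarith only [K1, Q', B1.1, B2.1, c1', c2', Q]
    · nlinarith only [K2, Q', B1.2, B2.2, c1', c2', Q]

/-- Lower bound for the integrand near the saddle point. -/
theorem inner_lower {n m : ℕ} {r θ : ℝ} (hr : 0 < r) (hr1 : r ≤ 1)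
    (hs : saddle n r = 3 * m)
    (hv : ∀ a : ℕ, a ≤ 3 * n → (a : ℝ) * |θ| ≤ 6 / 10 ∨ r ^ a ≤ 1 / 10)
    (hp : Real.pi / 6 + 65 / 100 * (1 - r) * powSum 2 n r * θ ^ 2 +
      3 / 10 * powSum 3 n r * |θ| ^ 3 ≤ Real.pi / 2) :
    Real.exp (logN n r + drift n r * θ - powSum 2 n r / 2 * θ ^ 2 -
        3 / 10 * powSum 3 n r * |θ| ^ 3) *
      Real.cos (Real.pi / 6 + 65 / 100 * (1 - r) * powSum 2 n r * θ ^ 2 +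
        3 / 10 * powSum 3 n r * |θ| ^ 3) ≤
      (bz n (r * om * exp (θ * I)) * exp (-((3 * m * θ : ℝ) : ℂ) * I)).re := by
  have H : ∀ i : ℕ, ∃ U V : ℝ, i ∈ range n → _ := fun i => by
    by_cases hi : i ∈ range n
    · have hi' := mem_range.1 hi
      obtain ⟨U, V, h⟩ := pair_exp hr hr1 i (hv _ (by omega)) (hv _ (by omega))
      exact ⟨U, V, fun _ => h⟩
    · exact ⟨0, 0, fun h => absurd h hi⟩
  choose U V h using H
  have e : bz n (r * om * exp (θ * I)) =
      exp (((∑ i ∈ range n, U i : ℝ) : ℂ) + ((∑ i ∈ range n, V i : ℝ) : ℂ) * I) := by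
    rw [bz, prod_congr rfl fun i hi => (h i hi).1, ← exp_sum, sum_add_distrib, ← sum_mul]
    push_cast
    rfl
  have hU : logN n r + drift n r * θ - powSum 2 n r / 2 * θ ^ 2 -
        3 / 10 * powSum 3 n r * |θ| ^ 3 ≤ ∑ i ∈ range n, U i := by
    refine le_trans (le_of_eq ?_) (sum_le_sum fun i hi => (h i hi).2.1)
    simp only [logN, drift, powSum, mul_sum, sum_mul, sum_div, ← sum_add_distrib, ← sum_sub_distrib]
    exact sum_congr rfl fun i _ => by ring
  have hV : |∑ i ∈ range n, V i - 3 * m * θ + ∑ i ∈ range n,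
      (at3 (r ^ (3 * i + 1)) - at3 (r ^ (3 * i + 2)))| ≤
      65 / 100 * (1 - r) * powSum 2 n r * θ ^ 2 + 3 / 10 * powSum 3 n r * |θ| ^ 3 := by
    have e1 := (abs_sum_le_sum_abs _ _).trans (sum_le_sum fun i hi => (h i hi).2.2)
    rw [sum_add_distrib, sum_sub_distrib, sum_add_distrib, ← mul_sum, ← mul_sum, ← mul_sum] at e1
    rw [← hs]
    unfold saddle powSum
    refine (le_of_eq ?_).trans (e1.trans (le_of_eq ?_))
    · congr 1; ring
    · ring
  have hat := sum_sub_mem_of_antitone (f := fun a => at3 (r ^ a))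
    (fun a b hab => at3_mono (by positivity) (antitone_pow hr.le hr1 hab)) n
  have hat' : ∑ i ∈ range n, (at3 (r ^ (3 * i + 1)) - at3 (r ^ (3 * i + 2))) ≤ Real.pi / 6 := by
    have h1 := at3_le (pow_nonneg hr.le 1) (pow_le_one₀ hr.le hr1)
    have h2 := at3_nonneg (pow_nonneg hr.le (3 * n + 1))
    exact hat.2.trans (by linarith)
  have hph : |∑ i ∈ range n, V i - 3 * m * θ| ≤ Real.pi / 6 +
      65 / 100 * (1 - r) * powSum 2 n r * θ ^ 2 + 3 / 10 * powSum 3 n r * |θ| ^ 3 := by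
    have := hat.1
    rw [abs_le] at hV ⊢
    have hpi := Real.pi_pos
    constructor <;> linarith [hV.1, hV.2]
  rw [e, ← exp_add]
  have e2 : ((∑ i ∈ range n, U i : ℝ) : ℂ) + ((∑ i ∈ range n, V i : ℝ) : ℂ) * I +
      -((3 * m * θ : ℝ) : ℂ) * I = ((∑ i ∈ range n, U i : ℝ) : ℂ) +
      ((∑ i ∈ range n, V i - 3 * m * θ : ℝ) : ℂ) * I := by
    push_cast; ring
  have e3 : ∀ a b : ℝ, (exp ((a : ℂ) + (b : ℂ) * I)).re = Real.exp a * Real.cos b := by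
    intro a b
    rw [exp_re]; simp
  rw [e2, e3, ← Real.cos_abs (_ - _)]
  apply mul_le_mul (Real.exp_le_exp.2 hU) _ _ (Real.exp_pos _).le
  · exact Real.cos_le_cos_of_nonneg_of_le_pi (abs_nonneg _) (by linarith [Real.pi_pos]) hph
  · apply Real.cos_nonneg_of_neg_pi_div_two_le_of_le _ hp
    linarith [abs_nonneg (∑ i ∈ range n, V i - 3 * m * θ), Real.pi_pos]

/-- The weight sum `∑ wt (r ^ (3 i + 2))`. -/
def ysum (n : ℕ) (r : ℝ) : ℝ := ∑ i ∈ range n, wt (r ^ (3 * i + 2))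

theorem abel_lower {W a : ℕ → ℝ} {L : ℝ} (hW : Antitone W) (hW0 : ∀ i, 0 ≤ W i)
    (ha : ∀ k, L ≤ ∑ i ∈ range k, a i) (n : ℕ) : W 0 * L ≤ ∑ i ∈ range n, W i * a i := by
  have H : ∀ n, L * (W 0 - W n) + W n * ∑ i ∈ range n, a i ≤ ∑ i ∈ range n, W i * a i := by
    intro n
    induction n with
    | zero => simp
    | succ n ih =>
      have h1 := ha (n + 1)
      rw [sum_range_succ] at h1 ⊢
      rw [sum_range_succ]
      nlinarith [mul_nonneg (sub_nonneg.2 (hW (Nat.le_succ n))) (sub_nonneg.2 h1)]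
  nlinarith [H n, mul_nonneg (hW0 n) (sub_nonneg.2 (ha n))]

theorem sum_cos_mul_sin (x : ℝ) (k : ℕ) :
    (∑ i ∈ range k, Real.cos ((3 * i + 3 / 2) * x)) * (2 * Real.sin (3 / 2 * x)) =
      Real.sin (3 * k * x) := by
  induction k with
  | zero => simp
  | succ k ih =>
    rw [sum_range_succ, add_mul, ih]
    push_cast
    have e1 : 3 * (k : ℝ) * x = (3 * k + 3 / 2) * x - 3 / 2 * x := by ring
    have e2 : 3 * ((k : ℝ) + 1) * x = (3 * k + 3 / 2) * x + 3 / 2 * x := by ring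
    rw [e1, e2, Real.sin_sub, Real.sin_add]
    ring

theorem norm_one_sub_le {r φ : ℝ} (hr : 0 ≤ r) (a : ℕ) :
    ‖1 - (r * exp (φ * I)) ^ a‖ ≤ Real.exp (Real.log (1 + r ^ a + (r ^ a) ^ 2) / 2 -
      wt (r ^ a) * (1 + 2 * Real.cos (a * φ)) / 2) := by
  have hp : 0 ≤ r ^ a := by positivity
  have hq : 0 < 1 + r ^ a + (r ^ a) ^ 2 := by positivity
  have e : (r * exp (φ * I)) ^ a = ((r ^ a : ℝ) : ℂ) * exp (((a * φ : ℝ) : ℂ) * I) := by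
    rw [mul_pow, ← exp_nat_mul]
    push_cast
    rw [mul_assoc (a : ℂ)]
  have h2 : ‖1 - (r * exp (φ * I)) ^ a‖ ^ 2 = (1 + r ^ a + (r ^ a) ^ 2) *
      (1 - wt (r ^ a) * (1 + 2 * Real.cos (a * φ))) := by
    rw [normSq_one_sub, e, norm_mul, norm_exp_ofReal_mul_I, Complex.norm_real, re_ofReal_mul,
      exp_ofReal_mul_I_re, Real.norm_of_nonneg hp, wt]
    field_simp
    ring
  rw [← abs_of_nonneg (norm_nonneg (1 - (r * exp (φ * I)) ^ a)),
    ← abs_of_pos (Real.exp_pos (_ - _)), ← sq_le_sq, h2, ← Real.exp_nat_mul]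
  have : ((2 : ℕ) : ℝ) * (Real.log (1 + r ^ a + (r ^ a) ^ 2) / 2 -
      wt (r ^ a) * (1 + 2 * Real.cos (a * φ)) / 2) = Real.log (1 + r ^ a + (r ^ a) ^ 2) +
      -(wt (r ^ a) * (1 + 2 * Real.cos (a * φ))) := by push_cast; ring
  rw [this, Real.exp_add, Real.exp_log hq]
  apply mul_le_mul_of_nonneg_left _ hq.le
  linarith [Real.add_one_le_exp (-(wt (r ^ a) * (1 + 2 * Real.cos (a * φ))))]

theorem norm_bz_le {r : ℝ} (hr : 0 < r) (hr1 : r ≤ 1) (n : ℕ) (φ : ℝ) :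
    ‖bz n (r * exp (φ * I))‖ ≤ Real.exp (logN n r -
      (∑ i ∈ range n, wt (r ^ (3 * i + 2)) *
        (2 + 4 * Real.cos (φ / 2) * Real.cos ((3 * i + 3 / 2) * φ))) / 2 + 1 / 6) := by
  have h1 : ‖bz n (r * exp (φ * I))‖ ≤ Real.exp (∑ i ∈ range n,
      ((Real.log (1 + r ^ (3 * i + 1) + (r ^ (3 * i + 1)) ^ 2) / 2 -
        wt (r ^ (3 * i + 1)) * (1 + 2 * Real.cos ((3 * i + 1 : ℕ) * φ)) / 2) +
      (Real.log (1 + r ^ (3 * i + 2) + (r ^ (3 * i + 2)) ^ 2) / 2 -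
        wt (r ^ (3 * i + 2)) * (1 + 2 * Real.cos ((3 * i + 2 : ℕ) * φ)) / 2))) := by
    rw [bz, norm_prod, Real.exp_sum]
    refine prod_le_prod (fun _ _ => norm_nonneg _) fun i _ => ?_
    rw [norm_mul, Real.exp_add]
    exact mul_le_mul (norm_one_sub_le hr.le _) (norm_one_sub_le hr.le _) (norm_nonneg _)
      (Real.exp_pos _).le
  refine h1.trans (Real.exp_le_exp.2 ?_)
  have hanti : Antitone fun a : ℕ => wt (r ^ a) := fun a b hab =>
    wt_mono (by positivity) (antitone_pow hr.le hr1 hab) (pow_le_one₀ hr.le hr1)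
  have h2 := (sum_sub_mem_of_antitone hanti n).2
  have h3 : wt (r ^ 1) ≤ 1 / 3 := wt_le_third (by positivity)
  have h4 : 0 ≤ wt (r ^ (3 * n + 1)) := wt_nonneg (by positivity)
  have h5 : ∑ i ∈ range n, ((Real.log (1 + r ^ (3 * i + 1) + (r ^ (3 * i + 1)) ^ 2) / 2 -
        wt (r ^ (3 * i + 1)) * (1 + 2 * Real.cos ((3 * i + 1 : ℕ) * φ)) / 2) +
      (Real.log (1 + r ^ (3 * i + 2) + (r ^ (3 * i + 2)) ^ 2) / 2 -
        wt (r ^ (3 * i + 2)) * (1 + 2 * Real.cos ((3 * i + 2 : ℕ) * φ)) / 2)) ≤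
      ∑ i ∈ range n, ((Real.log (1 + r ^ (3 * i + 1) + (r ^ (3 * i + 1)) ^ 2) / 2 +
        Real.log (1 + r ^ (3 * i + 2) + (r ^ (3 * i + 2)) ^ 2) / 2) -
        wt (r ^ (3 * i + 2)) * (2 + 4 * Real.cos (φ / 2) *
          Real.cos ((3 * i + 3 / 2) * φ)) / 2 +
        (wt (r ^ (3 * i + 1)) - wt (r ^ (3 * i + 2))) / 2) := by
    refine sum_le_sum fun i _ => ?_
    have e1 : ((3 * i + 1 : ℕ) : ℝ) * φ = (3 * i + 3 / 2) * φ - φ / 2 := by push_cast; ring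
    have e2 : ((3 * i + 2 : ℕ) : ℝ) * φ = (3 * i + 3 / 2) * φ + φ / 2 := by push_cast; ring
    have e3 : 2 + 4 * Real.cos (φ / 2) * Real.cos ((3 * i + 3 / 2) * φ) =
        (1 + 2 * Real.cos ((3 * i + 1 : ℕ) * φ)) + (1 + 2 * Real.cos ((3 * i + 2 : ℕ) * φ)) := by
      rw [e1, e2, Real.cos_sub, Real.cos_add]; ring
    rw [e3]
    have hm := hanti (show 3 * i + 1 ≤ 3 * i + 2 by omega)
    have hc := Real.neg_one_le_cos ((3 * i + 1 : ℕ) * φ)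
    simp only [] at hm
    nlinarith [mul_nonneg (sub_nonneg.2 hm) (show 0 ≤ 1 + Real.cos ((3 * i + 1 : ℕ) * φ) by
      linarith)]
  refine h5.trans ?_
  rw [sum_add_distrib, sum_sub_distrib, ← sum_div, ← sum_div]
  unfold logN
  linarith

theorem one_sub_cos_ge (x : ℝ) : x ^ 2 / 2 - x ^ 4 / 24 ≤ 1 - Real.cos x := by
  wlog hx : 0 ≤ x generalizing x
  · have := this (-x) (by linarith)
    rw [Real.cos_neg] at this
    nlinarith
  have h1 := Real.sin_ge_sub_cube (show 0 ≤ x / 2 by linarith)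
  have h2 : Real.cos x = 1 - 2 * Real.sin (x / 2) ^ 2 := by
    have h3 := Real.cos_two_mul (x / 2)
    rw [show 2 * (x / 2) = x by ring] at h3
    linarith [Real.sin_sq_add_cos_sq (x / 2)]
  rw [h2]
  by_cases h : 0 ≤ x / 2 - (x / 2) ^ 3 / 6
  · have := pow_le_pow_left₀ h h1 2
    nlinarith [sq_nonneg (x ^ 3)]
  · push Not at h
    have : 24 < x ^ 2 := by
      by_contra hc
      nlinarith [mul_nonneg hx (show 0 ≤ 24 - x ^ 2 by linarith)]
    nlinarith [sq_nonneg (Real.sin (x / 2))]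

theorem antitone_wt {r : ℝ} (hr : 0 < r) (hr1 : r ≤ 1) :
    Antitone fun i : ℕ => wt (r ^ (3 * i + 2)) := fun a b hab =>
  wt_mono (by positivity) (antitone_pow hr.le hr1 (by omega)) (pow_le_one₀ hr.le hr1)

theorem phase_factor (i : ℕ) (θ : ℝ) :
    Real.cos ((3 * i + 3 / 2) * (2 * Real.pi / 3 + θ)) = -Real.cos ((3 * i + 3 / 2) * θ) := by
  rw [show (3 * (i : ℝ) + 3 / 2) * (2 * Real.pi / 3 + θ) =
    ((3 * i + 3 / 2) * θ + Real.pi) + i * (2 * Real.pi) by ring, Real.cos_add_nat_mul_two_pi,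
    Real.cos_add_pi]

theorem cos_third_sub_le (θ : ℝ) : |1 - 2 * Real.cos (Real.pi / 3 + θ / 2)| ≤ |θ| := by
  have h := Real.abs_cos_sub_cos_le (Real.pi / 3) (Real.pi / 3 + θ / 2)
  rw [Real.cos_pi_div_three] at h
  have e : 1 - 2 * Real.cos (Real.pi / 3 + θ / 2) =
    2 * (1 / 2 - Real.cos (Real.pi / 3 + θ / 2)) := by ring
  rw [e, abs_mul, abs_two]
  have e2 : |Real.pi / 3 - (Real.pi / 3 + θ / 2)| = |θ| / 2 := by
    rw [show Real.pi / 3 - (Real.pi / 3 + θ / 2) = -(θ / 2) by ring, abs_neg, abs_div, abs_two]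
  linarith

/-- Bound near the cube root of unity. -/
theorem norm_bz_near {r : ℝ} (hr : 0 < r) (hr1 : r ≤ 1) {n M : ℕ} (hM : M ≤ n) (θ : ℝ) :
    ‖bz n (r * exp ((2 * Real.pi / 3 + θ : ℝ) * I))‖ ≤ Real.exp (logN n r -
      (∑ i ∈ range M, wt (r ^ (3 * i + 2)) * (3 * i + 3 / 2 : ℝ) ^ 2) * θ ^ 2 / 2 +
      (∑ i ∈ range M, wt (r ^ (3 * i + 2)) * (3 * i + 3 / 2 : ℝ) ^ 4) * θ ^ 4 / 24 +
      ysum n r * |θ| + 1 / 6) := by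
  refine (norm_bz_le hr hr1 n _).trans (Real.exp_le_exp.2 ?_)
  have key : ∑ i ∈ range M, wt (r ^ (3 * i + 2)) * (2 * (1 - Real.cos ((3 * i + 3 / 2) * θ))) -
      2 * |θ| * ysum n r ≤ ∑ i ∈ range n, wt (r ^ (3 * i + 2)) *
        (2 + 4 * Real.cos ((2 * Real.pi / 3 + θ) / 2) *
          Real.cos ((3 * i + 3 / 2) * (2 * Real.pi / 3 + θ))) := by
    have h1 : ∑ i ∈ range M, wt (r ^ (3 * i + 2)) * (2 * (1 - Real.cos ((3 * i + 3 / 2) * θ))) ≤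
        ∑ i ∈ range n, wt (r ^ (3 * i + 2)) * (2 * (1 - Real.cos ((3 * i + 3 / 2) * θ))) :=
      sum_le_sum_of_subset_of_nonneg (range_mono hM) fun i _ _ => mul_nonneg
        (wt_nonneg (by positivity)) (by linarith [Real.cos_le_one ((3 * i + 3 / 2) * θ)])
    refine (sub_le_sub_right h1 _).trans ?_
    rw [ysum, mul_sum, ← sum_sub_distrib]
    refine sum_le_sum fun i _ => ?_
    rw [phase_factor, show (2 * Real.pi / 3 + θ) / 2 = Real.pi / 3 + θ / 2 by ring]
    have w0 : 0 ≤ wt (r ^ (3 * i + 2)) := wt_nonneg (by positivity)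
    have h2 : |(1 - 2 * Real.cos (Real.pi / 3 + θ / 2)) * Real.cos ((3 * i + 3 / 2) * θ)| ≤ |θ| :=
        by
      rw [abs_mul]
      have := mul_le_mul (cos_third_sub_le θ) (Real.abs_cos_le_one ((3 * i + 3 / 2) * θ))
        (abs_nonneg _) (abs_nonneg _)
      linarith
    have := mul_nonneg w0 (by linarith [(abs_le.1 h2).1] : 0 ≤ (1 - 2 * Real.cos
      (Real.pi / 3 + θ / 2)) * Real.cos ((3 * i + 3 / 2) * θ) + |θ|)
    nlinarith
  have h3 : (∑ i ∈ range M, wt (r ^ (3 * i + 2)) * (3 * i + 3 / 2 : ℝ) ^ 2) * θ ^ 2 -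
      (∑ i ∈ range M, wt (r ^ (3 * i + 2)) * (3 * i + 3 / 2 : ℝ) ^ 4) * θ ^ 4 / 12 ≤
      ∑ i ∈ range M, wt (r ^ (3 * i + 2)) * (2 * (1 - Real.cos ((3 * i + 3 / 2) * θ))) := by
    rw [sum_mul, sum_mul, sum_div, ← sum_sub_distrib]
    refine sum_le_sum fun i _ => ?_
    have w0 : 0 ≤ wt (r ^ (3 * i + 2)) := wt_nonneg (by positivity)
    have := mul_le_mul_of_nonneg_left (one_sub_cos_ge ((3 * i + 3 / 2) * θ)) w0
    nlinarith
  linarith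

theorem wt_mul_le_third (r L : ℝ) (hr : 0 < r) (hL : 0 ≤ L) :
    wt (r ^ (3 * 0 + 2)) * L ≤ L / 3 := by
  have : wt (r ^ (3 * 0 + 2)) ≤ 1 / 3 := wt_le_third (by positivity)
  nlinarith

/-- Bound away from the cube root of unity. -/
theorem norm_bz_far {r : ℝ} (hr : 0 < r) (hr1 : r ≤ 1) {n : ℕ} {θ : ℝ} (h0 : θ ≠ 0)
    (hθ : |θ| ≤ Real.pi / 3) :
    ‖bz n (r * exp ((2 * Real.pi / 3 + θ : ℝ) * I))‖ ≤ Real.exp (logN n r - ysum n r +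
      1 / (9 * |θ|) + 5 / 12) := by
  refine (norm_bz_le hr hr1 n _).trans (Real.exp_le_exp.2 ?_)
  have hv : 0 < |θ| := abs_pos.2 h0
  have hpi := Real.pi_lt_d4
  have hs := Real.sin_gt_sub_cube (show 0 < 3 / 2 * |θ| by positivity)
  have hs' : 0 < Real.sin (3 / 2 * |θ|) := Real.sin_pos_of_pos_of_lt_pi (by positivity)
      (by linarith)
  set c := Real.cos (Real.pi / 3 + θ / 2) with hc
  have hc0 : 0 ≤ c := by
    have := abs_le.1 hθ
    exact Real.cos_nonneg_of_neg_pi_div_two_le_of_le (by linarith [Real.pi_pos]) (by linarith)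
  have hc1 : c ≤ 1 / 2 + 0.4331 * |θ| := by
    have h3 : √3 ≤ 1.7324 := by rw [Real.sqrt_le_left (by norm_num)]; norm_num
    have h30 := Real.sqrt_nonneg 3
    rw [hc, Real.cos_add, Real.cos_pi_div_three, Real.sin_pi_div_three]
    have a1 := Real.cos_le_one (θ / 2)
    have a2 := Real.abs_sin_le_abs (x := θ / 2)
    rw [abs_div, abs_two] at a2
    have a3 := (abs_le.1 a2).1
    nlinarith
  have hcs : c / (3 * Real.sin (3 / 2 * |θ|)) ≤ 1 / (9 * |θ|) + 1 / 4 := by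
    rw [div_add_div _ _ (by positivity) (by norm_num), div_le_div_iff₀ (by positivity)
        (by positivity)]
    have q : |θ| ≤ 1.0472 := by linarith
    generalize |θ| = v at *
    have b1 : c * (9 * v * 4) ≤ (1 / 2 + 0.4331 * v) * (9 * v * 4) := by gcongr
    have b2 : (1 * 4 + 9 * v * 1) * (3 * (3 / 2 * v - (3 / 2 * v) ^ 3 / 6)) ≤
      (1 * 4 + 9 * v * 1) * (3 * Real.sin (3 / 2 * v)) := by gcongr
    refine b1.trans (le_trans ?_ b2)
    have : 0 ≤ v ^ 2 * (40.5 - 15.5916 - 6.75 * v - 15.1875 * v ^ 2) := by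
      apply mul_nonneg (sq_nonneg _); nlinarith
    nlinarith
  have key : ∀ k, -(c * 4 / (2 * Real.sin (3 / 2 * |θ|))) ≤
      ∑ i ∈ range k, -(4 * c * Real.cos ((3 * i + 3 / 2) * θ)) := by
    intro k
    have e := sum_cos_mul_sin |θ| k
    have e2 : ∀ i : ℕ, Real.cos ((3 * i + 3 / 2) * |θ|) = Real.cos ((3 * i + 3 / 2) * θ) := by
      intro i
      rw [← Real.cos_abs ((3 * i + 3 / 2) * θ), abs_mul, abs_of_nonneg (by positivity :
        (0 : ℝ) ≤ 3 * i + 3 / 2)]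
    simp only [e2] at e
    rw [sum_neg_distrib, ← mul_sum, neg_le_neg_iff, le_div_iff₀ (by positivity), mul_assoc, e]
    nlinarith [Real.sin_le_one (3 * k * |θ|)]
  have ab := abel_lower (antitone_wt hr hr1) (fun i => wt_nonneg (by positivity)) key n
  have e3 : ∑ i ∈ range n, wt (r ^ (3 * i + 2)) *
        (2 + 4 * Real.cos ((2 * Real.pi / 3 + θ) / 2) *
          Real.cos ((3 * i + 3 / 2) * (2 * Real.pi / 3 + θ))) = 2 * ysum n r +
      ∑ i ∈ range n, wt (r ^ (3 * i + 2)) * -(4 * c * Real.cos ((3 * i + 3 / 2) * θ)) := by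
    rw [ysum, mul_sum, ← sum_add_distrib]
    refine sum_congr rfl fun i _ => ?_
    rw [phase_factor, show (2 * Real.pi / 3 + θ) / 2 = Real.pi / 3 + θ / 2 by ring]
    ring
  have t := wt_mul_le_third r (c * 4 / (2 * Real.sin (3 / 2 * |θ|))) hr (by positivity)
  have e4 : c * 4 / (2 * Real.sin (3 / 2 * |θ|)) / 3 = 2 * (c / (3 * Real.sin (3 / 2 * |θ|))) := by
    field_simp; ring
  rw [e3]
  linarith

/-- Bound on the first third of the circle. -/
theorem norm_bz_first {r : ℝ} (hr : 0 < r) (hr1 : r ≤ 1) {n : ℕ} {φ : ℝ} (h0 : 0 < φ)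
    (hφ : φ ≤ Real.pi / 3) (hY : 2 ≤ ysum n r) :
    ‖bz n (r * exp ((φ : ℝ) * I))‖ ≤ Real.exp (logN n r - ysum n r / 2 + 1 / 6) := by
  refine (norm_bz_le hr hr1 n _).trans (Real.exp_le_exp.2 ?_)
  have hpi := Real.pi_lt_d4
  have hs' : 0 < Real.sin (3 / 2 * φ) := Real.sin_pos_of_pos_of_lt_pi (by positivity) (by linarith)
  have hc0 : 0 ≤ Real.cos (φ / 2) :=
    Real.cos_nonneg_of_neg_pi_div_two_le_of_le (by linarith [Real.pi_pos]) (by linarith)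
  have hc1 := Real.cos_le_one (φ / 2)
  have e0 : ∀ k : ℕ, ∑ i ∈ range k, 4 * Real.cos (φ / 2) * Real.cos ((3 * i + 3 / 2) * φ) =
      2 * Real.cos (φ / 2) * Real.sin (3 * k * φ) / Real.sin (3 / 2 * φ) := by
    intro k
    rw [← mul_sum, eq_div_iff hs'.ne', ← sum_cos_mul_sin]
    ring
  rcases le_total φ (3 / 10) with h | h
  · have key : ∀ k, (0 : ℝ) ≤ ∑ i ∈ range k,
        (1 + 4 * Real.cos (φ / 2) * Real.cos ((3 * i + 3 / 2) * φ)) := by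
      intro k
      rw [sum_add_distrib, e0, sum_const, card_range, nsmul_eq_mul, mul_one]
      have hs := Real.sin_gt_sub_cube (show 0 < 3 / 2 * φ by positivity)
      have hs2 : 0.9661 * (3 / 2 * φ) ≤ Real.sin (3 / 2 * φ) := by
        nlinarith [mul_nonneg h0.le (show 0 ≤ 0.09 - φ ^ 2 by nlinarith)]
      have h1 : -(Real.sin (3 * k * φ)) ≤ k * Real.sin (3 / 2 * φ) / 2 := by
        rcases le_total (3 * k * φ) Real.pi with hk | hk
        · have := Real.sin_nonneg_of_nonneg_of_le_pi (by positivity) hk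
          have : 0 ≤ k * Real.sin (3 / 2 * φ) / 2 := by positivity
          linarith
        · have p3 := Real.pi_gt_d6
          have i1 : -(Real.sin (3 * k * φ)) ≤ 3 * k * φ - Real.pi := by
            rw [← Real.sin_sub_pi]
            exact Real.sin_le (by linarith)
          have i2 := Real.neg_one_le_sin (3 * k * φ)
          have i3 : (k : ℝ) * (0.9661 * (3 / 2 * φ)) ≤ k * Real.sin (3 / 2 * φ) := by gcongr
          rcases le_total (3 * k * φ) (Real.pi + 1) with hk2 | hk2 <;> nlinarith
      have h2 : -(2 * Real.cos (φ / 2) * Real.sin (3 * k * φ)) ≤ k * Real.sin (3 / 2 * φ) := by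
        have : 0 ≤ k * Real.sin (3 / 2 * φ) / 2 := by positivity
        nlinarith
      have h3 : -(k : ℝ) ≤ 2 * Real.cos (φ / 2) * Real.sin (3 * k * φ) / Real.sin (3 / 2 * φ) := by
        rw [le_div_iff₀ hs']; linarith
      linarith
    have ab := abel_lower (antitone_wt hr hr1) (fun i => wt_nonneg (by positivity)) key n
    have e3 : ∑ i ∈ range n, wt (r ^ (3 * i + 2)) *
        (2 + 4 * Real.cos (φ / 2) * Real.cos ((3 * i + 3 / 2) * φ)) = ysum n r +
      ∑ i ∈ range n, wt (r ^ (3 * i + 2)) *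
        (1 + 4 * Real.cos (φ / 2) * Real.cos ((3 * i + 3 / 2) * φ)) := by
      rw [ysum, ← sum_add_distrib]
      exact sum_congr rfl fun i _ => by ring
    rw [e3]
    linarith
  · have hs2 : 0.43 ≤ Real.sin (3 / 2 * φ) := by
      have hs := Real.sin_gt_sub_cube (show (0 : ℝ) < 0.45 by norm_num)
      have : Real.sin 0.45 ≤ Real.sin (3 / 2 * φ) := Real.sin_le_sin_of_le_of_le_pi_div_two
        (by linarith [Real.pi_pos]) (by linarith) (by linarith)
      norm_num at *
      linarith
    have key : ∀ k, (-5 : ℝ) ≤ ∑ i ∈ range k,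
        4 * Real.cos (φ / 2) * Real.cos ((3 * i + 3 / 2) * φ) := by
      intro k
      rw [e0, le_div_iff₀ hs']
      nlinarith [Real.neg_one_le_sin (3 * k * φ)]
    have ab := abel_lower (antitone_wt hr hr1) (fun i => wt_nonneg (by positivity)) key n
    have e3 : ∑ i ∈ range n, wt (r ^ (3 * i + 2)) *
        (2 + 4 * Real.cos (φ / 2) * Real.cos ((3 * i + 3 / 2) * φ)) = 2 * ysum n r +
      ∑ i ∈ range n, wt (r ^ (3 * i + 2)) *
        (4 * Real.cos (φ / 2) * Real.cos ((3 * i + 3 / 2) * φ)) := by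
      rw [ysum, mul_sum, ← sum_add_distrib]
      exact sum_congr rfl fun i _ => by ring
    have t := wt_mul_le_third r 5 hr (by norm_num)
    rw [e3]
    linarith

end

theorem step_sum_integral {f : ℝ → ℝ} {a b h : ℝ} (hh : 0 < h) (k : ℕ) (hb : b = a + h * k)
    (hf : AntitoneOn f (Set.Icc a b)) :
    h * ∑ i ∈ range k, f (a + h * (i + 1 : ℕ)) ≤ ∫ x in a..b, f x ∧
      ∫ x in a..b, f x ≤ h * ∑ i ∈ range k, f (a + h * i) := by
  subst hb
  have hg : AntitoneOn (fun u => f (a + h * u)) (Set.Icc 0 (0 + (k : ℝ))) := by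
    intro u hu v hv huv
    have hm : ∀ w ∈ Set.Icc (0 : ℝ) (0 + (k : ℝ)), a + h * w ∈ Set.Icc a (a + h * k) := by
      intro w hw
      rw [zero_add] at hw
      exact ⟨by nlinarith [hw.1], by nlinarith [hw.2]⟩
    exact hf (hm u hu) (hm v hv) (by nlinarith)
  have e : ∫ u in (0 : ℝ)..(0 + (k : ℝ)), f (a + h * u) = h⁻¹ * ∫ x in a..(a + h * k), f x := by
    rw [intervalIntegral.integral_comp_add_mul f hh.ne']
    simp
  have h1 := hg.sum_le_integral
  have h2 := hg.integral_le_sum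
  rw [e] at h1 h2
  simp only [zero_add] at h1 h2
  constructor
  · have := mul_le_mul_of_nonneg_left h1 hh.le
    rwa [mul_inv_cancel_left₀ hh.ne'] at this
  · have := mul_le_mul_of_nonneg_left h2 hh.le
    rwa [mul_inv_cancel_left₀ hh.ne'] at this

theorem exp_neg_ge {x v : ℝ} (hx : 0 ≤ x) (hx0 : x ≤ 16)
    (h : v * (1 + x / 16 + (x / 16) ^ 2 / 2 + (x / 16) ^ 3 / 6 + 5 / 96 * (x / 16) ^ 4) ^ 16 ≤ 1) :
    v ≤ Real.exp (-x) := by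
  have e : Real.exp (-x) = (Real.exp (x / 16) ^ 16)⁻¹ := by
    rw [← Real.exp_nat_mul, Real.exp_neg]; congr 2; push_cast; ring
  have h1 := Real.exp_bound' (show 0 ≤ x / 16 by linarith) (by linarith) (show 0 < 4 by norm_num)
  norm_num [sum_range_succ, Nat.factorial] at h1
  rcases le_total v 0 with hv | hv
  · exact hv.trans (Real.exp_pos _).le
  rw [e, ← one_div, le_div_iff₀ (by positivity)]
  refine le_trans (mul_le_mul_of_nonneg_left (pow_le_pow_left₀ (Real.exp_pos _).le ?_ 16) hv) h
  linarith

theorem exp_neg_le {x v : ℝ} (hx : 0 ≤ x)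
    (h : 1 ≤ v * (1 + x / 16 + (x / 16) ^ 2 / 2) ^ 16) : Real.exp (-x) ≤ v := by
  have e : Real.exp (-x) = (Real.exp (x / 16) ^ 16)⁻¹ := by
    rw [← Real.exp_nat_mul, Real.exp_neg]; congr 2; push_cast; ring
  have h1 := Real.quadratic_le_exp_of_nonneg (show 0 ≤ x / 16 by linarith)
  have hp : 0 < (1 + x / 16 + (x / 16) ^ 2 / 2) ^ 16 := by positivity
  rw [e, ← one_div, div_le_iff₀ (by positivity)]
  have hv : 0 ≤ v := by
    by_contra hc
    nlinarith
  exact h.trans (mul_le_mul_of_nonneg_left (pow_le_pow_left₀ (by positivity) h1 16) hv)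

/-- A polynomial minorant of the cosine on `[0, 2]`. -/
theorem cos_ge {x : ℝ} (hx : 0 ≤ x) (hx2 : x ≤ 2) :
    2 * (2 * (1 - x ^ 2 / 32) ^ 2 - 1) ^ 2 - 1 ≤ Real.cos x := by
  have h2 := Real.one_sub_sq_div_two_le_cos (x := x / 4)
  have h3 := Real.cos_two_mul (x / 4)
  have h4 := Real.cos_two_mul (x / 2)
  rw [show 2 * (x / 4) = x / 2 by ring] at h3
  rw [show 2 * (x / 2) = x by ring] at h4
  rw [h4, h3]
  have a0 : 7 / 8 ≤ 1 - x ^ 2 / 32 := by nlinarith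
  have a1 : (1 - x ^ 2 / 32) ^ 2 ≤ Real.cos (x / 4) ^ 2 :=
    pow_le_pow_left₀ (by linarith) (by linarith) 2
  have a2 : 49 / 64 ≤ (1 - x ^ 2 / 32) ^ 2 := by nlinarith
  have := pow_le_pow_left₀ (show 0 ≤ 2 * (1 - x ^ 2 / 32) ^ 2 - 1 by linarith)
    (show 2 * (1 - x ^ 2 / 32) ^ 2 - 1 ≤ 2 * Real.cos (x / 4) ^ 2 - 1 by linarith) 2
  linarith

/-- The rescaled lower bound for the integrand near the saddle point. -/
def mainFun (z : ℝ) : ℝ := Real.exp (-(z ^ 2 + 18 / 100 * z ^ 3)) *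
  Real.cos (Real.pi / 6 + z ^ 2 / 100 + 18 / 100 * z ^ 3)

theorem mainFun_antitone : AntitoneOn mainFun (Set.Icc 0 (17 / 10)) := by
  intro x hx y hy hxy
  have hpi := Real.pi_lt_d4
  have hpi0 := Real.pi_gt_d4
  have e2 : x ^ 2 ≤ y ^ 2 := pow_le_pow_left₀ hx.1 hxy 2
  have e3 : x ^ 3 ≤ y ^ 3 := pow_le_pow_left₀ hx.1 hxy 3
  have m2 : y ^ 2 ≤ (17 / 10) ^ 2 := pow_le_pow_left₀ hy.1 hy.2 2
  have m3 : y ^ 3 ≤ (17 / 10) ^ 3 := pow_le_pow_left₀ hy.1 hy.2 3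
  have x2 := sq_nonneg x
  have x3 : 0 ≤ x ^ 3 := pow_nonneg hx.1 3
  norm_num at m2 m3
  unfold mainFun
  apply mul_le_mul
  · exact Real.exp_le_exp.2 (by linarith)
  · exact Real.cos_le_cos_of_nonneg_of_le_pi (by positivity) (by linarith) (by linarith)
  · exact Real.cos_nonneg_of_neg_pi_div_two_le_of_le (by linarith) (by linarith)
  · exact (Real.exp_pos _).le

theorem mainFun_ge {z e p v : ℝ} (hz : 0 ≤ z) (hz2 : z ≤ 17 / 10) (he : 0 ≤ e)
    (h1 : e * (1 + (z ^ 2 + 18 / 100 * z ^ 3) / 16 + ((z ^ 2 + 18 / 100 * z ^ 3) / 16) ^ 2 / 2 +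
      ((z ^ 2 + 18 / 100 * z ^ 3) / 16) ^ 3 / 6 +
      5 / 96 * ((z ^ 2 + 18 / 100 * z ^ 3) / 16) ^ 4) ^ 16 ≤ 1)
    (hp : 5236 / 10000 + z ^ 2 / 100 + 18 / 100 * z ^ 3 ≤ p) (hp2 : p ≤ 2)
    (h2 : v ≤ 2 * (2 * (1 - p ^ 2 / 32) ^ 2 - 1) ^ 2 - 1) : e * v ≤ mainFun z := by
  have hpi := Real.pi_lt_d4
  have hpi0 := Real.pi_gt_d4
  have z3 : 0 ≤ z ^ 3 := pow_nonneg hz 3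
  have z2 := sq_nonneg z
  have m2 : z ^ 2 ≤ (17 / 10) ^ 2 := pow_le_pow_left₀ hz hz2 2
  have m3 : z ^ 3 ≤ (17 / 10) ^ 3 := pow_le_pow_left₀ hz hz2 3
  norm_num at m2 m3
  have a := exp_neg_ge (x := z ^ 2 + 18 / 100 * z ^ 3) (by positivity) (by linarith) h1
  have hp0 : 0 ≤ p := le_trans (by positivity) hp
  have b := (cos_ge hp0 hp2).trans (Real.cos_le_cos_of_nonneg_of_le_pi
    (x := Real.pi / 6 + z ^ 2 / 100 + 18 / 100 * z ^ 3) (by positivity) (by linarith) (by linarith))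
  have c : 0 ≤ Real.cos (Real.pi / 6 + z ^ 2 / 100 + 18 / 100 * z ^ 3) :=
    Real.cos_nonneg_of_neg_pi_div_two_le_of_le (by linarith) (by linarith)
  unfold mainFun
  exact (mul_le_mul_of_nonneg_left (h2.trans b) he).trans (mul_le_mul_of_nonneg_right a c)

theorem integral_mainFun : 62 / 100 ≤ ∫ z in (0 : ℝ)..(17 / 10), mainFun z := by
  have h := (step_sum_integral (h := 1 / 10) (by norm_num) 17 (by norm_num) mainFun_antitone).1
  refine le_trans ?_ h
  simp only [sum_range_succ, range_zero, sum_empty]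
  have a1 := mainFun_ge (z := 1 / 10) (e := 9897 / 10000) (p := 5239 / 10000) (v := 8656 / 10000)
    (by norm_num) (by norm_num) (by norm_num) (by norm_num) (by norm_num) (by norm_num)
        (by norm_num)
  have a2 := mainFun_ge (z := 2 / 10) (e := 9593 / 10000) (p := 5255 / 10000) (v := 8648 / 10000)
    (by norm_num) (by norm_num) (by norm_num) (by norm_num) (by norm_num) (by norm_num)
        (by norm_num)
  have a3 := mainFun_ge (z := 3 / 10) (e := 9094 / 10000) (p := 5294 / 10000) (v := 8629 / 10000)
    (by norm_num) (by norm_num) (by norm_num) (by norm_num) (by norm_num) (by norm_num)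
        (by norm_num)
  have a4 := mainFun_ge (z := 4 / 10) (e := 8422 / 10000) (p := 5368 / 10000) (v := 8591 / 10000)
    (by norm_num) (by norm_num) (by norm_num) (by norm_num) (by norm_num) (by norm_num)
        (by norm_num)
  have a5 := mainFun_ge (z := 5 / 10) (e := 7613 / 10000) (p := 5486 / 10000) (v := 8530 / 10000)
    (by norm_num) (by norm_num) (by norm_num) (by norm_num) (by norm_num) (by norm_num)
        (by norm_num)
  have a6 := mainFun_ge (z := 6 / 10) (e := 6710 / 10000) (p := 5661 / 10000) (v := 8437 / 10000)
    (by norm_num) (by norm_num) (by norm_num) (by norm_num) (by norm_num) (by norm_num)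
        (by norm_num)
  have a7 := mainFun_ge (z := 7 / 10) (e := 5758 / 10000) (p := 5903 / 10000) (v := 8304 / 10000)
    (by norm_num) (by norm_num) (by norm_num) (by norm_num) (by norm_num) (by norm_num)
        (by norm_num)
  have a8 := mainFun_ge (z := 8 / 10) (e := 4808 / 10000) (p := 6222 / 10000) (v := 8122 / 10000)
    (by norm_num) (by norm_num) (by norm_num) (by norm_num) (by norm_num) (by norm_num)
        (by norm_num)
  have a9 := mainFun_ge (z := 9 / 10) (e := 3901 / 10000) (p := 6630 / 10000) (v := 7876 / 10000)
    (by norm_num) (by norm_num) (by norm_num) (by norm_num) (by norm_num) (by norm_num)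
        (by norm_num)
  have a10 := mainFun_ge (z := 10 / 10) (e := 3072 / 10000) (p := 7136 / 10000) (v := 7553 / 10000)
    (by norm_num) (by norm_num) (by norm_num) (by norm_num) (by norm_num) (by norm_num)
        (by norm_num)
  have a11 := mainFun_ge (z := 11 / 10) (e := 2346 / 10000) (p := 7753 / 10000) (v := 7133 / 10000)
    (by norm_num) (by norm_num) (by norm_num) (by norm_num) (by norm_num) (by norm_num)
        (by norm_num)
  have a12 := mainFun_ge (z := 12 / 10) (e := 1735 / 10000) (p := 8491 / 10000) (v := 6594 / 10000)
    (by norm_num) (by norm_num) (by norm_num) (by norm_num) (by norm_num) (by norm_num)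
        (by norm_num)
  have a13 := mainFun_ge (z := 13 / 10) (e := 1242 / 10000) (p := 9360 / 10000) (v := 5912 / 10000)
    (by norm_num) (by norm_num) (by norm_num) (by norm_num) (by norm_num) (by norm_num)
        (by norm_num)
  have a14 := mainFun_ge (z := 14 / 10) (e := 859 / 10000) (p := 10372 / 10000) (v := 5061 / 10000)
    (by norm_num) (by norm_num) (by norm_num) (by norm_num) (by norm_num) (by norm_num)
        (by norm_num)
  have a15 := mainFun_ge (z := 15 / 10) (e := 573 / 10000) (p := 11536 / 10000) (v := 4015 / 10000)
    (by norm_num) (by norm_num) (by norm_num) (by norm_num) (by norm_num) (by norm_num)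
        (by norm_num)
  have a16 := mainFun_ge (z := 16 / 10) (e := 369 / 10000) (p := 12865 / 10000) (v := 2750 / 10000)
    (by norm_num) (by norm_num) (by norm_num) (by norm_num) (by norm_num) (by norm_num)
        (by norm_num)
  have a17 := mainFun_ge (z := 17 / 10) (e := 229 / 10000) (p := 14369 / 10000) (v := 1257 / 10000)
    (by norm_num) (by norm_num) (by norm_num) (by norm_num) (by norm_num) (by norm_num)
        (by norm_num)
  norm_num at *
  linarith

/-- The rescaled upper bound for the integrand in the near zone. -/
def nearFun (c z : ℝ) : ℝ := Real.exp (-(c * z ^ 2 - 43 / 1000 * z - 1 / 6))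

theorem integral_nearFun_left :
    ∫ z in (17 / 10 : ℝ)..(31 / 10), nearFun (285 / 1000) z ≤ 415 / 1000 := by
  have hanti : AntitoneOn (nearFun (285 / 1000)) (Set.Icc (17 / 10) (31 / 10)) := by
    intro x hx y hy hxy
    apply Real.exp_le_exp.2
    nlinarith [hx.1, hy.1]
  have h := (step_sum_integral (h := 1 / 10) (by norm_num) 14 (by norm_num) hanti).2
  refine h.trans ?_
  simp only [sum_range_succ, range_zero, sum_empty, nearFun]
  have a0 := exp_neg_le (x := 285 / 1000 * (17 / 10 + 1 / 10 * 0) ^ 2 - 43 / 1000 * (17 / 10 + 1 /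
      10 * 0) - 1 / 6)
    (v := 5579 / 10000) (by norm_num) (by norm_num)
  have a1 := exp_neg_le (x := 285 / 1000 * (17 / 10 + 1 / 10 * 1) ^ 2 - 43 / 1000 * (17 / 10 + 1 /
      10 * 1) - 1 / 6)
    (v := 5071 / 10000) (by norm_num) (by norm_num)
  have a2 := exp_neg_le (x := 285 / 1000 * (17 / 10 + 1 / 10 * 2) ^ 2 - 43 / 1000 * (17 / 10 + 1 /
      10 * 2) - 1 / 6)
    (v := 4584 / 10000) (by norm_num) (by norm_num)
  have a3 := exp_neg_le (x := 285 / 1000 * (17 / 10 + 1 / 10 * 3) ^ 2 - 43 / 1000 * (17 / 10 + 1 /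
      10 * 3) - 1 / 6)
    (v := 4120 / 10000) (by norm_num) (by norm_num)
  have a4 := exp_neg_le (x := 285 / 1000 * (17 / 10 + 1 / 10 * 4) ^ 2 - 43 / 1000 * (17 / 10 + 1 /
      10 * 4) - 1 / 6)
    (v := 3682 / 10000) (by norm_num) (by norm_num)
  have a5 := exp_neg_le (x := 285 / 1000 * (17 / 10 + 1 / 10 * 5) ^ 2 - 43 / 1000 * (17 / 10 + 1 /
      10 * 5) - 1 / 6)
    (v := 3272 / 10000) (by norm_num) (by norm_num)
  have a6 := exp_neg_le (x := 285 / 1000 * (17 / 10 + 1 / 10 * 6) ^ 2 - 43 / 1000 * (17 / 10 + 1 /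
      10 * 6) - 1 / 6)
    (v := 2892 / 10000) (by norm_num) (by norm_num)
  have a7 := exp_neg_le (x := 285 / 1000 * (17 / 10 + 1 / 10 * 7) ^ 2 - 43 / 1000 * (17 / 10 + 1 /
      10 * 7) - 1 / 6)
    (v := 2541 / 10000) (by norm_num) (by norm_num)
  have a8 := exp_neg_le (x := 285 / 1000 * (17 / 10 + 1 / 10 * 8) ^ 2 - 43 / 1000 * (17 / 10 + 1 /
      10 * 8) - 1 / 6)
    (v := 2221 / 10000) (by norm_num) (by norm_num)
  have a9 := exp_neg_le (x := 285 / 1000 * (17 / 10 + 1 / 10 * 9) ^ 2 - 43 / 1000 * (17 / 10 + 1 /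
      10 * 9) - 1 / 6)
    (v := 1930 / 10000) (by norm_num) (by norm_num)
  have a10 := exp_neg_le (x := 285 / 1000 * (17 / 10 + 1 / 10 * 10) ^ 2 - 43 / 1000 * (17 / 10 + 1
      / 10 * 10) - 1 / 6)
    (v := 1668 / 10000) (by norm_num) (by norm_num)
  have a11 := exp_neg_le (x := 285 / 1000 * (17 / 10 + 1 / 10 * 11) ^ 2 - 43 / 1000 * (17 / 10 + 1
      / 10 * 11) - 1 / 6)
    (v := 1433 / 10000) (by norm_num) (by norm_num)
  have a12 := exp_neg_le (x := 285 / 1000 * (17 / 10 + 1 / 10 * 12) ^ 2 - 43 / 1000 * (17 / 10 + 1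
      / 10 * 12) - 1 / 6)
    (v := 1225 / 10000) (by norm_num) (by norm_num)
  have a13 := exp_neg_le (x := 285 / 1000 * (17 / 10 + 1 / 10 * 13) ^ 2 - 43 / 1000 * (17 / 10 + 1
      / 10 * 13) - 1 / 6)
    (v := 1041 / 10000) (by norm_num) (by norm_num)
  norm_num at *
  linarith

theorem integral_nearFun_right {b : ℝ} (hb : 31 / 10 ≤ b) :
    ∫ z in (31 / 10 : ℝ)..b, nearFun (257 / 1000) z ≤ 75 / 1000 := by
  have hd : ∀ z : ℝ, HasDerivAt (fun z => -Real.exp (-(2169 / 1000 + 155 / 100 * (z - 31 / 10))) /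
      (155 / 100)) (Real.exp (-(2169 / 1000 + 155 / 100 * (z - 31 / 10)))) z := by
    intro z
    have h1 : HasDerivAt (fun z : ℝ => -(2169 / 1000 + 155 / 100 * (z - 31 / 10)))
        (-(155 / 100)) z := by
      have h0 : HasDerivAt (fun z : ℝ => -(2169 / 1000 + 155 / 100 * (z - 31 / 10)))
          (-(155 / 100 * 1)) z :=
        ((((hasDerivAt_id' z).sub_const _).const_mul _).const_add _).neg
      exact h0.congr_deriv (by ring)
    exact (h1.exp.neg.div_const (155 / 100)).congr_deriv (by ring)
  have hc : Continuous fun z : ℝ => Real.exp (-(2169 / 1000 + 155 / 100 * (z - 31 / 10))) := by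
    fun_prop
  have e := intervalIntegral.integral_eq_sub_of_hasDerivAt (a := 31 / 10) (b := b)
    (fun z _ => hd z) (hc.intervalIntegrable _ _)
  have hn : Continuous (nearFun (257 / 1000)) := by unfold nearFun; fun_prop
  have h1 : ∫ z in (31 / 10 : ℝ)..b, nearFun (257 / 1000) z ≤
      ∫ z in (31 / 10 : ℝ)..b, Real.exp (-(2169 / 1000 + 155 / 100 * (z - 31 / 10))) := by
    refine intervalIntegral.integral_mono_on hb (hn.intervalIntegrable _ _)
      (hc.intervalIntegrable _ _) fun z hz => Real.exp_le_exp.2 ?_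
    nlinarith [sq_nonneg (z - 31 / 10), hz.1]
  refine h1.trans ?_
  rw [e]
  have a := exp_neg_le (x := 2169 / 1000) (v := 1155 / 10000) (by norm_num) (by norm_num)
  have b0 := Real.exp_pos (-(2169 / 1000 + 155 / 100 * (b - 31 / 10)))
  norm_num at *
  linarith

/-- The Borwein product `∏ (1 - q^(3i+1)) (1 - q^(3i+2))`. -/
def bp (n : ℕ) : Polynomial ℤ :=
  ∏ i ∈ range n, (1 - Polynomial.X ^ (3 * i + 1)) * (1 - Polynomial.X ^ (3 * i + 2))

theorem aeval_bp (n : ℕ) (z : ℂ) : Polynomial.aeval z (bp n) = bz n z := by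
  simp [bp, bz, map_prod]

theorem integral_cos_int_mul (j : ℤ) :
    ∫ φ in (0 : ℝ)..Real.pi, Real.cos (j * φ) = if j = 0 then Real.pi else 0 := by
  split_ifs with h
  · simp [h]
  · have hj : (j : ℝ) ≠ 0 := by exact_mod_cast h
    rw [intervalIntegral.integral_comp_mul_left (fun x => Real.cos x) hj, integral_cos]
    simp [Real.sin_int_mul_pi]

theorem integral_coeff (P : Polynomial ℤ) (r : ℝ) (k : ℕ) :
    ∫ φ in (0 : ℝ)..Real.pi, (Polynomial.aeval (r * Complex.exp (φ * Complex.I)) P *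
      Complex.exp (-((k * φ : ℝ) : ℂ) * Complex.I)).re = Real.pi * (P.coeff k * r ^ k) := by
  have e : ∀ φ : ℝ, (Polynomial.aeval (r * Complex.exp (φ * Complex.I)) P *
      Complex.exp (-((k * φ : ℝ) : ℂ) * Complex.I)).re =
      ∑ j ∈ P.support, P.coeff j * r ^ j * Real.cos (((j : ℤ) - (k : ℤ) : ℤ) * φ) := by
    intro φ
    rw [Polynomial.aeval_eq_sum_range' (Nat.lt_succ_self _), sum_mul, Complex.re_sum]
    rw [← sum_subset (Polynomial.supp_subset_range (Nat.lt_succ_self _))]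
    · refine sum_congr rfl fun j _ => ?_
      have h1 : P.coeff j • (r * Complex.exp (φ * Complex.I)) ^ j *
          Complex.exp (-((k * φ : ℝ) : ℂ) * Complex.I) = ((P.coeff j * r ^ j : ℝ) : ℂ) *
          Complex.exp (((((j : ℤ) - (k : ℤ) : ℤ) * φ : ℝ) : ℂ) * Complex.I) := by
        rw [mul_pow, ← Complex.exp_nat_mul, zsmul_eq_mul, mul_assoc, mul_assoc, ← Complex.exp_add]
        push_cast
        rw [mul_assoc]
        congr 3
        ring
      rw [h1, Complex.re_ofReal_mul, Complex.exp_ofReal_mul_I_re]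
    · intro j _ hj
      simp [Polynomial.notMem_support_iff.1 hj]
  simp only [e]
  rw [intervalIntegral.integral_finsetSum fun j _ => by
    apply Continuous.intervalIntegrable; fun_prop]
  have e2 : ∀ j ∈ P.support, ∫ φ in (0 : ℝ)..Real.pi,
      P.coeff j * r ^ j * Real.cos (((j : ℤ) - (k : ℤ) : ℤ) * φ) =
      if j = k then Real.pi * (P.coeff k * r ^ k) else 0 := by
    intro j _
    rw [intervalIntegral.integral_const_mul, integral_cos_int_mul]
    by_cases h : j = k
    · simp [h]; ring
    · rw [if_neg (by omega), if_neg h, mul_zero]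
  rw [sum_congr rfl e2, sum_ite_eq']
  split_ifs with h
  · rfl
  · simp [Polynomial.notMem_support_iff.1 h]

/-- The integrand of the coefficient integral. -/
def integrand (n m : ℕ) (r φ : ℝ) : ℝ :=
  (bz n (r * Complex.exp (φ * Complex.I)) * Complex.exp (-((3 * m * φ : ℝ) : ℂ) * Complex.I)).re

theorem continuous_integrand (n m : ℕ) (r : ℝ) : Continuous (integrand n m r) := by
  unfold integrand bz
  fun_prop

theorem neg_norm_le_integrand (n m : ℕ) (r φ : ℝ) :
    -‖bz n (r * Complex.exp (φ * Complex.I))‖ ≤ integrand n m r φ := by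
  have h : ‖bz n (r * Complex.exp (φ * Complex.I)) *
      Complex.exp (-((3 * m * φ : ℝ) : ℂ) * Complex.I)‖ =
      ‖bz n (r * Complex.exp (φ * Complex.I))‖ := by
    rw [norm_mul, ← Complex.ofReal_neg, Complex.norm_exp_ofReal_mul_I, mul_one]
  rw [← h]
  exact (abs_le.1 (Complex.abs_re_le_norm _)).1

theorem om_eq : om = Complex.exp ((2 * Real.pi / 3 : ℝ) * Complex.I) := by
  have e : 2 * Real.pi / 3 = Real.pi - Real.pi / 3 := by ring
  apply Complex.ext
  · rw [Complex.exp_ofReal_mul_I_re, e, Real.cos_pi_sub, Real.cos_pi_div_three, om]; norm_num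
  · rw [Complex.exp_ofReal_mul_I_im, e, Real.sin_pi_sub, Real.sin_pi_div_three, om]

theorem integrand_shift (n m : ℕ) (r θ : ℝ) : integrand n m r (2 * Real.pi / 3 + θ) =
    (bz n (r * om * Complex.exp (θ * Complex.I)) *
      Complex.exp (-((3 * m * θ : ℝ) : ℂ) * Complex.I)).re := by
  unfold integrand
  have e1 : Complex.exp (((2 * Real.pi / 3 + θ : ℝ) : ℂ) * Complex.I) =
      om * Complex.exp (θ * Complex.I) := by
    rw [om_eq, ← Complex.exp_add]; congr 1; push_cast; ring
  have e2 : Complex.exp (-((3 * m * (2 * Real.pi / 3 + θ) : ℝ) : ℂ) * Complex.I) =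
      Complex.exp (-((3 * m * θ : ℝ) : ℂ) * Complex.I) := by
    rw [Complex.exp_eq_exp_iff_exists_int]
    exact ⟨-m, by push_cast; ring⟩
  rw [e1, e2, ← mul_assoc (r : ℂ)]

/-- The symmetrised integrand around the cube root of unity. -/
def symIntegrand (n m : ℕ) (r θ : ℝ) : ℝ :=
  integrand n m r (2 * Real.pi / 3 + θ) + integrand n m r (2 * Real.pi / 3 + -θ)

theorem continuous_symIntegrand (n m : ℕ) (r : ℝ) : Continuous (symIntegrand n m r) := by
  have := continuous_integrand n m r
  unfold symIntegrand
  fun_prop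

theorem coeff_eq_integral (n m : ℕ) (r : ℝ) :
    Real.pi * ((bp n).coeff (3 * m) * r ^ (3 * m)) =
      (∫ φ in (0 : ℝ)..Real.pi / 3, integrand n m r φ) +
        ∫ θ in (0 : ℝ)..Real.pi / 3, symIntegrand n m r θ := by
  have hc := continuous_integrand n m r
  have h := integral_coeff (bp n) r (3 * m)
  rw [← h]
  have e : ∀ φ : ℝ, (Polynomial.aeval (r * Complex.exp (φ * Complex.I)) (bp n) *
      Complex.exp (-(((3 * m : ℕ) * φ : ℝ) : ℂ) * Complex.I)).re = integrand n m r φ := by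
    intro φ
    rw [aeval_bp, integrand]
    push_cast
    rfl
  simp only [e]
  have i1 := fun a b => hc.intervalIntegrable (μ := MeasureTheory.volume) a b
  rw [← intervalIntegral.integral_add_adjacent_intervals (i1 0 (Real.pi / 3)) (i1 _ Real.pi),
    ← intervalIntegral.integral_add_adjacent_intervals (i1 (Real.pi / 3) (2 * Real.pi / 3))
      (i1 _ Real.pi)]
  unfold symIntegrand
  rw [intervalIntegral.integral_add, intervalIntegral.integral_comp_neg
    (fun x => integrand n m r (2 * Real.pi / 3 + x)),
    intervalIntegral.integral_comp_add_left, intervalIntegral.integral_comp_add_left]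
  · rw [add_comm (∫ φ in Real.pi / 3..2 * Real.pi / 3, _)]
    congr 3 <;> ring
  · exact Continuous.intervalIntegrable (by fun_prop) _ _
  · exact Continuous.intervalIntegrable (by fun_prop) _ _

theorem integral_ge_of_scaled {f g : ℝ → ℝ} {l a b I : ℝ} (hl : 0 < l) (hab : a ≤ b)
    (hf : Continuous f) (hg : Continuous g) (C : ℝ)
    (h : ∀ z ∈ Set.Icc a b, C * g z ≤ f (l * z)) (hI : I ≤ C * ∫ z in a..b, g z) :
    l * I ≤ ∫ x in (l * a)..(l * b), f x := by
  have e := intervalIntegral.integral_comp_mul_left (a := a) (b := b) f hl.ne'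
  have h1 : ∫ z in a..b, C * g z ≤ ∫ z in a..b, f (l * z) :=
    intervalIntegral.integral_mono_on hab ((hg.const_mul C).intervalIntegrable _ _)
      ((hf.comp (continuous_const.mul continuous_id)).intervalIntegrable _ _) h
  rw [intervalIntegral.integral_const_mul, e, smul_eq_mul] at h1
  have := mul_le_mul_of_nonneg_left (hI.trans h1) hl.le
  rwa [mul_inv_cancel_left₀ hl.ne'] at this

theorem integral_ge_neg_const {f : ℝ → ℝ} {a b C : ℝ} (hab : a ≤ b) (hf : Continuous f)
    (h : ∀ x ∈ Set.Ioo a b, -C ≤ f x) : -(C * (b - a)) ≤ ∫ x in a..b, f x := by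
  have := intervalIntegral.integral_mono_on_of_le_Ioo (μ := MeasureTheory.volume) hab
    (intervalIntegrable_const (c := -C)) (hf.intervalIntegrable _ _) h
  rw [intervalIntegral.integral_const, smul_eq_mul] at this
  linarith

theorem continuous_mainFun : Continuous mainFun := by unfold mainFun; fun_prop

theorem continuous_nearFun (c : ℝ) : Continuous (nearFun c) := by unfold nearFun; fun_prop

theorem symIntegrand_ge_mainFun {n m : ℕ} {r l z : ℝ} (hr : 0 < r) (hr1 : r ≤ 1)
    (hs : saddle n r = 3 * m) (hl : 0 < l) (hz : z ∈ Set.Icc (0 : ℝ) (17 / 10))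
    (h2 : powSum 2 n r * l ^ 2 ≤ 2) (h3 : powSum 3 n r * l ^ 3 ≤ 6 / 10)
    (hd : 65 / 100 * (1 - r) * powSum 2 n r * l ^ 2 ≤ 1 / 100)
    (hv : ∀ a : ℕ, a ≤ 3 * n → (a : ℝ) * (17 / 10 * l) ≤ 6 / 10 ∨ r ^ a ≤ 1 / 10) :
    2 * Real.exp (logN n r) * mainFun z ≤ symIntegrand n m r (l * z) := by
  obtain ⟨hz0, hz1⟩ := hz
  have hpi := Real.pi_gt_d4
  have z2 : 0 ≤ z ^ 2 := by positivity
  have z3 : 0 ≤ z ^ 3 := by positivity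
  have z2' : z ^ 2 ≤ (17 / 10) ^ 2 := pow_le_pow_left₀ hz0 hz1 2
  have z3' : z ^ 3 ≤ (17 / 10) ^ 3 := pow_le_pow_left₀ hz0 hz1 3
  have k2 : powSum 2 n r * (l * z) ^ 2 ≤ 2 * z ^ 2 := by
    rw [mul_pow, ← mul_assoc]; exact mul_le_mul_of_nonneg_right h2 z2
  have k3 : powSum 3 n r * (l * z) ^ 3 ≤ 6 / 10 * z ^ 3 := by
    rw [mul_pow, ← mul_assoc]; exact mul_le_mul_of_nonneg_right h3 z3
  have kd : 65 / 100 * (1 - r) * powSum 2 n r * (l * z) ^ 2 ≤ 1 / 100 * z ^ 2 := by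
    rw [mul_pow, ← mul_assoc]; exact mul_le_mul_of_nonneg_right hd z2
  have p2 : 0 ≤ powSum 2 n r :=
    sum_nonneg fun i _ => mul_nonneg (by positivity) (wt_nonneg (by positivity))
  have p3 : 0 ≤ powSum 3 n r :=
    sum_nonneg fun i _ => mul_nonneg (by positivity) (wt_nonneg (by positivity))
  have hr' : 0 ≤ 1 - r := by linarith
  have habs : |l * z| = l * z := abs_of_nonneg (by positivity)
  have hc0 : 0 ≤ Real.cos (Real.pi / 6 + z ^ 2 / 100 + 18 / 100 * z ^ 3) :=
    Real.cos_nonneg_of_neg_pi_div_two_le_of_le (by linarith) (by norm_num at z2' z3'; linarith)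
  have key : ∀ θ : ℝ, |θ| = l * z → Real.exp (logN n r) * Real.exp (drift n r * θ) * mainFun z ≤
      integrand n m r (2 * Real.pi / 3 + θ) := by
    intro θ hθ
    have hθ2 : θ ^ 2 = (l * z) ^ 2 := by rw [← hθ, sq_abs]
    rw [integrand_shift]
    refine le_trans ?_ (inner_lower hr hr1 hs ?_ ?_)
    · rw [mainFun, hθ, hθ2, ← mul_assoc, ← Real.exp_add, ← Real.exp_add]
      apply mul_le_mul _ _ hc0 (Real.exp_nonneg _)
      · apply Real.exp_le_exp.2; linarith
      · apply Real.cos_le_cos_of_nonneg_of_le_pi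
        · positivity
        · norm_num at z2' z3'; linarith
        · linarith
    · intro a ha
      refine (hv a ha).imp_left fun h => ?_
      rw [hθ]
      refine le_trans (mul_le_mul_of_nonneg_left ?_ (Nat.cast_nonneg a)) h
      nlinarith
    · rw [hθ, hθ2]; norm_num at z2' z3'; linarith
  have a1 := key (l * z) habs
  have a2 := key (-(l * z)) (by rw [abs_neg, habs])
  have hm : 0 ≤ mainFun z := mul_nonneg (Real.exp_nonneg _) hc0
  have hsum : 2 ≤ Real.exp (drift n r * (l * z)) + Real.exp (drift n r * -(l * z)) := by
    have e1 := Real.add_one_le_exp (drift n r * (l * z))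
    have e2 := Real.add_one_le_exp (drift n r * -(l * z))
    linarith
  have hE := Real.exp_pos (logN n r)
  have := mul_le_mul_of_nonneg_left hsum (mul_nonneg hE.le hm)
  unfold symIntegrand
  nlinarith

theorem symIntegrand_ge_of_norm_le {n m : ℕ} {r θ C : ℝ}
    (h : ∀ s : ℝ, |s| = |θ| → ‖bz n (r * Complex.exp ((2 * Real.pi / 3 + s : ℝ) * Complex.I))‖ ≤ C)
        :
    -(2 * C) ≤ symIntegrand n m r θ := by
  have a1 := neg_norm_le_integrand n m r (2 * Real.pi / 3 + θ)
  have a2 := neg_norm_le_integrand n m r (2 * Real.pi / 3 + -θ)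
  have b1 := h θ rfl
  have b2 := h (-θ) (abs_neg θ)
  unfold symIntegrand
  linarith

/-- The weighted second moment of the frequencies `3 i + 3 / 2`, `i < M`. -/
def zsum (M : ℕ) (r : ℝ) : ℝ := ∑ i ∈ range M, wt (r ^ (3 * i + 2)) * (3 * i + 3 / 2 : ℝ) ^ 2

theorem symIntegrand_ge_near {n m M : ℕ} {r l z v : ℝ} (hr : 0 < r) (hr1 : r ≤ 1) (hM : M ≤ n)
    (hl : 0 < l) (hz : 0 ≤ z) (hv : 0 < v) (hvl : v * (M * l) = 12 / 10)
    (hy : ysum n r * l ≤ 43 / 1000) (hZ : zsum M r * l ^ 2 = 8 / 13)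
    (hZ4 : ∑ i ∈ range M, wt (r ^ (3 * i + 2)) * (3 * i + 3 / 2 : ℝ) ^ 4 ≤
      54 / 10 * M ^ 2 * zsum M r) :
    -(2 * (Real.exp (logN n r) * Real.exp (-(4 / 13 * z ^ 2 * (1 - 648 / 1000 * (z / v) ^ 2) -
      43 / 1000 * z - 1 / 6)))) ≤ symIntegrand n m r (l * z) := by
  apply symIntegrand_ge_of_norm_le
  intro s hs
  refine (norm_bz_near hr hr1 hM s).trans ?_
  rw [← Real.exp_add]
  apply Real.exp_le_exp.2
  rw [abs_of_nonneg (by positivity : 0 ≤ l * z)] at hs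
  have s2 : s ^ 2 = (l * z) ^ 2 := by rw [← hs, sq_abs]
  have s4 : s ^ 4 = (l * z) ^ 4 := by
    calc s ^ 4 = (s ^ 2) ^ 2 := by ring
      _ = _ := by rw [s2]; ring
  rw [hs, s2, s4]
  have c1 : (∑ i ∈ range M, wt (r ^ (3 * i + 2)) * (3 * i + 3 / 2 : ℝ) ^ 2) * (l * z) ^ 2 / 2 =
      4 / 13 * z ^ 2 := by
    have : zsum M r * (l * z) ^ 2 / 2 = zsum M r * l ^ 2 * z ^ 2 / 2 := by ring
    rw [hZ] at this
    unfold zsum at this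
    rw [this]; ring
  have c2 : (∑ i ∈ range M, wt (r ^ (3 * i + 2)) * (3 * i + 3 / 2 : ℝ) ^ 4) * (l * z) ^ 4 / 24 ≤
      4 / 13 * z ^ 2 * (648 / 1000 * (z / v) ^ 2) := by
    have e1 : (M * l : ℝ) = 12 / 10 / v := by field_simp; linarith
    have := mul_le_mul_of_nonneg_right hZ4 (by positivity : 0 ≤ (l * z) ^ 4 / 24)
    have e2 : 54 / 10 * M ^ 2 * zsum M r * ((l * z) ^ 4 / 24) =
        54 / 240 * (zsum M r * l ^ 2) * (M * l) ^ 2 * z ^ 4 := by ring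
    rw [e2, hZ, e1] at this
    calc _ ≤ _ := by rw [mul_div_assoc]
      _ ≤ _ := this
      _ = _ := by field_simp; ring
  have c3 : ysum n r * (l * z) ≤ 43 / 1000 * z := by
    rw [← mul_assoc]; exact mul_le_mul_of_nonneg_right hy hz
  linarith

set_option maxHeartbeats 1000000 in
theorem coeff_nonneg_of_bounds {n m M : ℕ} {r l v : ℝ} (hr : 0 < r) (hr1 : r ≤ 1)
    (hs : saddle n r = 3 * m) (hl : 0 < l) (hM : M ≤ n) (hM3 : 3 ≤ M)
    (h2 : powSum 2 n r * l ^ 2 ≤ 2) (h3 : powSum 3 n r * l ^ 3 ≤ 6 / 10)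
    (hd : 65 / 100 * (1 - r) * powSum 2 n r * l ^ 2 ≤ 1 / 100)
    (ha : ∀ a : ℕ, a ≤ 3 * n → (a : ℝ) * (17 / 10 * l) ≤ 6 / 10 ∨ r ^ a ≤ 1 / 10)
    (hy : ysum n r * l ≤ 43 / 1000) (hy2 : 2 ≤ ysum n r) (hZ : zsum M r * l ^ 2 = 8 / 13)
    (hZ4 : ∑ i ∈ range M, wt (r ^ (3 * i + 2)) * (3 * i + 3 / 2 : ℝ) ^ 4 ≤
      54 / 10 * M ^ 2 * zsum M r)
    (hvl : v * (M * l) = 12 / 10) (hv : 93 / 10 ≤ v)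
    (ht : v / 2 * Real.exp (-(644 / 10000 * v ^ 2 - 43 / 1000 * v - 1 / 6)) +
      v * Real.exp (-(ysum n r - M / (108 / 10) - 5 / 12)) +
      Real.pi / 3 / l * Real.exp (-(ysum n r - M / (216 / 10) - 5 / 12)) +
      Real.pi / 6 / l * Real.exp (-(ysum n r / 2 - 1 / 6)) ≤ 12 / 100) :
    0 ≤ (bp n).coeff (3 * m) := by
  have hpi := Real.pi_gt_d4
  have hM0 : (3 : ℝ) ≤ M := by exact_mod_cast hM3
  set E := Real.exp (logN n r) with hE
  have hE0 : 0 < E := Real.exp_pos _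
  have hc := continuous_symIntegrand n m r
  have hlv : l * v = 12 / 10 / M := by field_simp; linarith
  have hlv' : 2 * (l * v) ≤ Real.pi / 3 := by
    rw [hlv]
    calc 2 * (12 / 10 / (M : ℝ)) ≤ 2 * (12 / 10 / 3) := by gcongr
      _ ≤ _ := by linarith
  have v0 : 0 < v := by linarith
  have i1 : l * (2 * E * (62 / 100)) ≤ ∫ x in (l * 0)..(l * (17 / 10)), symIntegrand n m r x := by
    apply integral_ge_of_scaled hl (by norm_num) hc continuous_mainFun (2 * E)
    · intro z hz
      exact symIntegrand_ge_mainFun hr hr1 hs hl hz h2 h3 hd ha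
    · exact mul_le_mul_of_nonneg_left integral_mainFun (by positivity)
  have near := fun (z : ℝ) (hz : 0 ≤ z) =>
    symIntegrand_ge_near (m := m) hr hr1 hM hl hz v0 hvl hy hZ hZ4
  have i2 : l * (-(2 * E) * (415 / 1000)) ≤
      ∫ x in (l * (17 / 10))..(l * (31 / 10)), symIntegrand n m r x := by
    apply integral_ge_of_scaled hl (by norm_num) hc (continuous_nearFun (285 / 1000)) (-(2 * E))
    · intro z hz
      have z0 : 0 ≤ z := by linarith [hz.1]
      refine le_trans ?_ (near z z0)
      rw [nearFun, neg_mul, neg_le_neg_iff, mul_assoc (2 : ℝ) E]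
      refine mul_le_mul_of_nonneg_left (mul_le_mul_of_nonneg_left
        (Real.exp_le_exp.2 (neg_le_neg ?_)) hE0.le) zero_le_two
      have hq : z / v ≤ 1 / 3 := by
        rw [div_le_iff₀ v0]; linarith [hz.2]
      have hq2 : (z / v) ^ 2 ≤ (1 / 3) ^ 2 := pow_le_pow_left₀ (by positivity) hq 2
      nlinarith only [sq_nonneg z, hq2]
    · linarith [mul_le_mul_of_nonneg_left integral_nearFun_left (by positivity : 0 ≤ 2 * E)]
  have i3 : l * (-(2 * E) * (75 / 1000)) ≤
      ∫ x in (l * (31 / 10))..(l * (v / 2)), symIntegrand n m r x := by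
    apply integral_ge_of_scaled hl (by linarith) hc (continuous_nearFun (257 / 1000)) (-(2 * E))
    · intro z hz
      have z0 : 0 ≤ z := by linarith [hz.1]
      refine le_trans ?_ (near z z0)
      rw [nearFun, neg_mul, neg_le_neg_iff, mul_assoc (2 : ℝ) E]
      refine mul_le_mul_of_nonneg_left (mul_le_mul_of_nonneg_left
        (Real.exp_le_exp.2 (neg_le_neg ?_)) hE0.le) zero_le_two
      have hq : z / v ≤ 1 / 2 := by
        rw [div_le_iff₀ v0]; linarith [hz.2]
      have hq2 : (z / v) ^ 2 ≤ (1 / 2) ^ 2 := pow_le_pow_left₀ (by positivity) hq 2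
      nlinarith only [sq_nonneg z, hq2]
    · linarith [mul_le_mul_of_nonneg_left (integral_nearFun_right (b := v / 2) (by linarith))
        (by positivity : 0 ≤ 2 * E)]
  have i4 : -(2 * (E * Real.exp (-(644 / 10000 * v ^ 2 - 43 / 1000 * v - 1 / 6))) *
      (l * v - l * (v / 2))) ≤ ∫ x in (l * (v / 2))..(l * v), symIntegrand n m r x := by
    apply integral_ge_neg_const (by linarith only [mul_pos hl v0]) hc
    intro x hx
    obtain ⟨z, rfl⟩ : ∃ z, x = l * z := ⟨x / l, by field_simp⟩
    have z1 : v / 2 < z := lt_of_mul_lt_mul_left hx.1 hl.le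
    have z2 : z < v := lt_of_mul_lt_mul_left hx.2 hl.le
    refine le_trans ?_ (near z (by linarith))
    refine neg_le_neg (mul_le_mul_of_nonneg_left (mul_le_mul_of_nonneg_left
      (Real.exp_le_exp.2 (neg_le_neg ?_)) hE0.le) zero_le_two)
    have hq1 : 1 / 2 ≤ z / v := by rw [le_div_iff₀ v0]; linarith
    have hq2 : z / v ≤ 1 := by rw [div_le_iff₀ v0]; linarith
    obtain ⟨q, hq⟩ : ∃ q, q = z / v := ⟨_, rfl⟩
    have hzq : z = v * q := by rw [hq]; field_simp
    rw [← hq] at hq1 hq2 ⊢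
    rw [hzq]
    have hq3 : 2095 / 10000 ≤ q ^ 2 * (1 - 648 / 1000 * q ^ 2) := by
      have q1 : 0 ≤ q ^ 2 - 1 / 4 := by nlinarith only [hq1]
      have q2 : 0 ≤ 1 - q ^ 2 := by nlinarith only [hq1, hq2]
      nlinarith only [mul_nonneg q1 q2, q1]
    have hq4 := mul_le_mul_of_nonneg_left hq3 (sq_nonneg v)
    have hq5 := mul_le_mul_of_nonneg_left hq2 v0.le
    rw [mul_pow]
    linarith only [hq4, hq5, sq_nonneg v]
  have far : ∀ θ1 θ2 D : ℝ, 0 < θ1 → θ1 ≤ θ2 → θ2 ≤ Real.pi / 3 → 1 / (9 * θ1) ≤ D →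
      -(2 * (E * Real.exp (-(ysum n r - D - 5 / 12))) * (θ2 - θ1)) ≤
        ∫ x in θ1..θ2, symIntegrand n m r x := by
    intro θ1 θ2 D h0 h12 hθ hD
    apply integral_ge_neg_const h12 hc
    intro x hx
    apply symIntegrand_ge_of_norm_le
    intro s hs
    have x0 : 0 < x := h0.trans hx.1
    rw [abs_of_pos x0] at hs
    have s0 : s ≠ 0 := by rw [← abs_pos, hs]; exact x0
    refine (norm_bz_far hr hr1 s0 (by rw [hs]; linarith [hx.2])).trans ?_
    rw [hE, ← Real.exp_add, hs]
    apply Real.exp_le_exp.2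
    have : 1 / (9 * x) ≤ 1 / (9 * θ1) := by
      gcongr
      exact hx.1.le
    linarith
  have i5 := far (l * v) (2 * (l * v)) (M / (108 / 10)) (by positivity)
    (by linarith [mul_pos hl v0]) hlv' (by rw [hlv]; field_simp; norm_num)
  have i6 := far (2 * (l * v)) (Real.pi / 3) (M / (216 / 10)) (by positivity) hlv' le_rfl
    (by rw [hlv]; field_simp; norm_num)
  have i7 : -(E * Real.exp (-(ysum n r / 2 - 1 / 6)) * (Real.pi / 3 - 0)) ≤
      ∫ x in (0 : ℝ)..Real.pi / 3, integrand n m r x := by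
    apply integral_ge_neg_const (by positivity) (continuous_integrand n m r)
    intro x hx
    refine le_trans (neg_le_neg ?_) (neg_norm_le_integrand n m r x)
    refine (norm_bz_first hr hr1 hx.1 hx.2.le hy2).trans ?_
    rw [hE, ← Real.exp_add]
    apply Real.exp_le_exp.2
    linarith
  have i6' : 2 * (E * Real.exp (-(ysum n r - M / (216 / 10) - 5 / 12))) *
      (Real.pi / 3 - 2 * (l * v)) ≤ 2 * (E * Real.exp (-(ysum n r - M / (216 / 10) - 5 / 12))) *
      (Real.pi / 3) := by
    gcongr
    linarith [mul_pos hl v0]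
  have ii := fun a b => hc.intervalIntegrable (μ := MeasureTheory.volume) a b
  have hsplit : ∫ x in (0 : ℝ)..Real.pi / 3, symIntegrand n m r x =
      (∫ x in (l * 0)..(l * (17 / 10)), symIntegrand n m r x) +
      (∫ x in (l * (17 / 10))..(l * (31 / 10)), symIntegrand n m r x) +
      (∫ x in (l * (31 / 10))..(l * (v / 2)), symIntegrand n m r x) +
      (∫ x in (l * (v / 2))..(l * v), symIntegrand n m r x) +
      (∫ x in (l * v)..(2 * (l * v)), symIntegrand n m r x) +
      (∫ x in (2 * (l * v))..(Real.pi / 3), symIntegrand n m r x) := by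
    rw [mul_zero]
    simp only [intervalIntegral.integral_add_adjacent_intervals (ii _ _) (ii _ _)]
  have hco := coeff_eq_integral n m r
  have ht' := mul_le_mul_of_nonneg_left ht (by positivity : 0 ≤ 2 * E * l)
  have e4 : 2 * E * l * (v / 2 * Real.exp (-(644 / 10000 * v ^ 2 - 43 / 1000 * v - 1 / 6)) +
      v * Real.exp (-(ysum n r - M / (108 / 10) - 5 / 12)) +
      Real.pi / 3 / l * Real.exp (-(ysum n r - M / (216 / 10) - 5 / 12)) +
      Real.pi / 6 / l * Real.exp (-(ysum n r / 2 - 1 / 6))) =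
      2 * (E * Real.exp (-(644 / 10000 * v ^ 2 - 43 / 1000 * v - 1 / 6))) *
      (l * v - l * (v / 2)) +
      2 * (E * Real.exp (-(ysum n r - M / (108 / 10) - 5 / 12))) * (2 * (l * v) - l * v) +
      2 * (E * Real.exp (-(ysum n r - M / (216 / 10) - 5 / 12))) * (Real.pi / 3) +
      E * Real.exp (-(ysum n r / 2 - 1 / 6)) * (Real.pi / 3 - 0) := by
    field_simp
    ring
  rw [e4] at ht'
  have hpos : 0 < Real.pi * ((bp n).coeff (3 * m) * r ^ (3 * m)) := by
    rw [hco, hsplit]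
    have := mul_pos hl hE0
    linarith
  have h4 := pos_of_mul_pos_right (pos_of_mul_pos_right hpos Real.pi_pos.le |>.trans_eq (mul_comm _
      _)) (by positivity)
  exact_mod_cast h4.le

theorem nonneg_of_bernstein {a0 a1 a2 a3 a4 a5 a6 a7 a8 u : ℝ} (h0 : 0 ≤ u) (h1 : u ≤ 1)
    (b0 : 0 ≤ a0) (b1 : 0 ≤ 8 * a0 + a1) (b2 : 0 ≤ 28 * a0 + 7 * a1 + a2)
    (b3 : 0 ≤ 56 * a0 + 21 * a1 + 6 * a2 + a3)
    (b4 : 0 ≤ 70 * a0 + 35 * a1 + 15 * a2 + 5 * a3 + a4)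
    (b5 : 0 ≤ 56 * a0 + 35 * a1 + 20 * a2 + 10 * a3 + 4 * a4 + a5)
    (b6 : 0 ≤ 28 * a0 + 21 * a1 + 15 * a2 + 10 * a3 + 6 * a4 + 3 * a5 + a6)
    (b7 : 0 ≤ 8 * a0 + 7 * a1 + 6 * a2 + 5 * a3 + 4 * a4 + 3 * a5 + 2 * a6 + a7)
    (b8 : 0 ≤ a0 + a1 + a2 + a3 + a4 + a5 + a6 + a7 + a8) :
    0 ≤ a0 + a1 * u + a2 * u ^ 2 + a3 * u ^ 3 + a4 * u ^ 4 + a5 * u ^ 5 + a6 * u ^ 6 +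
      a7 * u ^ 7 + a8 * u ^ 8 := by
  obtain ⟨w, hw⟩ : ∃ w, w = 1 - u := ⟨_, rfl⟩
  have hw0 : 0 ≤ w := by linarith
  have e : a0 + a1 * u + a2 * u ^ 2 + a3 * u ^ 3 + a4 * u ^ 4 + a5 * u ^ 5 + a6 * u ^ 6 +
      a7 * u ^ 7 + a8 * u ^ 8 = a0 * w ^ 8 + (8 * a0 + a1) * (u * w ^ 7) +
      (28 * a0 + 7 * a1 + a2) * (u ^ 2 * w ^ 6) +
      (56 * a0 + 21 * a1 + 6 * a2 + a3) * (u ^ 3 * w ^ 5) +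
      (70 * a0 + 35 * a1 + 15 * a2 + 5 * a3 + a4) * (u ^ 4 * w ^ 4) +
      (56 * a0 + 35 * a1 + 20 * a2 + 10 * a3 + 4 * a4 + a5) * (u ^ 5 * w ^ 3) +
      (28 * a0 + 21 * a1 + 15 * a2 + 10 * a3 + 6 * a4 + 3 * a5 + a6) * (u ^ 6 * w ^ 2) +
      (8 * a0 + 7 * a1 + 6 * a2 + 5 * a3 + 4 * a4 + 3 * a5 + 2 * a6 + a7) * (u ^ 7 * w) +
      (a0 + a1 + a2 + a3 + a4 + a5 + a6 + a7 + a8) * u ^ 8 := by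
    rw [hw]; ring
  rw [e]
  positivity

/-- A quartic minorant of `x ↦ 1 / (1 + 2 cosh x)` on `[0, 4]`. -/
def minor (x : ℝ) : ℝ :=
  3325 / 10000 - 528 / 10000 * x - 714 / 10000 * x ^ 2 + 2756 / 100000 * x ^ 3 -
    2845 / 1000000 * x ^ 4

theorem exp_taylor_le {s : ℝ} (hs : |s| ≤ 1) :
    Real.exp s ≤ 1 + s + s ^ 2 / 2 + s ^ 3 / 6 + s ^ 4 / 19 := by
  have h := Real.exp_bound (n := 4) hs (by norm_num)
  simp only [sum_range_succ, range_zero, sum_empty, Nat.factorial] at h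
  have h2 := (abs_le.1 h).2
  have e : |s| ^ 4 = s ^ 4 := by
    rw [show |s| ^ 4 = (|s| ^ 2) ^ 2 by ring, sq_abs]; ring
  rw [e] at h2
  push_cast at h2
  have : 0 ≤ s ^ 4 := by positivity
  norm_num at h2
  linarith

theorem minor_le_of_cell {c A B x : ℝ} (hA : Real.exp c ≤ A) (hB : Real.exp (-c) ≤ B)
    (hx0 : c - 1 / 4 ≤ x) (hx1 : x ≤ c + 1 / 4)
    (h : ∀ u : ℝ, 0 ≤ u → u ≤ 1 → 0 ≤ 1 - minor (c - 1 / 4 + u / 2) *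
      (1 + A * (1 + (u / 2 - 1 / 4) + (u / 2 - 1 / 4) ^ 2 / 2 + (u / 2 - 1 / 4) ^ 3 / 6 +
        (u / 2 - 1 / 4) ^ 4 / 19) + B * (1 - (u / 2 - 1 / 4) + (u / 2 - 1 / 4) ^ 2 / 2 -
        (u / 2 - 1 / 4) ^ 3 / 6 + (u / 2 - 1 / 4) ^ 4 / 19))) :
    minor x ≤ wt (Real.exp (-x)) := by
  have hE : wt (Real.exp (-x)) = 1 / (1 + Real.exp x + Real.exp (-x)) := by
    have := Real.exp_pos (-x)
    have h1 : Real.exp x = (Real.exp (-x))⁻¹ := by rw [← Real.exp_neg, neg_neg]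
    rw [wt, h1]
    field_simp
    ring
  rw [hE]
  rcases le_or_gt (minor x) 0 with hp | hp
  · exact hp.trans (by positivity)
  rw [le_div_iff₀ (by positivity)]
  have hu := h (2 * (x - c + 1 / 4)) (by linarith) (by linarith)
  have e1 : c - 1 / 4 + 2 * (x - c + 1 / 4) / 2 = x := by ring
  have e2 : 2 * (x - c + 1 / 4) / 2 - 1 / 4 = x - c := by ring
  rw [e1, e2] at hu
  have t1 := exp_taylor_le (s := x - c) (by rw [abs_le]; constructor <;> linarith)
  have t2 := exp_taylor_le (s := -(x - c)) (by rw [abs_neg, abs_le]; constructor <;> linarith)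
  have k1 : Real.exp x ≤ A * (1 + (x - c) + (x - c) ^ 2 / 2 + (x - c) ^ 3 / 6 +
      (x - c) ^ 4 / 19) := by
    have : Real.exp x = Real.exp c * Real.exp (x - c) := by rw [← Real.exp_add]; congr 1; ring
    rw [this]
    exact mul_le_mul hA t1 (Real.exp_nonneg _) ((Real.exp_nonneg _).trans hA)
  have k2 : Real.exp (-x) ≤ B * (1 - (x - c) + (x - c) ^ 2 / 2 - (x - c) ^ 3 / 6 +
      (x - c) ^ 4 / 19) := by
    have : Real.exp (-x) = Real.exp (-c) * Real.exp (-(x - c)) := by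
      rw [← Real.exp_add]; congr 1; ring
    rw [this]
    refine mul_le_mul hB (t2.trans (le_of_eq ?_)) (Real.exp_nonneg _) ((Real.exp_nonneg _).trans hB)
    ring
  have := mul_le_mul_of_nonneg_left (add_le_add k1 k2) hp.le
  linarith

theorem exp_quarter_le : Real.exp (1 / 4) ≤ 12840256 / 10000000 := by
  have h := Real.exp_bound (x := 1 / 4) (n := 7) (by norm_num [abs_le]) (by norm_num)
  simp only [sum_range_succ, range_zero, sum_empty, Nat.factorial] at h
  have h2 := (abs_le.1 h).2
  rw [abs_of_pos (by norm_num)] at h2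
  norm_num at h2
  norm_num
  linarith

theorem exp_neg_quarter_le : Real.exp (-(1 / 4)) ≤ 7788008 / 10000000 := by
  have h := Real.exp_bound (x := -(1 / 4)) (n := 9) (by norm_num [abs_le]) (by norm_num)
  simp only [sum_range_succ, range_zero, sum_empty, Nat.factorial] at h
  have h2 := (abs_le.1 h).2
  rw [abs_of_neg (by norm_num)] at h2
  norm_num at h2
  norm_num
  linarith

theorem exp_mul_quarter_le {k : ℕ} {A B : ℝ} (hA : (12840256 / 10000000 : ℝ) ^ k ≤ A)
    (hB : (7788008 / 10000000 : ℝ) ^ k ≤ B) :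
    Real.exp (k * (1 / 4)) ≤ A ∧ Real.exp (-(k * (1 / 4))) ≤ B := by
  constructor
  · rw [Real.exp_nat_mul]
    exact (pow_le_pow_left₀ (Real.exp_nonneg _) exp_quarter_le k).trans hA
  · rw [← mul_neg, Real.exp_nat_mul]
    exact (pow_le_pow_left₀ (Real.exp_nonneg _) exp_neg_quarter_le k).trans hB

set_option maxHeartbeats 1000000 in
theorem minor_le {x : ℝ} (h0 : 0 ≤ x) (h4 : x ≤ 4) : minor x ≤ wt (Real.exp (-x)) := by
  rcases le_or_gt x (1 / 2) with hx0 | hx0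
  · obtain ⟨hA, hB⟩ := exp_mul_quarter_le (k := 1) (A := (6421 / 5000)) (B := (779 / 1000))
      (by norm_num) (by norm_num)
    refine minor_le_of_cell hA hB (by push_cast; linarith) (by push_cast; linarith) fun u hu0 hu1
        => ?_
    have := nonneg_of_bernstein hu0 hu1 (a0 := (14971 / 6400000)) (a1 := (483230231 / 6080000000))
      (a2 := (-922634639 / 30400000000)) (a3 := (-16274479 / 6080000000))
      (a4 := (13145416767 / 4864000000000)) (a5 := (-7242857319 / 9728000000000))
      (a6 := (858538101 / 4864000000000)) (a7 := (-11636033 / 486400000000))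
      (a8 := (1467451 / 1216000000000))
      (by norm_num) (by norm_num) (by norm_num) (by norm_num) (by norm_num) (by norm_num)
      (by norm_num) (by norm_num) (by norm_num)
    refine this.trans (le_of_eq ?_)
    rw [minor]
    push_cast
    ring
  rcases le_or_gt x (1) with hx1 | hx1
  · obtain ⟨hA, hB⟩ := exp_mul_quarter_le (k := 3) (A := (5293 / 2500)) (B := (189 / 400))
      (by norm_num) (by norm_num)
    refine minor_le_of_cell hA hB (by push_cast; linarith) (by push_cast; linarith) fun u hu0 hu1
        => ?_
    have := nonneg_of_bernstein hu0 hu1 (a0 := (50043392611 / 983040000000))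
      (a1 := (11818475621 / 614400000000)) (a2 := (-114188405933 / 4096000000000))
      (a3 := (33801925189 / 6144000000000)) (a4 := (600512347 / 24576000000000))
      (a5 := (-188469647 / 2048000000000)) (a6 := (39273237 / 512000000000))
      (a7 := (-31065511 / 1536000000000)) (a8 := (775547 / 512000000000))
      (by norm_num) (by norm_num) (by norm_num) (by norm_num) (by norm_num) (by norm_num)
      (by norm_num) (by norm_num) (by norm_num)
    refine this.trans (le_of_eq ?_)
    rw [minor]
    push_cast
    ring
  rcases le_or_gt x (3 / 2) with hx2 | hx2
  · obtain ⟨hA, hB⟩ := exp_mul_quarter_le (k := 5) (A := (6981 / 2000)) (B := (2867 / 10000))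
      (by norm_num) (by norm_num)
    refine minor_le_of_cell hA hB (by push_cast; linarith) (by push_cast; linarith) fun u hu0 hu1
        => ?_
    have := nonneg_of_bernstein hu0 hu1 (a0 := (2291171761 / 48000000000))
      (a1 := (-3739387399 / 192000000000)) (a2 := (-389667347 / 32000000000))
      (a3 := (3053220019 / 384000000000)) (a4 := (-351442419 / 256000000000))
      (a5 := (257444471 / 1024000000000)) (a6 := (4172777 / 1536000000000))
      (a7 := (-13578209 / 768000000000)) (a8 := (282793 / 128000000000))
      (by norm_num) (by norm_num) (by norm_num) (by norm_num) (by norm_num) (by norm_num)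
      (by norm_num) (by norm_num) (by norm_num)
    refine this.trans (le_of_eq ?_)
    rw [minor]
    push_cast
    ring
  rcases le_or_gt x (2) with hx3 | hx3
  · obtain ⟨hA, hB⟩ := exp_mul_quarter_le (k := 7) (A := (14387 / 2500)) (B := (1739 / 10000))
      (by norm_num) (by norm_num)
    refine minor_le_of_cell hA hB (by push_cast; linarith) (by push_cast; linarith) fun u hu0 hu1
        => ?_
    have := nonneg_of_bernstein hu0 hu1 (a0 := (3560479915381 / 155648000000000))
      (a1 := (-14405050231 / 608000000000)) (a2 := (359007890863 / 77824000000000))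
      (a3 := (284068401189 / 38912000000000)) (a4 := (-407787590027 / 155648000000000))
      (a5 := (18922490973 / 38912000000000)) (a6 := (-628832839 / 9728000000000))
      (a7 := (-4604793 / 389120000000)) (a8 := (33734303 / 9728000000000))
      (by norm_num) (by norm_num) (by norm_num) (by norm_num) (by norm_num) (by norm_num)
      (by norm_num) (by norm_num) (by norm_num)
    refine this.trans (le_of_eq ?_)
    rw [minor]
    push_cast
    ring
  rcases le_or_gt x (5 / 2) with hx4 | hx4
  · obtain ⟨hA, hB⟩ := exp_mul_quarter_le (k := 9) (A := (94879 / 10000)) (B := (211 / 2000))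
      (by norm_num) (by norm_num)
    refine minor_le_of_cell hA hB (by push_cast; linarith) (by push_cast; linarith) fun u hu0 hu1
        => ?_
    have := nonneg_of_bernstein hu0 hu1 (a0 := (6470141819 / 729600000000))
      (a1 := (-357110089 / 912000000000)) (a2 := (16124676977 / 1216000000000))
      (a3 := (1201798741 / 364800000000)) (a4 := (-182763210679 / 46694400000000))
      (a5 := (7589445029 / 9728000000000)) (a6 := (-1094382391 / 9728000000000))
      (a7 := (33558187 / 7296000000000)) (a8 := (27293223 / 4864000000000))
      (by norm_num) (by norm_num) (by norm_num) (by norm_num) (by norm_num) (by norm_num)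
      (by norm_num) (by norm_num) (by norm_num)
    refine this.trans (le_of_eq ?_)
    rw [minor]
    push_cast
    ring
  rcases le_or_gt x (3) with hx5 | hx5
  · obtain ⟨hA, hB⟩ := exp_mul_quarter_le (k := 11) (A := (39107 / 2500)) (B := (641 / 10000))
      (by norm_num) (by norm_num)
    refine minor_le_of_cell hA hB (by push_cast; linarith) (by push_cast; linarith) fun u hu0 hu1
        => ?_
    have := nonneg_of_bernstein hu0 hu1 (a0 := (135453587119 / 6225920000000))
      (a1 := (94770511283 / 3891200000000)) (a2 := (2890298889 / 622592000000))
      (a3 := (-116998868459 / 38912000000000)) (a4 := (-631452443017 / 155648000000000))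
      (a5 := (58201682463 / 38912000000000)) (a6 := (-667797101 / 9728000000000))
      (a7 := (438576461 / 9728000000000)) (a8 := (89372261 / 9728000000000))
      (by norm_num) (by norm_num) (by norm_num) (by norm_num) (by norm_num) (by norm_num)
      (by norm_num) (by norm_num) (by norm_num)
    refine this.trans (le_of_eq ?_)
    rw [minor]
    push_cast
    ring
  rcases le_or_gt x (7 / 2) with hx6 | hx6
  · obtain ⟨hA, hB⟩ := exp_mul_quarter_le (k := 13) (A := (51581 / 2000)) (B := (389 / 10000))
      (by norm_num) (by norm_num)
    refine minor_le_of_cell hA hB (by push_cast; linarith) (by push_cast; linarith) fun u hu0 hu1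
        => ?_
    have := nonneg_of_bernstein hu0 hu1 (a0 := (131735837237 / 2918400000000))
      (a1 := (40222199191 / 2432000000000)) (a2 := (-145856835147 / 9728000000000))
      (a3 := (-5119418723 / 29184000000000)) (a4 := (373718165981 / 233472000000000))
      (a5 := (17767795557 / 4864000000000)) (a6 := (7774705601 / 29184000000000))
      (a7 := (246354949 / 1824000000000)) (a8 := (73484643 / 4864000000000))
      (by norm_num) (by norm_num) (by norm_num) (by norm_num) (by norm_num) (by norm_num)
      (by norm_num) (by norm_num) (by norm_num)
    refine this.trans (le_of_eq ?_)
    rw [minor]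
    push_cast
    ring
  obtain ⟨hA, hB⟩ := exp_mul_quarter_le (k := 15) (A := (425213 / 10000)) (B := (237 / 10000))
    (by norm_num) (by norm_num)
  refine minor_le_of_cell hA hB (by push_cast; linarith) (by push_cast; linarith) fun u hu0 hu1 =>
      ?_
  have := nonneg_of_bernstein hu0 hu1 (a0 := (12173651794639 / 233472000000000))
      (a1 := (820616968631 / 58368000000000)) (a2 := (1417912417843 / 38912000000000))
      (a3 := (3330399661321 / 58368000000000)) (a4 := (6209869973023 / 233472000000000))
      (a5 := (97031918567 / 9728000000000)) (a6 := (13278886391 / 9728000000000))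
      (a7 := (2351563759 / 7296000000000)) (a8 := (4841621 / 194560000000))
    (by norm_num) (by norm_num) (by norm_num) (by norm_num) (by norm_num) (by norm_num)
    (by norm_num) (by norm_num) (by norm_num)
  refine this.trans (le_of_eq ?_)
  rw [minor]
  push_cast
  ring

theorem sum_freq (M : ℕ) : ∑ i ∈ range M, (3 * i + 3 / 2 : ℝ) = 3 / 2 * M ^ 2 := by
  induction M with
  | zero => simp
  | succ k ih => rw [sum_range_succ, ih]; push_cast; ring

theorem sum_freq_sq (M : ℕ) : ∑ i ∈ range M, (3 * i + 3 / 2 : ℝ) ^ 2 = 3 * M ^ 3 - 3 / 4 * M := by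
  induction M with
  | zero => simp
  | succ k ih => rw [sum_range_succ, ih]; push_cast; ring

theorem sum_freq_cube (M : ℕ) :
    ∑ i ∈ range M, (3 * i + 3 / 2 : ℝ) ^ 3 = 27 / 4 * M ^ 4 - 27 / 8 * M ^ 2 := by
  induction M with
  | zero => simp
  | succ k ih => rw [sum_range_succ, ih]; push_cast; ring

theorem sum_freq_four (M : ℕ) : ∑ i ∈ range M, (3 * i + 3 / 2 : ℝ) ^ 4 =
    81 * (M ^ 5 / 5 - M ^ 3 / 6 + 7 * M / 240) := by
  induction M with
  | zero => simp
  | succ k ih => rw [sum_range_succ, ih]; push_cast; ring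

theorem sum_freq_five (M : ℕ) : ∑ i ∈ range M, (3 * i + 3 / 2 : ℝ) ^ 5 =
    243 * (M ^ 6 / 6 - 5 * M ^ 4 / 24 + 7 * M ^ 2 / 96) := by
  induction M with
  | zero => simp
  | succ k ih => rw [sum_range_succ, ih]; push_cast; ring

theorem sum_freq_six (M : ℕ) : ∑ i ∈ range M, (3 * i + 3 / 2 : ℝ) ^ 6 =
    729 * (M ^ 7 / 7 - M ^ 5 / 4 + 7 * M ^ 3 / 48 - 31 * M / 1344) := by
  induction M with
  | zero => simp
  | succ k ih => rw [sum_range_succ, ih]; push_cast; ring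

theorem wt_ge_minor {t : ℝ} (ht : 0 ≤ t) (ht1 : t ≤ 61 / 10000) {i M : ℕ} (hi : i < M)
    (hM : 3 * M * t ≤ 4) :
    minor ((3 * i + 3 / 2) * t) - 5 / 10000 ≤ wt (Real.exp (-t) ^ (3 * i + 2)) := by
  have hi' : (i : ℝ) + 1 ≤ M := by exact_mod_cast hi
  have e : Real.exp (-t) ^ (3 * i + 2) = Real.exp (-((3 * i + 2) * t)) := by
    rw [← Real.exp_nat_mul]; congr 1; push_cast; ring
  have h4 : (3 * i + 2) * t ≤ 4 := by nlinarith
  rw [e]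
  refine le_trans ?_ (minor_le (by positivity) h4)
  obtain ⟨u, hu⟩ : ∃ u, u = (3 * i + 3 / 2 : ℝ) * t := ⟨_, rfl⟩
  have hu0 : 0 ≤ u := by rw [hu]; positivity
  have e2 : (3 * i + 2 : ℝ) * t = u + t / 2 := by rw [hu]; ring
  rw [e2] at h4 ⊢
  rw [← hu]
  obtain ⟨s, hs⟩ : ∃ s, s = t / 2 := ⟨_, rfl⟩
  rw [← hs] at h4 ⊢
  have hs0 : 0 ≤ s := by linarith
  have hs1 : s ≤ 305 / 100000 := by linarith
  have e3 : minor u - minor (u + s) = s * (528 / 10000 + 714 / 10000 * (2 * u + s) -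
      2756 / 100000 * (3 * u ^ 2 + 3 * u * s + s ^ 2) +
      2845 / 1000000 * (4 * u ^ 3 + 6 * u ^ 2 * s + 4 * u * s ^ 2 + s ^ 3)) := by
    unfold minor; ring
  have hu4 : u ≤ 4 := by linarith
  have e4 : 528 / 10000 + 714 / 10000 * (2 * u + s) -
      2756 / 100000 * (3 * u ^ 2 + 3 * u * s + s ^ 2) +
      2845 / 1000000 * (4 * u ^ 3 + 6 * u ^ 2 * s + 4 * u * s ^ 2 + s ^ 3) ≤ 16 / 100 := by
    have a1 : 528 / 10000 + 714 / 10000 * (2 * u) - 2756 / 100000 * (3 * u ^ 2) +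
        2845 / 1000000 * (4 * u ^ 3) ≤ 15 / 100 := by
      nlinarith [mul_nonneg hu0 (sq_nonneg (u - 2)), sq_nonneg (u - 1),
          mul_nonneg (mul_nonneg hu0 hu0) (sub_nonneg.2 hu4), mul_nonneg hu0 (sub_nonneg.2 hu4),
          mul_nonneg (sq_nonneg (u-1)) hu0,  mul_nonneg (sq_nonneg (u-1)) (sub_nonneg.2 hu4)]
    have a2 : u ^ 2 * s ≤ 16 * s := mul_le_mul_of_nonneg_right (by nlinarith) hs0
    have a3 : u * s ^ 2 ≤ 4 * s := by nlinarith
    have a4 : s ^ 3 ≤ s := by nlinarith [sq_nonneg s]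
    have a5 : 0 ≤ u * s := by positivity
    nlinarith [sq_nonneg s]
  nlinarith

/-- Lower estimate for the normalised weight sum. -/
def yLow (T : ℝ) : ℝ :=
  332 / 1000 - 264 / 10000 * T - 238 / 10000 * T ^ 2 + 689 / 100000 * T ^ 3 -
    569 / 1000000 * T ^ 4

/-- Lower estimate for the normalised second moment. -/
def zLow (T : ℝ) : ℝ :=
  996 / 1000 - 1188 / 10000 * T - 12852 / 100000 * T ^ 2 + 4134 / 100000 * T ^ 3 -
    3658 / 1000000 * T ^ 4

theorem ysum_ge {t : ℝ} (ht : 0 ≤ t) (ht1 : t ≤ 61 / 10000) {M : ℕ}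
    (hM : 3 * M * t ≤ 4) : M * yLow (3 * M * t) - 1 / 100 ≤ ysum M (Real.exp (-t)) := by
  have h : ∑ i ∈ range M, (minor ((3 * i + 3 / 2) * t) - 5 / 10000) ≤ ysum M (Real.exp (-t)) :=
    sum_le_sum fun i hi => wt_ge_minor ht ht1 (mem_range.1 hi) hM
  refine le_trans ?_ h
  have e : ∑ i ∈ range M, (minor ((3 * i + 3 / 2) * t) - 5 / 10000) =
      332 / 1000 * M - 528 / 10000 * t * ∑ i ∈ range M, (3 * i + 3 / 2 : ℝ) -
      714 / 10000 * t ^ 2 * ∑ i ∈ range M, (3 * i + 3 / 2 : ℝ) ^ 2 +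
      2756 / 100000 * t ^ 3 * ∑ i ∈ range M, (3 * i + 3 / 2 : ℝ) ^ 3 -
      2845 / 1000000 * t ^ 4 * ∑ i ∈ range M, (3 * i + 3 / 2 : ℝ) ^ 4 := by
    have e0 : (332 / 1000 * M : ℝ) = ∑ i ∈ range M, (332 / 1000 : ℝ) := by simp [mul_comm]
    rw [e0, mul_sum, mul_sum, mul_sum, mul_sum, ← sum_sub_distrib, ← sum_sub_distrib,
      ← sum_add_distrib, ← sum_sub_distrib]
    refine sum_congr rfl fun i _ => ?_
    unfold minor; ring
  rw [e, sum_freq, sum_freq_sq, sum_freq_cube, sum_freq_four, yLow]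
  rcases Nat.eq_zero_or_pos M with h0 | h0
  · subst h0; norm_num
  have hM1 : (1 : ℝ) ≤ M := by exact_mod_cast h0
  have k1 : t * M ≤ 4 / 3 := by linarith
  have k2 : t ^ 3 * M ^ 2 ≤ 61 / 10000 * (16 / 9) := by
    calc t ^ 3 * M ^ 2 = t * (t * M) ^ 2 := by ring
      _ ≤ 61 / 10000 * (4 / 3) ^ 2 := by gcongr
      _ = _ := by norm_num
  have k3 : 0 ≤ t ^ 4 * (M ^ 3 / 6 - 7 * M / 240) := by
    apply mul_nonneg (by positivity)
    nlinarith [pow_le_pow_left₀ (by norm_num) hM1 2, mul_nonneg (by linarith : (0:ℝ) ≤ M)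
        (by nlinarith : 0 ≤ (M : ℝ) ^ 2 - 1)]
  have k4 : 0 ≤ t ^ 2 * M := by positivity
  have k5 : 0 ≤ t ^ 4 * (M : ℝ) ^ 5 := by positivity
  nlinarith

theorem zsum_ge {t : ℝ} (ht : 0 ≤ t) (ht1 : t ≤ 61 / 10000) {M : ℕ}
    (hM : 3 * M * t ≤ 4) : M ^ 3 * zLow (3 * M * t) - 4 * M ≤ zsum M (Real.exp (-t)) := by
  have h : ∑ i ∈ range M, (minor ((3 * i + 3 / 2) * t) - 5 / 10000) * (3 * i + 3 / 2 : ℝ) ^ 2 ≤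
      zsum M (Real.exp (-t)) :=
    sum_le_sum fun i hi => mul_le_mul_of_nonneg_right
      (wt_ge_minor ht ht1 (mem_range.1 hi) hM) (by positivity)
  refine le_trans ?_ h
  have e : ∑ i ∈ range M, (minor ((3 * i + 3 / 2) * t) - 5 / 10000) * (3 * i + 3 / 2 : ℝ) ^ 2 =
      332 / 1000 * ∑ i ∈ range M, (3 * i + 3 / 2 : ℝ) ^ 2 -
      528 / 10000 * t * ∑ i ∈ range M, (3 * i + 3 / 2 : ℝ) ^ 3 -
      714 / 10000 * t ^ 2 * ∑ i ∈ range M, (3 * i + 3 / 2 : ℝ) ^ 4 +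
      2756 / 100000 * t ^ 3 * ∑ i ∈ range M, (3 * i + 3 / 2 : ℝ) ^ 5 -
      2845 / 1000000 * t ^ 4 * ∑ i ∈ range M, (3 * i + 3 / 2 : ℝ) ^ 6 := by
    rw [mul_sum, mul_sum, mul_sum, mul_sum, mul_sum, ← sum_sub_distrib, ← sum_sub_distrib,
      ← sum_add_distrib, ← sum_sub_distrib]
    refine sum_congr rfl fun i _ => ?_
    unfold minor; ring
  rw [e, sum_freq_sq, sum_freq_cube, sum_freq_four, sum_freq_five, sum_freq_six, zLow]
  rcases Nat.eq_zero_or_pos M with h0 | h0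
  · subst h0; norm_num
  have hM1 : (1 : ℝ) ≤ M := by exact_mod_cast h0
  have hM2 : (1 : ℝ) ≤ (M : ℝ) ^ 2 := one_le_pow₀ hM1
  have k1 : t * M ≤ 4 / 3 := by linarith
  have k2 : t ^ 3 * (M : ℝ) ^ 4 ≤ 64 / 27 * M := by
    calc t ^ 3 * (M : ℝ) ^ 4 = (t * M) ^ 3 * (M : ℝ) := by ring
      _ ≤ (4 / 3) ^ 3 * (M : ℝ) := by gcongr
      _ = _ := by norm_num
  have k3 : 0 ≤ t ^ 2 * (M ^ 3 / 6 - 7 * M / 240) := by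
    apply mul_nonneg (by positivity)
    nlinarith
  have k4 : 0 ≤ t * (M : ℝ) ^ 2 := by positivity
  have k5 : 0 ≤ t ^ 3 * (M : ℝ) ^ 2 := by positivity
  have k6 : 0 ≤ t ^ 4 * (M ^ 5 / 4 - 7 * M ^ 3 / 48 + 31 * M / 1344) := by
    apply mul_nonneg (by positivity)
    have : (M : ℝ) ^ 3 ≤ M ^ 5 := pow_le_pow_right₀ hM1 (by norm_num)
    have := pow_pos (by linarith : (0 : ℝ) < M) 3
    linarith
  have k7 : 0 ≤ t ^ 4 * (M : ℝ) ^ 7 := by positivity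
  nlinarith

theorem zsum_le {r : ℝ} (hr : 0 ≤ r) (M : ℕ) : zsum M r ≤ M ^ 3 := by
  have h : zsum M r ≤ ∑ i ∈ range M, 1 / 3 * (3 * i + 3 / 2 : ℝ) ^ 2 :=
    sum_le_sum fun i _ => mul_le_mul_of_nonneg_right (wt_le_third (by positivity)) (by positivity)
  rw [← mul_sum, sum_freq_sq] at h
  have : (0 : ℝ) ≤ M := Nat.cast_nonneg M
  linarith

theorem ysum_le {r : ℝ} (hr : 0 ≤ r) (n : ℕ) : ysum n r ≤ n / 3 := by
  have h : ysum n r ≤ ∑ i ∈ range n, (1 / 3 : ℝ) :=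
    sum_le_sum fun i _ => wt_le_third (by positivity)
  rw [sum_const, card_range, nsmul_eq_mul] at h
  linarith

theorem fourth_moment_le {r : ℝ} (hr : 0 < r) (hr1 : r ≤ 1) (M : ℕ) :
    ∑ i ∈ range M, wt (r ^ (3 * i + 2)) * (3 * i + 3 / 2 : ℝ) ^ 4 ≤
      54 / 10 * M ^ 2 * zsum M r := by
  obtain ⟨c, hc⟩ : ∃ c : ℝ, c = 54 / 10 * M ^ 2 := ⟨_, rfl⟩
  have hex : ∃ k : ℕ, c ≤ (3 * k + 3 / 2 : ℝ) ^ 2 := by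
    refine ⟨M, ?_⟩
    rw [hc]; nlinarith [(Nat.cast_nonneg M : (0 : ℝ) ≤ M)]
  classical
  obtain ⟨k, hk, hk'⟩ : ∃ k : ℕ, c ≤ (3 * k + 3 / 2 : ℝ) ^ 2 ∧
      ∀ i < k, (3 * i + 3 / 2 : ℝ) ^ 2 ≤ c :=
    ⟨Nat.find hex, Nat.find_spec hex, fun i hi => (not_le.1 (Nat.find_min hex hi)).le⟩
  have hterm : ∀ i ∈ range M, wt (r ^ (3 * i + 2)) *
      ((3 * i + 3 / 2 : ℝ) ^ 2 * ((3 * i + 3 / 2 : ℝ) ^ 2 - c)) ≤ wt (r ^ (3 * k + 2)) *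
      ((3 * i + 3 / 2 : ℝ) ^ 2 * ((3 * i + 3 / 2 : ℝ) ^ 2 - c)) := by
    intro i _
    rcases lt_or_ge i k with h | h
    · apply mul_le_mul_of_nonpos_right (antitone_wt hr hr1 h.le)
      exact mul_nonpos_of_nonneg_of_nonpos (by positivity) (by linarith [hk' i h])
    · apply mul_le_mul_of_nonneg_right (antitone_wt hr hr1 h)
      apply mul_nonneg (by positivity)
      have : (k : ℝ) ≤ i := by exact_mod_cast h
      have := pow_le_pow_left₀ (by positivity) (by linarith : (3 * k + 3 / 2 : ℝ) ≤ 3 * i + 3 / 2) 2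
      linarith
  have h := sum_le_sum hterm
  rw [← mul_sum] at h
  have e1 : ∑ i ∈ range M, ((3 * i + 3 / 2 : ℝ) ^ 2 * ((3 * i + 3 / 2 : ℝ) ^ 2 - c)) =
      ∑ i ∈ range M, (3 * i + 3 / 2 : ℝ) ^ 4 - c * ∑ i ∈ range M, (3 * i + 3 / 2 : ℝ) ^ 2 := by
    rw [mul_sum, ← sum_sub_distrib]
    exact sum_congr rfl fun i _ => by ring
  have e2 : ∑ i ∈ range M, wt (r ^ (3 * i + 2)) *
      ((3 * i + 3 / 2 : ℝ) ^ 2 * ((3 * i + 3 / 2 : ℝ) ^ 2 - c)) =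
      ∑ i ∈ range M, wt (r ^ (3 * i + 2)) * (3 * i + 3 / 2 : ℝ) ^ 4 - c * zsum M r := by
    rw [zsum, mul_sum, ← sum_sub_distrib]
    exact sum_congr rfl fun i _ => by ring
  rw [e1, e2, sum_freq_four, sum_freq_sq] at h
  have h0 : 81 * ((M : ℝ) ^ 5 / 5 - M ^ 3 / 6 + 7 * M / 240) - c * (3 * M ^ 3 - 3 / 4 * M) ≤ 0 := by
    rw [hc]
    rcases Nat.eq_zero_or_pos M with h0 | h0
    · subst h0; norm_num
    have hM1 : (1 : ℝ) ≤ M := by exact_mod_cast h0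
    have : (M : ℝ) ≤ M ^ 3 := le_self_pow₀ hM1 (by norm_num)
    nlinarith
  have := mul_nonpos_of_nonneg_of_nonpos (wt_nonneg (by positivity : 0 ≤ r ^ (3 * k + 2))) h0
  rw [← hc]
  linarith

theorem powSum_two_le {t : ℝ} (ht : 0 ≤ t) (ht1 : t ≤ 61 / 10000) (M : ℕ)
    (h37 : 37 * (M : ℝ) ^ 2 ≤ zsum M (Real.exp (-t))) (hM : 85 ≤ M) :
    powSum 2 M (Real.exp (-t)) ≤ 215 / 100 * zsum M (Real.exp (-t)) := by
  set r := Real.exp (-t) with hr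
  have hr0 : 0 < r := Real.exp_pos _
  have hr1 : r ≤ 1 := by rw [hr]; exact Real.exp_le_one_iff.2 (by linarith)
  have hr2 : 10000 / 10062 ≤ r := by
    have := Real.add_one_le_exp (-t)
    rw [← hr] at this
    norm_num
    linarith
  have h : powSum 2 M r ≤ ∑ i ∈ range M, (2 * (10062 / 10000) * (17 / 16) *
      (wt (r ^ (3 * i + 2)) * (3 * i + 3 / 2 : ℝ) ^ 2) + 9 * wt (r ^ (3 * i + 2))) := by
    apply sum_le_sum
    intro i _
    have h1 := mul_wt_le hr0.le hr1 (by positivity : 0 ≤ r ^ (3 * i + 1))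
    rw [← pow_succ'] at h1
    have h2 : wt (r ^ (3 * i + 1)) ≤ 10062 / 10000 * wt (r ^ (3 * i + 2)) := by
      have := wt_nonneg (by positivity : 0 ≤ r ^ (3 * i + 1))
      have h3 := mul_le_mul_of_nonneg_right hr2 this
      have : r ^ (3 * i + 1 + 1) = r ^ (3 * i + 2) := rfl
      rw [this] at h1
      linarith
    have hw := wt_nonneg (by positivity : 0 ≤ r ^ (3 * i + 2))
    have h4 : ((3 * i + 2 : ℕ) : ℝ) ^ 2 ≤ 17 / 16 * (3 * i + 3 / 2 : ℝ) ^ 2 + 17 / 4 := by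
      push_cast
      nlinarith [sq_nonneg ((3 * i + 3 / 2 : ℝ) / 4 - 2)]
    calc 2 * ((3 * i + 2 : ℕ) : ℝ) ^ 2 * wt (r ^ (3 * i + 1)) ≤
        2 * (17 / 16 * (3 * i + 3 / 2 : ℝ) ^ 2 + 17 / 4) *
          (10062 / 10000 * wt (r ^ (3 * i + 2))) := by
          have := wt_nonneg (by positivity : 0 ≤ r ^ (3 * i + 1))
          gcongr
      _ ≤ _ := by nlinarith
  rw [sum_add_distrib, ← mul_sum, ← mul_sum] at h
  have hy : ∑ i ∈ range M, wt (r ^ (3 * i + 2)) ≤ M / 3 := ysum_le hr0.le M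
  have hz : ∑ i ∈ range M, wt (r ^ (3 * i + 2)) * (3 * i + 3 / 2 : ℝ) ^ 2 = zsum M r := rfl
  rw [hz] at h
  have hM' : (85 : ℝ) ≤ M := by exact_mod_cast hM
  nlinarith

theorem sum_choose_mul_pow_le {x : ℝ} (hx : 0 ≤ x) (hx1 : x < 1) (k n : ℕ) :
    ∑ i ∈ range n, ((i + k).choose k : ℝ) * x ^ i ≤ 1 / (1 - x) ^ (k + 1) := by
  have hn : ‖x‖ < 1 := by rwa [Real.norm_of_nonneg hx]
  rw [← tsum_choose_mul_geometric_of_norm_lt_one k hn]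
  exact (summable_choose_mul_geometric_of_norm_lt_one k hn).sum_le_tsum _
    fun i _ => by positivity

theorem ht_le {x : ℝ} (hx : 0 ≤ x) : ht x ≤ 578 / 1000 * x := by
  rw [ht, div_le_iff₀ (by positivity)]
  nlinarith [mul_nonneg hx (sq_nonneg (x - 211 / 578)), mul_nonneg hx (sq_nonneg x)]

theorem continuousOn_saddle (n : ℕ) : ContinuousOn (saddle n) (Set.Icc 0 1) := by
  have h : ContinuousOn ht (Set.Icc 0 1) := by
    unfold ht
    refine ContinuousOn.div (by fun_prop) (by fun_prop) fun x hx => ?_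
    have := hx.1
    positivity
  have hk : ∀ k : ℕ, ContinuousOn (fun r : ℝ => ht (r ^ k)) (Set.Icc 0 1) := fun k =>
    h.comp (by fun_prop) fun x hx => ⟨pow_nonneg hx.1 k, pow_le_one₀ hx.1 hx.2⟩
  unfold saddle
  exact continuousOn_finsetSum _ fun i _ =>
    (continuousOn_const.mul (hk _)).add (continuousOn_const.mul (hk _))

theorem exists_saddle {n m : ℕ} (hm : 0 < m) (h : 2 * m ≤ n ^ 2) :
    ∃ t : ℝ, 0 ≤ t ∧ saddle n (Real.exp (-t)) = 3 * m := by
  have h0 : saddle n 0 = 0 := by simp [saddle, ht]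
  have h1 : saddle n 1 = 3 / 2 * n ^ 2 := by
    have hh : ht 1 = 1 / 2 := by norm_num [ht]
    unfold saddle
    simp only [one_pow, hh]
    clear h h0
    induction n with
    | zero => simp
    | succ k ih => rw [sum_range_succ, ih]; push_cast; ring
  have h' : (2 * m : ℝ) ≤ n ^ 2 := by exact_mod_cast h
  have hm' : (0 : ℝ) < m := by exact_mod_cast hm
  obtain ⟨r, hr, hr'⟩ := intermediate_value_Icc (zero_le_one) (continuousOn_saddle n)
    (show (3 * m : ℝ) ∈ Set.Icc (saddle n 0) (saddle n 1) by
      rw [h0, h1]; constructor <;> linarith)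
  have hr0 : 0 < r := by
    rcases hr.1.eq_or_lt with h2 | h2
    · rw [← h2, h0] at hr'; linarith
    · exact h2
  refine ⟨-Real.log r, ?_, ?_⟩
  · have := Real.log_nonpos hr.1 hr.2
    linarith
  · rw [neg_neg, Real.exp_log hr0, hr']

theorem saddle_le {r : ℝ} (hr : 0 ≤ r) (hr1 : r < 1) (n : ℕ) :
    saddle n r ≤ 3468 / 1000 / (1 - r ^ 3) ^ 2 := by
  have hx0 : 0 ≤ r ^ 3 := by positivity
  have hx1 : r ^ 3 < 1 := pow_lt_one₀ hr hr1 (by norm_num)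
  have hs := sum_choose_mul_pow_le hx0 hx1 1 n
  have : saddle n r ≤ ∑ i ∈ range n, 3468 / 1000 * (((i + 1).choose 1 : ℝ) * (r ^ 3) ^ i) := by
    refine sum_le_sum fun i _ => ?_
    have e : ∀ j, r ^ (3 * i + j) ≤ (r ^ 3) ^ i := fun j => by
      rw [pow_add, pow_mul]
      exact mul_le_of_le_one_right (by positivity) (pow_le_one₀ hr hr1.le)
    have a1 := (ht_le (by positivity : 0 ≤ r ^ (3 * i + 1))).trans
      (mul_le_mul_of_nonneg_left (e 1) (by norm_num))
    have a2 := (ht_le (by positivity : 0 ≤ r ^ (3 * i + 2))).trans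
      (mul_le_mul_of_nonneg_left (e 2) (by norm_num))
    have b1 := mul_le_mul_of_nonneg_left a1 (Nat.cast_nonneg (α := ℝ) (3 * i + 1))
    have b2 := mul_le_mul_of_nonneg_left a2 (Nat.cast_nonneg (α := ℝ) (3 * i + 2))
    have hp : 0 ≤ (r ^ 3) ^ i := by positivity
    push_cast [Nat.choose_one_right] at b1 b2 ⊢
    nlinarith
  rw [← mul_sum] at this
  refine this.trans ?_
  have := mul_le_mul_of_nonneg_left hs (by norm_num : (0 : ℝ) ≤ 3468 / 1000)
  rwa [mul_one_div] at this

theorem saddle_point_small {n m : ℕ} {t : ℝ} (ht : 0 ≤ t) (hm : 3600 ≤ m)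
    (hs : saddle n (Real.exp (-t)) = 3 * m) : t ≤ 61 / 10000 := by
  rcases ht.eq_or_lt with h0 | h0
  · rw [← h0]; norm_num
  have hr1 : Real.exp (-t) < 1 := Real.exp_lt_one_iff.2 (by linarith)
  have h := saddle_le (Real.exp_pos (-t)).le hr1 n
  have e : Real.exp (-t) ^ 3 = Real.exp (-(3 * t)) := by
    rw [← Real.exp_nat_mul]; congr 1; push_cast; ring
  rw [e, hs] at h
  set x := Real.exp (-(3 * t)) with hx
  have hx1 : x < 1 := Real.exp_lt_one_iff.2 (by linarith)
  have hm' : (3600 : ℝ) ≤ m := by exact_mod_cast hm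
  have hx0 : 0 < 1 - x := by linarith
  rw [le_div_iff₀ (by positivity)] at h
  have h2 : 1 - x ≤ 1792 / 100000 := by
    by_contra! hc
    have : (1792 / 100000 : ℝ) ^ 2 < (1 - x) ^ 2 := by gcongr
    nlinarith
  have h3 : (3 * t + 1) * x ≤ 1 := by
    have := mul_le_mul_of_nonneg_right (Real.add_one_le_exp (3 * t)) (Real.exp_pos (-(3 * t))).le
    rwa [← Real.exp_add, add_neg_cancel, Real.exp_zero] at this
  nlinarith

theorem one_sub_exp_ge {t : ℝ} (ht : 0 ≤ t) (ht1 : t ≤ 61 / 10000) :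
    29725 / 10000 * t ≤ 1 - Real.exp (-t) ^ 3 := by
  have e : Real.exp (-t) ^ 3 = Real.exp (-(3 * t)) := by
    rw [← Real.exp_nat_mul]; congr 1; push_cast; ring
  rw [e]
  have h := Real.quadratic_le_exp_of_nonneg (by linarith : 0 ≤ 3 * t)
  have h2 : Real.exp (-(3 * t)) * (1 + 3 * t + (3 * t) ^ 2 / 2) ≤ 1 := by
    have := mul_le_mul_of_nonneg_left h (Real.exp_pos (-(3 * t))).le
    rwa [← Real.exp_add, neg_add_cancel, Real.exp_zero] at this
  have h3 : 1 ≤ (1 - 29725 / 10000 * t) * (1 + 3 * t + (3 * t) ^ 2 / 2) := by nlinarith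
  have h4 : 0 < 1 + 3 * t + (3 * t) ^ 2 / 2 := by positivity
  have := le_of_mul_le_mul_right (h2.trans h3) h4
  linarith

theorem exp_neg_nat_le {k : ℕ} {c : ℝ} (hc : 0 < c) (h : 1 ≤ c * 27182818283 ^ k / 10000000000 ^ k)
    :
    Real.exp (-k) ≤ c := by
  have h1 := pow_le_pow_left₀ (by norm_num) Real.exp_one_gt_d9.le k
  rw [← Real.exp_nat_mul, mul_one] at h1
  rw [Real.exp_neg, inv_le_comm₀ (Real.exp_pos _) hc]
  refine le_trans ?_ h1
  rw [inv_le_iff_one_le_mul₀' hc]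
  refine h.trans (le_of_eq ?_)
  rw [mul_div_assoc, ← div_pow]
  norm_num

theorem exp_neg_half_nat_le {k : ℕ} {c : ℝ} (hc : 0 < c)
    (h : 1 ≤ c ^ 2 * 27182818283 ^ k / 10000000000 ^ k) : Real.exp (-(k / 2)) ≤ c := by
  apply le_of_sq_le_sq _ hc.le
  rw [← Real.exp_nat_mul]
  have e : ((2 : ℕ) : ℝ) * -(k / 2) = -k := by push_cast; ring
  rw [e]
  exact exp_neg_nat_le (pow_pos hc 2) h

theorem mul_exp_le {a b x y z : ℝ} (hb : 0 ≤ b) (ha : a ≤ b * Real.exp x) (h : x - y ≤ -z) :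
    a * Real.exp (-y) ≤ b * Real.exp (-z) := by
  calc a * Real.exp (-y) ≤ b * Real.exp x * Real.exp (-y) := by gcongr
    _ = b * Real.exp (x - y) := by rw [mul_assoc, ← Real.exp_add, sub_eq_add_neg]
    _ ≤ _ := by gcongr

theorem tails_le {M v Y l : ℝ} (hM : 85 ≤ M) (hv : 93 / 10 ≤ v) (hvM : v ^ 2 ≤ 234 / 100 * M)
    (hY1 : 27 / 2 + 69 / 1000 * M ≤ Y) (hY2 : 131 / 1000 * M ≤ Y) (hl : 0 < l)
    (hvl : v * (M * l) = 12 / 10) :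
    v / 2 * Real.exp (-(644 / 10000 * v ^ 2 - 43 / 1000 * v - 1 / 6)) +
      v * Real.exp (-(Y - M / (108 / 10) - 5 / 12)) +
      Real.pi / 3 / l * Real.exp (-(Y - M / (216 / 10) - 5 / 12)) +
      Real.pi / 6 / l * Real.exp (-(Y / 2 - 1 / 6)) ≤ 12 / 100 := by
  have e5 : Real.exp (-5) ≤ 68 / 10000 := by
    exact_mod_cast exp_neg_nat_le (k := 5) (c := 68 / 10000) (by norm_num) (by norm_num)
  have e14 : Real.exp (-14) ≤ 1 / 1000000 := by
    exact_mod_cast exp_neg_nat_le (k := 14) (c := 1 / 1000000) (by norm_num) (by norm_num)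
  have e13 : Real.exp (-(13 / 2)) ≤ 16 / 10000 := by
    exact_mod_cast exp_neg_half_nat_le (k := 13) (c := 16 / 10000) (by norm_num) (by norm_num)
  have e19 : Real.exp (-(19 / 2)) ≤ 8 / 100000 := by
    exact_mod_cast exp_neg_half_nat_le (k := 19) (c := 8 / 100000) (by norm_num) (by norm_num)
  have hpi : Real.pi ≤ 31416 / 10000 := by linarith [Real.pi_lt_d4]
  have hpi0 := Real.pi_pos
  have hv1 : v ≤ 83 / 1000 * (M + 85) := by
    apply le_of_sq_le_sq _ (by positivity)
    nlinarith [sq_nonneg (M - 85)]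
  have hM1 : M ≤ 85 * Real.exp ((M - 85) / 85) := by
    have := Real.add_one_le_exp ((M - 85) / 85)
    linarith
  have hv2 : v ≤ 1411 / 100 * Real.exp ((M - 85) / 170) := by
    have := Real.add_one_le_exp ((M - 85) / 170)
    linarith
  have hvM2 : v * M ≤ 1411 / 100 * 85 * Real.exp ((M - 85) / 170 + (M - 85) / 85) := by
    rw [Real.exp_add]
    calc v * M ≤ (1411 / 100 * Real.exp ((M - 85) / 170)) * (85 * Real.exp ((M - 85) / 85)) := by
          gcongr
      _ = _ := by ring
  have hl' : 1 / l = v * M * (10 / 12) := by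
    field_simp
    linarith
  have t1 := mul_exp_le (a := v / 2) (b := 93 / 20) (x := (v - 93 / 10) / (93 / 10))
    (y := 644 / 10000 * v ^ 2 - 43 / 1000 * v - 1 / 6) (z := 5) (by norm_num)
    (by have := Real.add_one_le_exp ((v - 93 / 10) / (93 / 10)); linarith) (by nlinarith)
  have t2 := mul_exp_le (a := v) (y := Y - M / (108 / 10) - 5 / 12) (z := 13 / 2)
    (by norm_num) hv2 (by linarith)
  have t3 := mul_exp_le (a := v * M) (y := Y - M / (216 / 10) - 5 / 12) (z := 14)
    (by norm_num) hvM2 (by linarith)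
  have t4 := mul_exp_le (a := v * M) (y := Y / 2 - 1 / 6) (z := 19 / 2)
    (by norm_num) hvM2 (by linarith)
  have f3 : Real.pi / 3 / l * Real.exp (-(Y - M / (216 / 10) - 5 / 12)) =
      Real.pi * (10 / 36) * (v * M * Real.exp (-(Y - M / (216 / 10) - 5 / 12))) := by
    rw [div_eq_mul_one_div (Real.pi / 3) l, hl']; ring
  have f4 : Real.pi / 6 / l * Real.exp (-(Y / 2 - 1 / 6)) =
      Real.pi * (10 / 72) * (v * M * Real.exp (-(Y / 2 - 1 / 6))) := by
    rw [div_eq_mul_one_div (Real.pi / 6) l, hl']; ring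
  have g3 : Real.pi * (10 / 36) * (v * M * Real.exp (-(Y - M / (216 / 10) - 5 / 12))) ≤
      31416 / 10000 * (10 / 36) * (1411 / 100 * 85 * (1 / 1000000)) := by
    have : v * M * Real.exp (-(Y - M / (216 / 10) - 5 / 12)) ≤
      1411 / 100 * 85 * (1 / 1000000) := by linarith
    have : 0 ≤ v := by linarith
    gcongr
  have g4 : Real.pi * (10 / 72) * (v * M * Real.exp (-(Y / 2 - 1 / 6))) ≤
      31416 / 10000 * (10 / 72) * (1411 / 100 * 85 * (8 / 100000)) := by
    have : v * M * Real.exp (-(Y / 2 - 1 / 6)) ≤ 1411 / 100 * 85 * (8 / 100000) := by linarith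
    have : 0 ≤ v := by linarith
    gcongr
  rw [f3, f4]
  linarith

theorem zLow_ge_of_le {T : ℝ} (h0 : 0 ≤ T) (h : T ≤ 156 / 100) : 6 / 10 + 1 / 10 * (156 / 100 - T)
    ≤ zLow T := by
  unfold zLow
  nlinarith [mul_nonneg h0 (sub_nonneg.2 h), mul_nonneg (mul_nonneg h0 h0) (sub_nonneg.2 h),
    mul_nonneg (mul_nonneg h0 (mul_nonneg h0 h0)) (sub_nonneg.2 h)]

theorem mul_zLow_ge {T : ℝ} (h0 : 156 / 100 ≤ T) (h : T ≤ 4) :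
    69 / 100 + 12 / 100 * (4 - T) ≤ T * zLow T := by
  obtain ⟨s, rfl⟩ : ∃ s, T = 4 - s := ⟨4 - T, by ring⟩
  have hs : 0 ≤ s := by linarith
  have hs1 : s ≤ 244 / 100 := by linarith
  unfold zLow
  nlinarith [mul_nonneg hs (sub_nonneg.2 hs1), mul_nonneg (mul_nonneg hs hs) (sub_nonneg.2 hs1),
    mul_nonneg (mul_nonneg hs (mul_nonneg hs hs)) (sub_nonneg.2 hs1),
    mul_nonneg (mul_nonneg (mul_nonneg hs hs) (mul_nonneg hs hs)) (sub_nonneg.2 hs1)]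

theorem yLow_ge_of_le {T : ℝ} (h0 : 0 ≤ T) (h : T ≤ 156 / 100) : 25 / 100 ≤ yLow T := by
  unfold yLow
  nlinarith [mul_nonneg h0 (sub_nonneg.2 h), mul_nonneg (mul_nonneg h0 h0) (sub_nonneg.2 h),
    mul_nonneg (mul_nonneg h0 (mul_nonneg h0 h0)) (sub_nonneg.2 h)]

theorem yLow_ge {T : ℝ} (h0 : 0 ≤ T) (h : T ≤ 4) : 14 / 100 ≤ yLow T := by
  obtain ⟨s, rfl⟩ : ∃ s, T = 4 - s := ⟨4 - T, by ring⟩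
  have hs : 0 ≤ s := by linarith
  have hs1 : s ≤ 4 := by linarith
  unfold yLow
  nlinarith [mul_nonneg hs (sub_nonneg.2 hs1), mul_nonneg (mul_nonneg hs hs) (sub_nonneg.2 hs1),
    mul_nonneg (mul_nonneg hs (mul_nonneg hs hs)) (sub_nonneg.2 hs1)]

theorem mul_yLow_ge {T : ℝ} (h0 : 156 / 100 ≤ T) (h : T ≤ 4) :
    26 / 100 ≤ T * (yLow T - 69 / 1000) := by
  obtain ⟨s, rfl⟩ : ∃ s, T = 4 - s := ⟨4 - T, by ring⟩
  have hs : 0 ≤ s := by linarith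
  have hs1 : s ≤ 244 / 100 := by linarith
  unfold yLow
  nlinarith [mul_nonneg hs (sub_nonneg.2 hs1), mul_nonneg (mul_nonneg hs hs) (sub_nonneg.2 hs1),
    mul_nonneg (mul_nonneg hs (mul_nonneg hs hs)) (sub_nonneg.2 hs1),
    mul_nonneg (mul_nonneg (mul_nonneg hs hs) (mul_nonneg hs hs)) (sub_nonneg.2 hs1)]

section scale

variable {t : ℝ} {M : ℕ} (ht : 0 ≤ t) (ht1 : t ≤ 61 / 10000) (hM : 85 ≤ M) (hT : 3 * M * t ≤ 4)

include ht ht1 hM hT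

theorem zsum_ge_linear :
    (37 + 55 / 10 * (4 - 3 * M * t)) * (M : ℝ) ^ 2 ≤ zsum M (Real.exp (-t)) := by
  have hM' : (85 : ℝ) ≤ M := by exact_mod_cast hM
  have hz := zsum_ge ht ht1 hT
  obtain ⟨T, h⟩ : ∃ T, T = 3 * M * t := ⟨_, rfl⟩
  rw [← h] at hz hT ⊢
  have hT0 : 0 ≤ T := by rw [h]; positivity
  have hMT : 546 / 10 * T ≤ M := by rw [h]; nlinarith
  have key : 375 / 10 + 55 / 10 * (4 - T) ≤ M * zLow T := by
    rcases le_total T (156 / 100) with h1 | h1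
    · have := zLow_ge_of_le hT0 h1
      have := mul_le_mul hM' this (by linarith) (by linarith)
      linarith
    · have := mul_zLow_ge h1 hT
      have hz0 : 0 ≤ zLow T := by
        by_contra! hc
        nlinarith
      have := mul_le_mul_of_nonneg_right hMT hz0
      nlinarith
  have := mul_le_mul_of_nonneg_right key (sq_nonneg (M : ℝ))
  nlinarith

theorem ysum_ge_linear : 27 / 2 + 69 / 1000 * M ≤ ysum M (Real.exp (-t)) ∧
    131 / 1000 * M ≤ ysum M (Real.exp (-t)) := by
  have hM' : (85 : ℝ) ≤ M := by exact_mod_cast hM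
  have hy := ysum_ge ht ht1 hT
  obtain ⟨T, h⟩ : ∃ T, T = 3 * M * t := ⟨_, rfl⟩
  rw [← h] at hy hT
  have hT0 : 0 ≤ T := by rw [h]; positivity
  have hMT : 546 / 10 * T ≤ M := by rw [h]; nlinarith
  constructor
  · rcases le_total T (156 / 100) with h1 | h1
    · have := yLow_ge_of_le hT0 h1
      nlinarith
    · have := mul_yLow_ge h1 hT
      have hz0 : 0 ≤ yLow T - 69 / 1000 := by
        by_contra! hc
        nlinarith
      have := mul_le_mul_of_nonneg_right hMT hz0
      nlinarith
  · have := yLow_ge hT0 hT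
    nlinarith

end scale

theorem ysum_mono {r : ℝ} (hr : 0 ≤ r) {M n : ℕ} (h : M ≤ n) : ysum M r ≤ ysum n r :=
  sum_le_sum_of_subset_of_nonneg (range_subset_range.2 h) fun i _ _ => wt_nonneg (by positivity)

/-- The analytic criterion, with the scale `M` of the central part of the product chosen so that
`3 * M * t ≤ 4`. -/
theorem coeff_nonneg_of_scale {n m M : ℕ} {t : ℝ} (ht : 0 ≤ t) (ht1 : t ≤ 61 / 10000)
    (hM : 85 ≤ M) (hT : 3 * M * t ≤ 4) (hMn : M ≤ n) (hs : saddle n (Real.exp (-t)) = 3 * m)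
    (h2 : powSum 2 n (Real.exp (-t)) ≤ 13 / 4 * zsum M (Real.exp (-t)))
    (hl : ∀ l : ℝ, 0 < l → zsum M (Real.exp (-t)) * l ^ 2 = 8 / 13 →
      powSum 3 n (Real.exp (-t)) * l ^ 3 ≤ 6 / 10 ∧ ysum n (Real.exp (-t)) * l ≤ 43 / 1000 ∧
      ∀ a : ℕ, a ≤ 3 * n → a * t ≤ 2303 / 1000 → a * (17 / 10 * l) ≤ 6 / 10) :
    0 ≤ (bp n).coeff (3 * m) := by
  have hM' : (85 : ℝ) ≤ M := by exact_mod_cast hM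
  have hz := zsum_ge_linear ht ht1 hM hT
  obtain ⟨hy1, hy2⟩ := ysum_ge_linear ht ht1 hM hT
  have hr0 : 0 < Real.exp (-t) := Real.exp_pos _
  have hr1 : Real.exp (-t) ≤ 1 := Real.exp_le_one_iff.2 (by linarith)
  have hrt : 1 - Real.exp (-t) ≤ t := by linarith [Real.add_one_le_exp (-t)]
  have h10 : Real.exp (-(2303 / 1000)) ≤ 1 / 10 := by
    have e2 := pow_le_pow_left₀ (by norm_num) Real.exp_one_gt_d9.le 2
    rw [← Real.exp_nat_mul, mul_one] at e2
    have e3 := Real.sum_le_exp_of_nonneg (by norm_num : (0 : ℝ) ≤ 303 / 1000) 4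
    norm_num [sum_range_succ, Nat.factorial] at e3
    have e4 : Real.exp (2303 / 1000) = Real.exp ((2 : ℕ) : ℝ) * Real.exp (303 / 1000) := by
      rw [← Real.exp_add]; norm_num
    rw [Real.exp_neg, inv_le_comm₀ (Real.exp_pos _) (by norm_num), e4]
    refine le_trans ?_ (mul_le_mul e2 e3 (by norm_num) (Real.exp_pos _).le)
    norm_num
  have hym := ysum_mono hr0.le hMn
  have hzM := zsum_le hr0.le M
  set r := Real.exp (-t) with hr
  set Z := zsum M r with hZ
  have hz37 : 37 * (M : ℝ) ^ 2 ≤ Z := by nlinarith [sq_nonneg (M : ℝ)]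
  have hZ0 : 0 < Z := by nlinarith
  set l := √(8 / 13 / Z) with hl_def
  have hl0 : 0 < l := by positivity
  have hl2 : Z * l ^ 2 = 8 / 13 := by
    rw [hl_def, Real.sq_sqrt (by positivity)]; field_simp
  obtain ⟨h3, hy, ha⟩ := hl l hl0 hl2
  have hp : powSum 2 n r * l ^ 2 ≤ 2 := by
    have := mul_le_mul_of_nonneg_right h2 (sq_nonneg l)
    linarith
  have hv2 : (12 / 10 / (M * l)) ^ 2 = 234 / 100 * (Z / M ^ 2) := by
    have : l ^ 2 = 8 / 13 / Z := by field_simp; linarith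
    rw [div_pow, mul_pow, this]
    field_simp
    norm_num
  have hv : 93 / 10 ≤ 12 / 10 / (M * l) := by
    apply le_of_sq_le_sq _ (by positivity)
    have : 37 ≤ Z / M ^ 2 := by rw [le_div_iff₀ (by positivity)]; exact hz37
    rw [hv2]; linarith
  have hvM : (12 / 10 / (M * l)) ^ 2 ≤ 234 / 100 * M := by
    rw [hv2]
    have : Z / M ^ 2 ≤ M := by rw [div_le_iff₀ (by positivity)]; linarith
    linarith
  have hvl : 12 / 10 / (M * l) * (M * l) = 12 / 10 := div_mul_cancel₀ _ (by positivity)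
  refine coeff_nonneg_of_bounds hr0 hr1 hs hl0 hMn (by omega) hp h3 ?_ ?_ hy (by linarith)
    hl2 (fourth_moment_le hr0 hr1 M) hvl hv
    (tails_le hM' hv hvM (hy1.trans hym) (hy2.trans hym) hl0 hvl)
  · have h0 : 0 ≤ powSum 2 n r * l ^ 2 :=
      mul_nonneg (sum_nonneg fun i _ => mul_nonneg (by positivity) (wt_nonneg (by positivity)))
        (sq_nonneg l)
    have : (1 - r) * (powSum 2 n r * l ^ 2) ≤ 61 / 10000 * 2 := by
      apply mul_le_mul (by linarith) hp h0 (by norm_num)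
    linarith
  · intro a han
    rcases le_total (a * t) (2303 / 1000) with h | h
    · exact Or.inl (ha a han h)
    · right
      rw [hr, ← Real.exp_nat_mul]
      refine le_trans ?_ h10
      apply Real.exp_le_exp.2
      linarith

theorem coeff_nonneg_of_short {n m : ℕ} {t : ℝ} (ht : 0 ≤ t) (ht1 : t ≤ 61 / 10000)
    (hn : 85 ≤ n) (hT : 3 * n * t ≤ 4) (hs : saddle n (Real.exp (-t)) = 3 * m) :
    0 ≤ (bp n).coeff (3 * m) := by
  have hn' : (85 : ℝ) ≤ n := by exact_mod_cast hn
  have hr0 : 0 < Real.exp (-t) := Real.exp_pos _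
  have hz := zsum_ge_linear ht ht1 hn hT
  have hz37 : 37 * (n : ℝ) ^ 2 ≤ zsum n (Real.exp (-t)) := by nlinarith [sq_nonneg (n : ℝ)]
  have hp2 := powSum_two_le ht ht1 n hz37 hn
  have hp3 : powSum 3 n (Real.exp (-t)) ≤ 3 * n * powSum 2 n (Real.exp (-t)) := by
    unfold powSum
    rw [mul_sum]
    refine sum_le_sum fun i hi => ?_
    have h1 : ((3 * i + 2 : ℕ) : ℝ) ≤ 3 * n := by
      have := mem_range.1 hi
      exact_mod_cast (by omega : 3 * i + 2 ≤ 3 * n)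
    have hw := wt_nonneg (by positivity : 0 ≤ Real.exp (-t) ^ (3 * i + 1))
    calc 2 * ((3 * i + 2 : ℕ) : ℝ) ^ 3 * wt (Real.exp (-t) ^ (3 * i + 1)) =
        ((3 * i + 2 : ℕ) : ℝ) *
          (2 * ((3 * i + 2 : ℕ) : ℝ) ^ 2 * wt (Real.exp (-t) ^ (3 * i + 1))) := by ring
      _ ≤ _ := mul_le_mul_of_nonneg_right h1 (by positivity)
  have hy := ysum_le hr0.le n
  set r := Real.exp (-t) with hr
  set Z := zsum n r with hZ
  have hZ0 : 0 < Z := by nlinarith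
  refine coeff_nonneg_of_scale ht ht1 hn hT le_rfl hs (by linarith) ?_
  intro l hl hl2
  rw [← hr, ← hZ] at *
  have hnl : (n : ℝ) * l ≤ 12899 / 100000 := by
    apply le_of_sq_le_sq _ (by norm_num)
    have := mul_le_mul_of_nonneg_right hz37 (sq_nonneg l)
    nlinarith
  refine ⟨?_, ?_, ?_⟩
  · have h1 := mul_le_mul_of_nonneg_left hp2 (by positivity : (0 : ℝ) ≤ 3 * n)
    have h2 := mul_le_mul_of_nonneg_right (hp3.trans h1) (by positivity : 0 ≤ l ^ 3)
    have e : 3 * n * (215 / 100 * Z) * l ^ 3 = 645 / 100 * (n * l) * (Z * l ^ 2) := by ring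
    rw [e, hl2] at h2
    linarith
  · have := mul_le_mul_of_nonneg_right hy hl.le
    linarith
  · intro a ha hat
    have ha' : (a : ℝ) ≤ 3 * n := by exact_mod_cast ha
    rcases le_total (3 * n * t) (26 / 10) with h | h
    · have hz44 : 447 / 10 * (n : ℝ) ^ 2 ≤ Z := by
        refine le_trans (mul_le_mul_of_nonneg_right ?_ (sq_nonneg _)) hz
        linarith
      have hnl' : (n : ℝ) * l ≤ 1174 / 10000 := by
        apply le_of_sq_le_sq _ (by norm_num)
        have := mul_le_mul_of_nonneg_right hz44 (sq_nonneg l)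
        nlinarith
      have := mul_le_mul_of_nonneg_right ha' hl.le
      linarith
    · have h1 : 26 / 10 * (a : ℝ) ≤ 3 * n * (2303 / 1000) := by
        calc 26 / 10 * (a : ℝ) ≤ 3 * n * t * a := by gcongr
          _ = 3 * n * (a * t) := by ring
          _ ≤ _ := by gcongr
      have := mul_le_mul_of_nonneg_right h1 hl.le
      linarith

theorem wt_le_cube_pow {r : ℝ} (hr : 0 ≤ r) (hr1 : r ≤ 1) {j : ℕ} (i : ℕ) :
    wt (r ^ (3 * i + j)) ≤ (r ^ 3) ^ i := by
  have h : wt (r ^ (3 * i + j)) ≤ r ^ (3 * i + j) := by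
    have : 0 ≤ r ^ (3 * i + j) := by positivity
    rw [wt, div_le_iff₀ (by positivity)]
    nlinarith [pow_pos (by linarith : 0 < 1 + r ^ (3 * i + j)) 3, mul_nonneg this this,
      mul_nonneg this (mul_nonneg this this)]
  refine h.trans ?_
  rw [pow_add, pow_mul]
  exact mul_le_of_le_one_right (by positivity) (pow_le_one₀ hr hr1)

theorem powSum_two_tail {t : ℝ} (ht : 0 < t) (ht1 : t ≤ 61 / 10000) {M n : ℕ} (hMn : M ≤ n)
    (hT : 398 / 100 ≤ 3 * M * t) (hT4 : 3 * M * t ≤ 4) :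
    t ^ 3 * (powSum 2 n (Real.exp (-t)) - powSum 2 M (Real.exp (-t))) ≤ 45 / 100 := by
  have hr0 : 0 < Real.exp (-t) := Real.exp_pos _
  have hr1 : Real.exp (-t) < 1 := Real.exp_lt_one_iff.2 (by linarith)
  have hx := one_sub_exp_ge ht.le ht1
  have hx0 : 0 ≤ Real.exp (-t) ^ 3 := by positivity
  have hx1 : Real.exp (-t) ^ 3 < 1 := pow_lt_one₀ hr0.le hr1 (by norm_num)
  have hrM : (Real.exp (-t) ^ 3) ^ M ≤ 19 / 1000 := by
    have e4 : Real.exp (-4) ≤ 184 / 10000 := by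
      exact_mod_cast exp_neg_nat_le (k := 4) (c := 184 / 10000) (by norm_num) (by norm_num)
    have e2 : Real.exp (2 / 100) * Real.exp (-(2 / 100)) = 1 := by
      rw [← Real.exp_add, add_neg_cancel, Real.exp_zero]
    have e3 := Real.add_one_le_exp (-(2 / 100) : ℝ)
    have e5 := Real.exp_pos (2 / 100)
    have e6 : Real.exp (2 / 100) ≤ 103 / 100 := by nlinarith
    rw [← pow_mul, ← Real.exp_nat_mul]
    calc Real.exp ((3 * M : ℕ) * -t) ≤ Real.exp (-4 + 2 / 100) := by
          apply Real.exp_le_exp.2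
          push_cast
          linarith
      _ = Real.exp (-4) * Real.exp (2 / 100) := Real.exp_add _ _
      _ ≤ 184 / 10000 * (103 / 100) := by gcongr
      _ ≤ _ := by norm_num
  set r := Real.exp (-t) with hr
  set x := r ^ 3 with hx_def
  obtain ⟨A, hA⟩ : ∃ A : ℝ, A = 3 * M + 2 := ⟨_, rfl⟩
  have hA0 : 0 ≤ A := by rw [hA]; positivity
  have hAt : A * t ≤ 4013 / 1000 := by rw [hA]; linarith
  have h1 : powSum 2 n r - powSum 2 M r ≤ ∑ j ∈ range (n - M), 2 * x ^ M *
      (A ^ 2 * (((j + 0).choose 0 : ℕ) * x ^ j) + 6 * A * (((j + 1).choose 1 : ℕ) * x ^ j) +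
        18 * (((j + 2).choose 2 : ℕ) * x ^ j)) := by
    have e : powSum 2 n r - powSum 2 M r = ∑ j ∈ range (n - M),
        2 * ((3 * (M + j) + 2 : ℕ) : ℝ) ^ 2 * wt (r ^ (3 * (M + j) + 1)) := by
      obtain ⟨d, rfl⟩ := Nat.exists_eq_add_of_le hMn
      rw [powSum, powSum, sum_range_add, Nat.add_sub_cancel_left]
      ring
    rw [e]
    refine sum_le_sum fun j _ => ?_
    have hw : wt (r ^ (3 * (M + j) + 1)) ≤ x ^ M * x ^ j := by
      rw [← pow_add]
      exact wt_le_cube_pow hr0.le hr1.le _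
    have hc : ((j + 2).choose 2 : ℝ) = (j + 1) * (j + 2) / 2 := by
      rw [Nat.cast_choose_two]; push_cast; ring
    calc 2 * ((3 * (M + j) + 2 : ℕ) : ℝ) ^ 2 * wt (r ^ (3 * (M + j) + 1)) ≤
        2 * ((3 * (M + j) + 2 : ℕ) : ℝ) ^ 2 * (x ^ M * x ^ j) := by gcongr
      _ = 2 * x ^ M * (((3 * (M + j) + 2 : ℕ) : ℝ) ^ 2 * x ^ j) := by ring
      _ ≤ 2 * x ^ M * ((A ^ 2 + 6 * A * (j + 1) + 18 * ((j + 1) * (j + 2) / 2)) * x ^ j) := by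
        have : ((3 * (M + j) + 2 : ℕ) : ℝ) ^ 2 ≤
            A ^ 2 + 6 * A * (j + 1) + 18 * ((j + 1) * (j + 2) / 2) := by
          have : ((3 * (M + j) + 2 : ℕ) : ℝ) = A + 3 * j := by rw [hA]; push_cast; ring
          rw [this]
          have : (0 : ℝ) ≤ j := Nat.cast_nonneg j
          nlinarith
        gcongr
      _ = _ := by rw [hc]; simp only [Nat.choose_zero_right, Nat.choose_one_right]; push_cast; ring
  rw [← mul_sum, sum_add_distrib, sum_add_distrib, ← mul_sum, ← mul_sum, ← mul_sum] at h1
  have g : ∀ k, ∑ j ∈ range (n - M), ((j + k).choose k : ℝ) * x ^ j ≤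
      1 / (29725 / 10000 * t) ^ (k + 1) := fun k =>
    (sum_choose_mul_pow_le hx0 hx1 k _).trans (by gcongr)
  have h2 : powSum 2 n r - powSum 2 M r ≤ 2 * (19 / 1000) *
      (A ^ 2 * (1 / (29725 / 10000 * t) ^ (0 + 1)) + 6 * A * (1 / (29725 / 10000 * t) ^ (1 + 1)) +
        18 * (1 / (29725 / 10000 * t) ^ (2 + 1))) := by
    refine h1.trans ?_
    have := g 0
    have := g 1
    have := g 2
    gcongr
  have h3 := mul_le_mul_of_nonneg_left h2 (by positivity : 0 ≤ t ^ 3)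
  refine h3.trans ?_
  have e : t ^ 3 * (2 * (19 / 1000) *
      (A ^ 2 * (1 / (29725 / 10000 * t) ^ (0 + 1)) + 6 * A * (1 / (29725 / 10000 * t) ^ (1 + 1)) +
        18 * (1 / (29725 / 10000 * t) ^ (2 + 1)))) = 2 * (19 / 1000) *
      ((A * t) ^ 2 * (10000 / 29725) + 6 * (A * t) * (10000 / 29725) ^ 2 +
        18 * (10000 / 29725) ^ 3) := by
    field_simp
    ring
  rw [e]
  calc _ ≤ 2 * (19 / 1000) * ((4013 / 1000 : ℝ) ^ 2 * (10000 / 29725) +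
        6 * (4013 / 1000) * (10000 / 29725) ^ 2 + 18 * (10000 / 29725) ^ 3) := by gcongr
    _ ≤ _ := by norm_num

theorem powSum_three_le {t : ℝ} (ht : 0 < t) (ht1 : t ≤ 61 / 10000) (n : ℕ) :
    t ^ 4 * powSum 3 n (Real.exp (-t)) ≤ 416 / 100 := by
  have hr0 : 0 < Real.exp (-t) := Real.exp_pos _
  have hr1 : Real.exp (-t) < 1 := Real.exp_lt_one_iff.2 (by linarith)
  have hx := one_sub_exp_ge ht.le ht1
  have hx0 : 0 ≤ Real.exp (-t) ^ 3 := by positivity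
  have hx1 : Real.exp (-t) ^ 3 < 1 := pow_lt_one₀ hr0.le hr1 (by norm_num)
  have h1 : powSum 3 n (Real.exp (-t)) ≤ ∑ i ∈ range n,
      324 * (((i + 3).choose 3 : ℝ) * (Real.exp (-t) ^ 3) ^ i) := by
    refine sum_le_sum fun i _ => ?_
    have hc : ((i + 3).choose 3 : ℝ) * 6 = (i + 1) * (i + 2) * (i + 3) := by
      have := Nat.descFactorial_eq_factorial_mul_choose (i + 3) 3
      simp [Nat.descFactorial, Nat.factorial] at this
      have : (((i + 1) * (i + 2) * (i + 3) : ℕ) : ℝ) = ((i + 3).choose 3 * 6 : ℕ) := by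
        congr 1; linarith
      push_cast at this
      linarith
    have hw := wt_le_cube_pow hr0.le hr1.le (j := 1) i
    have hi : (0 : ℝ) ≤ i := Nat.cast_nonneg i
    calc 2 * ((3 * i + 2 : ℕ) : ℝ) ^ 3 * wt (Real.exp (-t) ^ (3 * i + 1)) ≤
        2 * ((3 * i + 2 : ℕ) : ℝ) ^ 3 * (Real.exp (-t) ^ 3) ^ i := by gcongr
      _ ≤ 54 * ((i + 1) * (i + 2) * (i + 3)) * (Real.exp (-t) ^ 3) ^ i := by
        have : 2 * ((3 * i + 2 : ℕ) : ℝ) ^ 3 ≤ 54 * ((i + 1) * (i + 2) * (i + 3)) := by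
          push_cast
          nlinarith [mul_nonneg hi hi]
        gcongr
      _ = _ := by rw [← hc]; ring
  rw [← mul_sum] at h1
  have h2 := h1.trans (mul_le_mul_of_nonneg_left (sum_choose_mul_pow_le hx0 hx1 3 n) (by norm_num))
  have h3 : 1 / (1 - Real.exp (-t) ^ 3) ^ (3 + 1) ≤ 1 / (29725 / 10000 * t) ^ (3 + 1) := by gcongr
  have h4 := mul_le_mul_of_nonneg_left (h2.trans (mul_le_mul_of_nonneg_left h3 (by norm_num)))
    (by positivity : 0 ≤ t ^ 4)
  refine h4.trans ?_
  have e : t ^ 4 * (324 * (1 / (29725 / 10000 * t) ^ (3 + 1))) = 324 * (10000 / 29725) ^ 4 := by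
    field_simp
    ring
  rw [e]; norm_num

theorem cube_mul_zLow_ge {T : ℝ} (h0 : 398 / 100 ≤ T) (h : T ≤ 4) :
    110755 / 10000 ≤ T ^ 3 * zLow T := by
  obtain ⟨s, rfl⟩ : ∃ s, T = 4 - s := ⟨4 - T, by ring⟩
  have hs : 0 ≤ s := by linarith
  have hs1 : s ≤ 2 / 100 := by linarith
  have h1 : 17379 / 100000 + 985 / 10000 * s ≤ zLow (4 - s) := by
    unfold zLow
    nlinarith [mul_nonneg hs (sub_nonneg.2 hs1), mul_nonneg (mul_nonneg hs hs) (sub_nonneg.2 hs1)]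
  have h2 : 64 - 48 * s ≤ (4 - s) ^ 3 := by
    nlinarith [mul_nonneg hs (sub_nonneg.2 hs1), mul_nonneg (mul_nonneg hs hs) (sub_nonneg.2 hs1)]
  have h3 := mul_le_mul h2 h1 (by positivity) (by positivity)
  nlinarith [mul_nonneg hs (sub_nonneg.2 hs1)]

theorem cube_mul_zsum_ge {t : ℝ} (ht : 0 < t) (ht1 : t ≤ 61 / 10000) {M : ℕ}
    (hT : 398 / 100 ≤ 3 * M * t) (hT4 : 3 * M * t ≤ 4) :
    41 / 100 ≤ t ^ 3 * zsum M (Real.exp (-t)) := by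
  have hz := mul_le_mul_of_nonneg_left (zsum_ge ht.le ht1 hT4) (by positivity : 0 ≤ t ^ 3)
  have h := cube_mul_zLow_ge hT hT4
  refine le_trans ?_ hz
  have e : t ^ 3 * (M ^ 3 * zLow (3 * M * t) - 4 * M) =
      (3 * M * t) ^ 3 * zLow (3 * M * t) / 27 - 4 / 3 * (3 * M * t) * t ^ 2 := by ring
  rw [e]
  have : 3 * M * t * t ^ 2 ≤ 4 * (61 / 10000) ^ 2 := by gcongr
  linarith

theorem coeff_nonneg_of_long {n m : ℕ} {t : ℝ} (ht : 0 ≤ t) (ht1 : t ≤ 61 / 10000)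
    (hT : 4 < 3 * n * t) (hs : saddle n (Real.exp (-t)) = 3 * m) :
    0 ≤ (bp n).coeff (3 * m) := by
  have ht0 : 0 < t := by
    rcases ht.eq_or_lt with h | h
    · rw [← h] at hT; linarith
    · exact h
  obtain ⟨M, hM⟩ : ∃ M, M = ⌊4 / (3 * t)⌋₊ := ⟨_, rfl⟩
  have hM1 : (M : ℝ) ≤ 4 / (3 * t) := by rw [hM]; exact Nat.floor_le (by positivity)
  have hM2 : 4 / (3 * t) < M + 1 := by rw [hM]; exact Nat.lt_floor_add_one _
  rw [le_div_iff₀ (by positivity)] at hM1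
  rw [div_lt_iff₀ (by positivity)] at hM2
  have hT4 : 3 * M * t ≤ 4 := by linarith
  have hT0 : 398 / 100 ≤ 3 * M * t := by linarith
  have h85 : 85 ≤ M := by
    have : (85 : ℝ) ≤ M := by nlinarith
    exact_mod_cast this
  have hMn : M ≤ n := by
    have : (M : ℝ) ≤ n := by nlinarith
    exact_mod_cast this
  have hr0 : 0 < Real.exp (-t) := Real.exp_pos _
  have hr1 : Real.exp (-t) < 1 := Real.exp_lt_one_iff.2 (by linarith)
  have hZ := cube_mul_zsum_ge ht0 ht1 hT0 hT4
  have hz := zsum_ge_linear ht ht1 h85 hT4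
  have hz37 : 37 * (M : ℝ) ^ 2 ≤ zsum M (Real.exp (-t)) := by nlinarith [sq_nonneg (M : ℝ)]
  have hp2 := powSum_two_le ht ht1 M hz37 h85
  have hp2' := powSum_two_tail ht0 ht1 hMn hT0 hT4
  have hp3 := powSum_three_le ht0 ht1 n
  have hx := one_sub_exp_ge ht0.le ht1
  have hy : t * ysum n (Real.exp (-t)) ≤ 337 / 1000 := by
    have h1 : ysum n (Real.exp (-t)) ≤
        ∑ i ∈ range n, ((i + 0).choose 0 : ℝ) * (Real.exp (-t) ^ 3) ^ i := by
      refine sum_le_sum fun i _ => ?_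
      rw [Nat.choose_zero_right, Nat.cast_one, one_mul]
      exact wt_le_cube_pow hr0.le hr1.le _
    have h2 := h1.trans (sum_choose_mul_pow_le (by positivity)
      (pow_lt_one₀ hr0.le hr1 (by norm_num)) 0 n)
    have h3 : 1 / (1 - Real.exp (-t) ^ 3) ^ (0 + 1) ≤ 1 / (29725 / 10000 * t) := by
      rw [zero_add, pow_one]
      gcongr
    have h4 := mul_le_mul_of_nonneg_left (h2.trans h3) ht0.le
    refine h4.trans ?_
    have : t * (1 / (29725 / 10000 * t)) = 10000 / 29725 := by field_simp
    rw [this]; norm_num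
  set r := Real.exp (-t) with hr
  obtain ⟨Z, hZ_def⟩ : ∃ Z, Z = zsum M r := ⟨_, rfl⟩
  rw [← hZ_def] at hZ hz37 hp2
  have ht3 : 0 < t ^ 3 := by positivity
  have hZ0 : 0 < Z := by
    by_contra! hc
    nlinarith [mul_nonneg ht3.le (sub_nonneg.2 hc)]
  refine coeff_nonneg_of_scale ht ht1 h85 hT4 hMn hs ?_ ?_
  · rw [← hr, ← hZ_def]
    refine le_of_mul_le_mul_left ?_ ht3
    have := mul_le_mul_of_nonneg_left hp2 ht3.le
    linarith
  intro l hl hl2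
  rw [← hr, ← hZ_def] at *
  have hlt : l ^ 2 ≤ 1501 / 1000 * t ^ 3 := by
    have : 41 / 100 * l ^ 2 ≤ 8 / 13 * t ^ 3 := by
      calc 41 / 100 * l ^ 2 ≤ t ^ 3 * Z * l ^ 2 := by gcongr
        _ = t ^ 3 * (Z * l ^ 2) := by ring
        _ = 8 / 13 * t ^ 3 := by rw [hl2]; ring
    linarith
  have hP0 : 0 ≤ powSum 3 n r :=
    sum_nonneg fun i _ => mul_nonneg (by positivity) (wt_nonneg (by positivity))
  have hY0 : 0 ≤ ysum n r := sum_nonneg fun i _ => wt_nonneg (by positivity)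
  refine ⟨?_, ?_, ?_⟩
  · apply le_of_sq_le_sq _ (by norm_num)
    calc (powSum 3 n r * l ^ 3) ^ 2 = (powSum 3 n r) ^ 2 * (l ^ 2) ^ 3 := by ring
      _ ≤ (powSum 3 n r) ^ 2 * (1501 / 1000 * t ^ 3) ^ 3 := by gcongr
      _ = (1501 / 1000) ^ 3 * (t ^ 4 * powSum 3 n r) ^ 2 * t := by ring
      _ ≤ (1501 / 1000) ^ 3 * (416 / 100) ^ 2 * (61 / 10000) := by gcongr
      _ ≤ _ := by norm_num
  · apply le_of_sq_le_sq _ (by norm_num)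
    calc (ysum n r * l) ^ 2 = ysum n r ^ 2 * l ^ 2 := by ring
      _ ≤ ysum n r ^ 2 * (1501 / 1000 * t ^ 3) := by gcongr
      _ = 1501 / 1000 * (t * ysum n r) ^ 2 * t := by ring
      _ ≤ 1501 / 1000 * (337 / 1000) ^ 2 * (61 / 10000) := by gcongr
      _ ≤ _ := by norm_num
  · intro a _ hat
    apply le_of_sq_le_sq _ (by norm_num)
    calc (a * (17 / 10 * l)) ^ 2 = (a * (17 / 10)) ^ 2 * l ^ 2 := by ring
      _ ≤ (a * (17 / 10)) ^ 2 * (1501 / 1000 * t ^ 3) := by gcongr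
      _ = 1501 / 1000 * (17 / 10) ^ 2 * (a * t) ^ 2 * t := by ring
      _ ≤ 1501 / 1000 * (17 / 10) ^ 2 * (2303 / 1000) ^ 2 * (61 / 10000) := by gcongr
      _ ≤ _ := by norm_num

theorem coeff_nonneg_of_large {n m : ℕ} (hm : 3600 ≤ m) (h : 2 * m ≤ n ^ 2) :
    0 ≤ (bp n).coeff (3 * m) := by
  obtain ⟨t, ht, hs⟩ := exists_saddle (by omega) h
  have ht1 := saddle_point_small ht hm hs
  rcases le_or_gt (3 * n * t) 4 with h4 | h4
  · exact coeff_nonneg_of_short ht ht1 (by nlinarith) h4 hs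
  · exact coeff_nonneg_of_long ht ht1 h4 hs

/-- The integer with base-`B` digits `c 0, …, c (D - 1)`, most significant first. -/
def digits (B : ℤ) : ℕ → (ℕ → ℤ) → ℤ
  | 0, _ => 0
  | D + 1, c => digits B D c * B + c D

theorem digits_add (B : ℤ) (D : ℕ) (c d : ℕ → ℤ) :
    digits B D (fun j => c j + d j) = digits B D c + digits B D d := by
  induction D with
  | zero => rfl
  | succ D ih => simp only [digits, ih]; ring

theorem digits_sub (B : ℤ) (D : ℕ) (c d : ℕ → ℤ) :
    digits B D (fun j => c j - d j) = digits B D c - digits B D d := by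
  induction D with
  | zero => rfl
  | succ D ih => simp only [digits, ih]; ring

theorem digits_congr (B : ℤ) {D : ℕ} {c d : ℕ → ℤ} (h : ∀ j < D, c j = d j) :
    digits B D c = digits B D d := by
  induction D with
  | zero => rfl
  | succ D ih => rw [digits, digits, ih fun j hj => h j (by omega), h D (by omega)]

theorem digits_append (B : ℤ) (D s : ℕ) (c : ℕ → ℤ) :
    digits B (D + s) c = digits B D c * B ^ s + digits B s fun j => c (D + j) := by
  induction s with
  | zero => simp [digits]
  | succ s ih => rw [← add_assoc, digits, ih, digits]; ring

theorem digits_zero (B : ℤ) (D : ℕ) : digits B D (fun _ => 0) = 0 := by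
  induction D with
  | zero => rfl
  | succ D ih => simp [digits, ih]

theorem digits_shift (B : ℤ) (D s : ℕ) (c : ℕ → ℤ) :
    digits B (s + D) (fun j => if s ≤ j then c (j - s) else 0) = digits B D c := by
  rw [digits_append, digits_congr B (d := fun _ => 0) fun j hj => if_neg (by omega), digits_zero,
    zero_mul, zero_add]
  exact digits_congr B fun j _ => by simp

theorem abs_digits_le {B : ℤ} (hB : 1 ≤ B) {D : ℕ} {c : ℕ → ℤ}
    (h : ∀ j < D, 2 * |c j| ≤ B - 1) : 2 * |digits B D c| ≤ B ^ D - 1 := by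
  induction D with
  | zero => simp [digits]
  | succ D ih =>
    have h1 := ih fun j hj => h j (by omega)
    have h2 := h D (by omega)
    have h3 := abs_add_le (digits B D c * B) (c D)
    rw [abs_mul, abs_of_nonneg (by omega : 0 ≤ B)] at h3
    rw [digits, pow_succ]
    nlinarith

theorem digits_sub_shiftRight {b D s U E : ℕ} {c : ℕ → ℤ} {ε : ℤ} (hs : 1 ≤ s) (hsD : s ≤ D)
    (hc : ∀ j < D, 2 * |c j| ≤ 2 ^ b - 1) (hU : (U : ℤ) = digits (2 ^ b) D c + ε)
    (hε : |ε| ≤ E) (hE : 2 * E ≤ 2 ^ b) :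
    ∃ ε' : ℤ, |ε'| ≤ (E + 1 : ℕ) ∧ ((U - U >>> (b * s) : ℕ) : ℤ) =
      digits (2 ^ b) D (fun j => c j - if s ≤ j then c (j - s) else 0) + ε' := by
  obtain ⟨K, rfl⟩ := Nat.exists_eq_add_of_le hsD
  have hU' := hU
  rw [add_comm s K, digits_append] at hU
  have hr := abs_digits_le (one_le_pow₀ one_le_two : (1 : ℤ) ≤ 2 ^ b) (D := s)
    (c := fun j => c (K + j)) fun j hj => hc _ (by omega)
  have hBs : (2 : ℤ) ^ b ≤ (2 ^ b) ^ s := le_self_pow₀ (one_le_pow₀ one_le_two) (by omega)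
  have hV : ((U >>> (b * s) : ℕ) : ℤ) = U / (2 ^ b) ^ s := by
    rw [Nat.shiftRight_eq_div_pow, pow_mul]; push_cast; rfl
  have hE' : (2 * E : ℤ) ≤ 2 ^ b := by exact_mod_cast hE
  generalize ((2 : ℤ) ^ b) ^ s = P at *
  generalize digits (2 ^ b) s (fun j => c (K + j)) = r at *
  have hle : U >>> (b * s) ≤ U := by
    rw [Nat.shiftRight_eq_div_pow]; exact Nat.div_le_self _ _
  have hP : 0 < P := lt_of_lt_of_le (by positivity) hBs
  have hdiv : (U : ℤ) / P = digits (2 ^ b) K c + (r + ε) / P := by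
    rw [hU, add_assoc, Int.add_comm, Int.add_mul_ediv_right _ _ hP.ne', add_comm]
  rw [abs_le] at hε
  have hr' : -P < 2 * r ∧ 2 * r < P := by
    have := abs_lt.1 (show |2 * r| < P by rw [abs_mul]; norm_num; omega)
    exact this
  have hlo : -1 ≤ (r + ε) / P := (Int.le_ediv_iff_mul_le hP).2 (by omega)
  have hhi : (r + ε) / P < 1 := (Int.ediv_lt_iff_lt_mul hP).2 (by omega)
  refine ⟨ε - (r + ε) / P, by rw [abs_le]; push_cast; omega, ?_⟩
  rw [Nat.cast_sub hle, hV, hdiv, hU', digits_sub, digits_shift]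
  ring

theorem lt_of_land_eq_zero {k r : ℕ} (hr : r < 16 * 2 ^ k) (h : r &&& (15 * 2 ^ k) = 0) :
    r < 2 ^ k := by
  have h1 : (r &&& (15 * 2 ^ k)) >>> k = 0 := by rw [h]; simp
  rw [Nat.shiftRight_and_distrib, Nat.shiftRight_eq_div_pow, Nat.shiftRight_eq_div_pow,
    Nat.mul_div_cancel _ (by positivity), show 15 = 2 ^ 4 - 1 by rfl,
    Nat.and_two_pow_sub_one_eq_mod, Nat.mod_eq_of_lt] at h1
  · exact (Nat.div_eq_zero_iff_lt (by positivity)).1 h1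
  · rw [Nat.div_lt_iff_lt_mul (by positivity)]; exact hr

/-- The mask selecting the top four bits in each of `D` fields of `k + 4` bits. -/
def fieldMask (k : ℕ) : ℕ → ℕ
  | 0 => 0
  | D + 1 => fieldMask k D * 2 ^ (k + 4) + 15 * 2 ^ k

theorem digit_bounds_of_land_eq_zero {k D X : ℕ} {d : ℕ → ℤ}
    (hX : (X : ℤ) = digits (2 ^ (k + 4)) D d) (hd : ∀ j < D, |d j| < 8 * 2 ^ k)
    (h : X &&& fieldMask k D = 0) : ∀ j < D, 0 ≤ d j ∧ d j < 2 ^ k := by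
  induction D generalizing X with
  | zero => simp
  | succ D ih =>
    have hB : 2 ^ (k + 4) = 16 * 2 ^ k := by ring
    have hpos : 0 < 2 ^ k := by positivity
    have hM : (15 * 2 ^ k) < 2 ^ (k + 4) := by omega
    have hmod : X % 2 ^ (k + 4) < 2 ^ k := by
      apply lt_of_land_eq_zero
      · rw [← hB]; exact Nat.mod_lt _ (by positivity)
      · have := congrArg (· % 2 ^ (k + 4)) h
        simpa [Nat.and_mod_two_pow, fieldMask, Nat.mod_eq_of_lt hM] using this
    have hdiv : (X / 2 ^ (k + 4)) &&& fieldMask k D = 0 := by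
      have := congrArg (· / 2 ^ (k + 4)) h
      simp only [Nat.and_div_two_pow, fieldMask, Nat.zero_div] at this
      rwa [add_comm (_ * _), Nat.add_mul_div_right _ _ (by positivity), Nat.div_eq_of_lt hM,
        zero_add] at this
    have hdm : (X : ℤ) = (X / 2 ^ (k + 4) : ℕ) * 2 ^ (k + 4) + (X % 2 ^ (k + 4) : ℕ) := by
      exact_mod_cast (Nat.div_add_mod' X (2 ^ (k + 4))).symm
    have hBz : (2 : ℤ) ^ (k + 4) = 16 * 2 ^ k := by ring
    have hmod' : ((X % 2 ^ (k + 4) : ℕ) : ℤ) < 2 ^ k := by exact_mod_cast hmod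
    have hmod0 : (0 : ℤ) ≤ ((X % 2 ^ (k + 4) : ℕ) : ℤ) := by positivity
    have hposz : (0 : ℤ) < 2 ^ k := by positivity
    have hdD := abs_lt.1 (hd D (by omega))
    rw [digits] at hX
    generalize ((X % 2 ^ (k + 4) : ℕ) : ℤ) = r at *
    have hq : ((X / 2 ^ (k + 4) : ℕ) : ℤ) = digits (2 ^ (k + 4)) D d := by
      generalize ((X / 2 ^ (k + 4) : ℕ) : ℤ) = q at *
      generalize digits (2 ^ (k + 4)) D d = p at *
      rw [hBz] at *
      have h1 : (q - p) * (16 * 2 ^ k) = d D - r := by linarith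
      by_contra hne
      rcases lt_or_gt_of_ne hne with h2 | h2
      · have : (q - p) ≤ -1 := by omega
        nlinarith
      · have : 1 ≤ (q - p) := by omega
        nlinarith
    intro j hj
    rcases Nat.lt_succ_iff_lt_or_eq.1 hj with hj | rfl
    · exact ih hq (fun j hj => hd j (by omega)) hdiv j hj
    · rw [← hq] at hX
      constructor <;> linarith

theorem fieldMask_eq (k D : ℕ) :
    fieldMask k D = 15 * 2 ^ k * ((2 ^ ((k + 4) * D) - 1) / (2 ^ (k + 4) - 1)) := by
  have h1 : 2 ≤ 2 ^ (k + 4) := Nat.one_lt_two_pow (by omega)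
  rw [pow_mul, ← Nat.geomSum_eq h1]
  induction D with
  | zero => simp [fieldMask]
  | succ D ih => rw [fieldMask, ih, geom_sum_succ]; ring

theorem digits_offset (k m : ℕ) :
    (((2 ^ k - 1) * (2 ^ (k + 4) + 1) *
      ((2 ^ ((k + 4) * (3 * m)) - 1) / (2 ^ ((k + 4) * 3) - 1)) : ℕ) : ℤ) =
      digits (2 ^ (k + 4)) (3 * m) fun j => if 3 ∣ j then 0 else 2 ^ k - 1 := by
  have h1 : 2 ≤ 2 ^ ((k + 4) * 3) := Nat.one_lt_two_pow (by omega)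
  rw [← mul_assoc, pow_mul 2 ((k + 4) * 3) m, ← Nat.geomSum_eq h1]
  have h2 : ((2 ^ k - 1 : ℕ) : ℤ) = 2 ^ k - 1 := by
    rw [Nat.cast_sub Nat.one_le_two_pow]; simp
  induction m with
  | zero => simp [digits]
  | succ m ih =>
    rw [geom_sum_succ, show 3 * (m + 1) = 3 * m + 1 + 1 + 1 by ring, digits, digits, digits, ← ih,
      if_pos (by omega), if_neg (by omega), if_neg (by omega)]
    push_cast [h2]
    ring

theorem coeff_mul_one_sub_X_pow (p : Polynomial ℤ) (s j : ℕ) :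
    (p * (1 - Polynomial.X ^ s)).coeff j = p.coeff j - if s ≤ j then p.coeff (j - s) else 0 := by
  rw [mul_sub, mul_one, Polynomial.coeff_sub, Polynomial.coeff_mul_X_pow']

theorem bp_succ (n : ℕ) : bp (n + 1) =
    bp n * (1 - Polynomial.X ^ (3 * n + 1)) * (1 - Polynomial.X ^ (3 * n + 2)) := by
  rw [bp, prod_range_succ, ← bp, mul_assoc]

/-- Multiply the packed polynomial `U` successively by `(1 - q^(3n+1)) (1 - q^(3n+2))`, `k` times,
checking after each step that adding `H` clears all the bits selected by `M`. -/
def packedLoop (b H M : Nat) : Nat → Nat → Nat → Bool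
  | 0, _, _ => true
  | k + 1, n, U =>
    let U₁ := Nat.sub U (Nat.shiftRight U (b * (3 * n + 1)))
    let U₂ := Nat.sub U₁ (Nat.shiftRight U₁ (b * (3 * n + 2)))
    match Nat.beq (Nat.land (Nat.add U₂ H) M) 0 with
    | true => packedLoop b H M k (n + 1) U₂
    | false => false

/-- The coefficients of `p` below degree `D` have the sign pattern `+ - -`. -/
def SignPattern (D : ℕ) (p : Polynomial ℤ) : Prop :=
  ∀ j < D, (3 ∣ j → 0 ≤ p.coeff j) ∧ (¬ 3 ∣ j → p.coeff j ≤ 0)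

theorem packed_step {K D n U H : ℕ} {ε : ℤ} (hn : 3 * n + 2 ≤ D) (hD : 1 ≤ D)
    (hw : 10 * (n + 1) < 2 ^ K)
    (hU : (U : ℤ) = digits (2 ^ (K + 4)) D (bp n).coeff + ε) (hε : |ε| ≤ (2 * n : ℕ))
    (hc : ∀ j < D, |(bp n).coeff j| ≤ 2 ^ K + 2 * n)
    (hH : (H : ℤ) = digits (2 ^ (K + 4)) D fun j => if 3 ∣ j then 0 else 2 ^ K - 1)
    (V : ℕ) (hV : V = U - U >>> ((K + 4) * (3 * n + 1)) -
      (U - U >>> ((K + 4) * (3 * n + 1))) >>> ((K + 4) * (3 * n + 2)))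
    (h : (V + H) &&& fieldMask K D = 0) :
    (∃ ε' : ℤ, (V : ℤ) = digits (2 ^ (K + 4)) D (bp (n + 1)).coeff + ε' ∧
      |ε'| ≤ (2 * (n + 1) : ℕ)) ∧
    (∀ j < D, |(bp (n + 1)).coeff j| ≤ 2 ^ K + 2 * (n + 1 : ℕ)) ∧
    SignPattern (D - 1) (bp (n + 1)) := by
  have hwz : (10 * (n + 1) : ℤ) < 2 ^ K := by exact_mod_cast hw
  have hB : (2 : ℤ) ^ (K + 4) = 16 * 2 ^ K := by ring
  have hBn : 2 ^ (K + 4) = 16 * 2 ^ K := by ring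
  have bound_shift : ∀ (p : Polynomial ℤ) (A : ℤ) (s : ℕ), 0 ≤ A →
      (∀ j < D, |p.coeff j| ≤ A) → ∀ j < D, |(p * (1 - Polynomial.X ^ s)).coeff j| ≤ 2 * A := by
    intro p A s hA hp j hj
    rw [coeff_mul_one_sub_X_pow]
    have h1 := hp j hj
    split_ifs with hsj
    · have h2 := hp (j - s) (by omega)
      have := abs_sub (p.coeff j) (p.coeff (j - s))
      omega
    · rw [sub_zero]; omega
  have hc₁ := bound_shift _ _ (3 * n + 1) (by positivity) hc
  have hc₂ := bound_shift _ _ (3 * n + 2) (by positivity) hc₁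
  rw [← bp_succ] at hc₂
  obtain ⟨ε₁, hε₁, hU₁⟩ := digits_sub_shiftRight (s := 3 * n + 1) (by omega) (by omega)
    (fun j hj => by have := hc j hj; omega) hU hε (by omega)
  simp only [← coeff_mul_one_sub_X_pow] at hU₁
  obtain ⟨ε₂, hε₂, hU₂⟩ := digits_sub_shiftRight (s := 3 * n + 2) (by omega) (by omega)
    (fun j hj => by have := hc₁ j hj; omega) hU₁ hε₁ (by omega)
  simp only [← coeff_mul_one_sub_X_pow, ← bp_succ, ← hV] at hU₂
  obtain ⟨E, rfl⟩ := Nat.exists_eq_add_of_le' hD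
  have hX : ((V + H : ℕ) : ℤ) = digits (2 ^ (K + 4)) (E + 1) fun j =>
      (bp (n + 1)).coeff j + (if 3 ∣ j then 0 else 2 ^ K - 1) + if j = E then ε₂ else 0 := by
    have hlast : digits (2 ^ (K + 4)) (E + 1) (fun j => if j = E then ε₂ else 0) = ε₂ := by
      rw [digits, digits_congr _ (d := fun _ => 0) fun j hj => if_neg (by omega), digits_zero]
      simp
    rw [digits_add, digits_add, Nat.cast_add, hU₂, hH, hlast]
    ring
  have hε₂' : |ε₂| ≤ 2 * (n + 1) := by push_cast at hε₂; linarith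
  have key := digit_bounds_of_land_eq_zero hX (fun j hj => by
    have h1 := hc₂ j hj
    rw [abs_le] at h1 hε₂'
    rw [abs_lt]
    split_ifs <;> constructor <;> linarith) h
  rw [abs_le] at hε₂'
  refine ⟨⟨ε₂, hU₂, by rw [abs_le]; push_cast; constructor <;> linarith⟩, fun j hj => ?_,
    fun j hj => ?_⟩
  · have := key j hj
    rw [abs_le]
    push_cast
    split_ifs at this <;> constructor <;> linarith
  · have := key j (by omega)
    rw [if_neg (show j ≠ E by omega)] at this
    constructor <;> intro h3
    · rw [if_pos h3] at this; linarith
    · rw [if_neg h3] at this; linarith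

theorem signPattern_of_packedLoop {K D H : ℕ} (hD : 1 ≤ D)
    (hH : (H : ℤ) = digits (2 ^ (K + 4)) D fun j => if 3 ∣ j then 0 else 2 ^ K - 1) (k : ℕ) :
    ∀ {n U : ℕ} {ε : ℤ}, 3 * (n + k) ≤ D → 10 * (n + k) < 2 ^ K →
    (U : ℤ) = digits (2 ^ (K + 4)) D (bp n).coeff + ε → |ε| ≤ (2 * n : ℕ) →
    (∀ j < D, |(bp n).coeff j| ≤ 2 ^ K + 2 * n) →
    packedLoop (K + 4) H (fieldMask K D) k n U = true →
    ∀ i, n < i → i ≤ n + k → SignPattern (D - 1) (bp i) := by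
  induction k with
  | zero => intros; omega
  | succ k ih =>
    intro n U ε h1 h2 hU hε hc hloop i hi hik
    rw [packedLoop] at hloop
    split at hloop
    · rename_i heq
      obtain ⟨⟨ε', hV, hε'⟩, hc', hs⟩ := packed_step (by omega) hD (by omega) hU hε hc hH _ rfl
        (Nat.eq_of_beq_eq_true heq)
      rcases Nat.eq_or_lt_of_le hi with rfl | hi
      · exact hs
      · exact ih (by omega) (by omega) hV hε' hc' hloop i hi (by omega)
    · exact absurd hloop (by simp)

/-- Certifies the sign pattern of the first `3 * m - 1` coefficients of `bp i` for `i ≤ k`. -/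
def packedCheck (b m k : Nat) : Bool :=
  packedLoop b ((2 ^ (b - 4) - 1) * (2 ^ b + 1) * ((2 ^ (b * (3 * m)) - 1) / (2 ^ (b * 3) - 1)))
    (15 * 2 ^ (b - 4) * ((2 ^ (b * (3 * m)) - 1) / (2 ^ b - 1))) k 0 (2 ^ (b * (3 * m - 1)))

theorem digits_coeff_one (B : ℤ) (D : ℕ) :
    digits B (D + 1) (1 : Polynomial ℤ).coeff = B ^ D := by
  induction D with
  | zero => simp [digits]
  | succ D ih => rw [digits, ih, Polynomial.coeff_one]; simp [pow_succ]

theorem signPattern_of_packedCheck {K m k i : ℕ} (hm : 1 ≤ m) (hk : k ≤ m) (hw : 10 * k < 2 ^ K)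
    (h : packedCheck (K + 4) m k = true) (hi : i ≤ k) : SignPattern (3 * m - 1) (bp i) := by
  have h0 : bp 0 = 1 := by simp [bp]
  have hpos : (1 : ℤ) ≤ 2 ^ K := one_le_pow₀ one_le_two
  rcases Nat.eq_zero_or_pos i with rfl | hi0
  · intro j _
    rw [h0, Polynomial.coeff_one]
    split_ifs with hj
    · subst hj; simp
    · simp
  · rw [packedCheck, Nat.add_sub_cancel, ← fieldMask_eq] at h
    refine signPattern_of_packedLoop (by omega) (digits_offset K m) k (ε := 0) (by omega) (by omega)
      ?_ (by simp) ?_ h i hi0 (by omega)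
    · obtain ⟨D, hD⟩ : ∃ D, 3 * m = D + 1 := ⟨3 * m - 1, by omega⟩
      rw [h0, hD, digits_coeff_one, Nat.add_sub_cancel, pow_mul]
      simp
    · intro j _
      rw [h0, Polynomial.coeff_one]
      split_ifs <;> simp; linarith

theorem packedCheck_eq_true : packedCheck 180 3601 1800 = true := by decide +kernel

theorem signPattern_bp_of_le {i : ℕ} (hi : i ≤ 1800) : SignPattern 10802 (bp i) :=
  signPattern_of_packedCheck (K := 176) (m := 3601) (by norm_num) (by norm_num) (by norm_num)
    packedCheck_eq_true hi

theorem coeff_bp_nonneg_of_lt (n : ℕ) {k : ℕ} (hk : k < 3600) : 0 ≤ (bp n).coeff (3 * k) := by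
  have stable : ∀ i, ∀ j ≤ 5400, (bp (1800 + i)).coeff j = (bp 1800).coeff j := by
    intro i
    induction i with
    | zero => intros; rfl
    | succ i ih =>
      intro j hj
      rw [← add_assoc, bp_succ, coeff_mul_one_sub_X_pow, coeff_mul_one_sub_X_pow,
        if_neg (by omega), if_neg (by omega), ih j hj, sub_zero, sub_zero]
  rcases le_total n 1800 with hn | hn
  · exact (signPattern_bp_of_le hn (3 * k) (by omega)).1 (by omega)
  · obtain ⟨i, rfl⟩ := Nat.exists_eq_add_of_le hn
    induction i with
    | zero => exact (signPattern_bp_of_le le_rfl (3 * k) (by omega)).1 (by omega)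
    | succ i ih =>
      have ih := ih (by omega)
      have key : ∀ j ≤ 5400, ¬ 3 ∣ j → (bp (1800 + i)).coeff j ≤ 0 := fun j hj h3 => by
        rw [stable i j hj]
        exact (signPattern_bp_of_le le_rfl j (by omega)).2 h3
      rw [← add_assoc, bp_succ, coeff_mul_one_sub_X_pow, coeff_mul_one_sub_X_pow,
        coeff_mul_one_sub_X_pow]
      rw [if_neg (show ¬ 3 * (1800 + i) + 1 ≤ 3 * k - (3 * (1800 + i) + 2) by omega)]
      split_ifs with h1 h2 h2
      · have := key (3 * k - (3 * (1800 + i) + 1)) (by omega) (by omega)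
        have := key (3 * k - (3 * (1800 + i) + 2)) (by omega) (by omega)
        linarith
      · have := key (3 * k - (3 * (1800 + i) + 1)) (by omega) (by omega)
        linarith
      · omega
      · linarith

theorem natDegree_one_sub_X_pow (s : ℕ) :
    (1 - Polynomial.X ^ s : Polynomial ℤ).natDegree = s := by
  rw [← neg_sub, Polynomial.natDegree_neg, ← map_one Polynomial.C,
    Polynomial.natDegree_X_pow_sub_C]

theorem reverse_one_sub_X_pow {s : ℕ} (hs : 0 < s) :
    (1 - Polynomial.X ^ s : Polynomial ℤ).reverse = -(1 - Polynomial.X ^ s) := by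
  ext j
  rw [Polynomial.coeff_reverse, natDegree_one_sub_X_pow]
  rcases le_or_gt j s with h | h
  · rw [Polynomial.revAt_le h]
    simp only [Polynomial.coeff_sub, Polynomial.coeff_neg, Polynomial.coeff_one,
      Polynomial.coeff_X_pow]
    split_ifs <;> omega
  · rw [Polynomial.revAt_eq_self_of_lt h]
    simp only [Polynomial.coeff_sub, Polynomial.coeff_neg, Polynomial.coeff_one,
      Polynomial.coeff_X_pow]
    split_ifs <;> omega

theorem one_sub_X_pow_ne_zero {s : ℕ} (hs : 0 < s) : (1 - Polynomial.X ^ s : Polynomial ℤ) ≠ 0 := by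
  intro h
  have := natDegree_one_sub_X_pow s
  rw [h, Polynomial.natDegree_zero] at this
  omega

theorem bp_ne_zero (n : ℕ) : bp n ≠ 0 :=
  prod_ne_zero_iff.2 fun _ _ =>
    mul_ne_zero (one_sub_X_pow_ne_zero (by omega)) (one_sub_X_pow_ne_zero (by omega))

theorem reverse_bp (n : ℕ) : (bp n).reverse = bp n := by
  induction n with
  | zero => rw [show bp 0 = Polynomial.C 1 by simp [bp], Polynomial.reverse_C]
  | succ n ih =>
    rw [bp_succ, Polynomial.reverse_mul_of_domain, Polynomial.reverse_mul_of_domain, ih,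
      reverse_one_sub_X_pow (by omega), reverse_one_sub_X_pow (by omega)]
    ring

theorem natDegree_bp (n : ℕ) : (bp n).natDegree = 3 * n ^ 2 := by
  induction n with
  | zero => simp [bp]
  | succ n ih =>
    rw [bp_succ, Polynomial.natDegree_mul (mul_ne_zero (bp_ne_zero n)
      (one_sub_X_pow_ne_zero (by omega))) (one_sub_X_pow_ne_zero (by omega)),
      Polynomial.natDegree_mul (bp_ne_zero n) (one_sub_X_pow_ne_zero (by omega)), ih,
      natDegree_one_sub_X_pow, natDegree_one_sub_X_pow]
    ring

theorem coeff_bp_nonneg_of_le {n m : ℕ} (h : 2 * m ≤ n ^ 2) : 0 ≤ (bp n).coeff (3 * m) := by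
  rcases lt_or_ge m 3600 with hm | hm
  · exact coeff_bp_nonneg_of_lt n hm
  · exact coeff_nonneg_of_large hm h

theorem coeff_bp_nonneg (n m : ℕ) : 0 ≤ (bp n).coeff (3 * m) := by
  rcases le_or_gt (2 * m) (n ^ 2) with h | h
  · exact coeff_bp_nonneg_of_le h
  · rcases le_or_gt m (n ^ 2) with h' | h'
    · rw [← reverse_bp, Polynomial.coeff_reverse, natDegree_bp, Polynomial.revAt_le (by omega),
        ← Nat.mul_sub]
      exact coeff_bp_nonneg_of_le (by omega)
    · rw [Polynomial.coeff_eq_zero_of_natDegree_lt (by rw [natDegree_bp]; omega)]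

theorem gb_zero_right (m : ℕ) : gb m 0 = 1 := by cases m <;> rfl

theorem gb_eq_zero_of_lt {m k : ℕ} (h : m < k) : gb m k = 0 := by
  induction m generalizing k with
  | zero => obtain ⟨k, rfl⟩ := Nat.exists_eq_succ_of_ne_zero h.ne'; rfl
  | succ m ih =>
    obtain ⟨k, rfl⟩ := Nat.exists_eq_succ_of_ne_zero (Nat.ne_zero_of_lt h)
    rw [gb, ih (by omega), ih (by omega)]
    simp

theorem prod_one_add_mul_pow {R : Type*} [CommRing R] [Algebra ℤ R] (q : R) (m : ℕ) (y : R) :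
    ∏ i ∈ range m, (1 + y * q ^ i) =
      ∑ k ∈ range (m + 1), q ^ k.choose 2 * Polynomial.aeval q (gb m k) * y ^ k := by
  induction m generalizing y with
  | zero => simp [gb]
  | succ m ih =>
    have h1 : ∏ i ∈ range (m + 1), (1 + y * q ^ i) =
        (1 + y) * ∏ i ∈ range m, (1 + (y * q) * q ^ i) := by
      rw [prod_range_succ', mul_comm, pow_zero, mul_one]
      congr 1
      exact prod_congr rfl fun i _ => by ring
    rw [h1, ih, add_mul, one_mul, sum_range_succ' _ (m + 1)]
    have h2 : ∑ k ∈ range (m + 1), q ^ k.choose 2 * Polynomial.aeval q (gb m k) * (y * q) ^ k =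
        ∑ k ∈ range (m + 1), q ^ (k + 1).choose 2 *
          (q ^ (k + 1) * Polynomial.aeval q (gb m (k + 1))) * y ^ (k + 1) + 1 := by
      rw [sum_range_succ', sum_range_succ _ m, gb_eq_zero_of_lt (Nat.lt_succ_self m)]
      simp [gb_zero_right, mul_pow]
      exact sum_congr rfl fun k _ => by ring
    nth_rewrite 1 [h2]
    rw [add_right_comm, mul_sum, ← sum_add_distrib]
    simp only [gb, Nat.choose_zero_succ, pow_zero, map_one, mul_one]
    congr 1
    refine sum_congr rfl fun k _ => ?_
    rw [Nat.choose_succ_succ' k 1, Nat.choose_one_right]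
    simp only [map_add, map_mul, map_pow, Polynomial.aeval_X]
    ring

/-- The additive map keeping the terms whose exponent is a multiple of `3` and dividing these
exponents by `3`. -/
def trisect : LaurentPolynomial ℤ →+ LaurentPolynomial ℤ :=
  AddMonoidAlgebra.comapDomainAddMonoidHom (fun i : ℤ => 3 * i)
    (mul_right_injective₀ (by norm_num))

theorem coeff_trisect (f : LaurentPolynomial ℤ) (i : ℤ) :
    (trisect f).coeff i = f.coeff (3 * i) := rfl

theorem trisect_C_mul_T (a i : ℤ) :
    trisect (C a * T (3 * i)) = C a * T i := by
  ext j
  rw [coeff_trisect, ← single_eq_C_mul_T, ← single_eq_C_mul_T, AddMonoidAlgebra.coeff_single,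
    AddMonoidAlgebra.coeff_single, Finsupp.single_apply, Finsupp.single_apply]
  simp

theorem trisect_C_mul_T_of_not_dvd (a : ℤ) {i : ℤ} (h : ¬ 3 ∣ i) :
    trisect (C a * T i) = 0 := by
  ext j
  rw [coeff_trisect, ← single_eq_C_mul_T, AddMonoidAlgebra.coeff_single, Finsupp.single_apply,
    if_neg (by omega)]
  rfl

theorem trisect_toLaurent (p : Polynomial ℤ) :
    trisect p.toLaurent = (Polynomial.contract 3 p).toLaurent := by
  induction p using Polynomial.induction_on' with
  | add p q hp hq => rw [map_add, map_add, hp, hq, Polynomial.contract_add (by norm_num), map_add]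
  | monomial n b =>
    rw [← Polynomial.C_mul_X_pow_eq_monomial, Polynomial.toLaurent_C_mul_X_pow]
    by_cases h : 3 ∣ n
    · obtain ⟨i, rfl⟩ := h
      have hc : Polynomial.contract 3 (Polynomial.C b * Polynomial.X ^ (3 * i)) =
          Polynomial.C b * Polynomial.X ^ i := by
        ext j
        simp only [Polynomial.coeff_contract (by norm_num : 3 ≠ 0), Polynomial.coeff_C_mul,
          Polynomial.coeff_X_pow]
        split_ifs <;> omega
      rw [hc, Polynomial.toLaurent_C_mul_X_pow, Nat.cast_mul]
      exact trisect_C_mul_T b i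
    · have hc : Polynomial.contract 3 (Polynomial.C b * Polynomial.X ^ n) = 0 := by
        ext j
        simp only [Polynomial.coeff_contract (by norm_num : 3 ≠ 0), Polynomial.coeff_C_mul,
          Polynomial.coeff_X_pow, Polynomial.coeff_zero]
        rw [if_neg (by omega), mul_zero]
      rw [hc, map_zero]
      exact trisect_C_mul_T_of_not_dvd b (by omega)

theorem trisect_mul_aeval (a i : ℤ) (p : Polynomial ℤ) :
    trisect (C a * T (3 * i) * Polynomial.aeval (T 3 : LaurentPolynomial ℤ) p) =
      C a * T i * p.toLaurent := by
  induction p using Polynomial.induction_on' with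
  | add p q hp hq => rw [map_add, map_add, mul_add, mul_add, map_add, hp, hq]
  | monomial n b =>
    rw [Polynomial.aeval_monomial, ← Polynomial.C_mul_X_pow_eq_monomial,
      Polynomial.toLaurent_C_mul_X_pow, ← C_eq_algebraMap, T_pow]
    have h := trisect_C_mul_T (a * b) (i + n)
    rw [show 3 * (i + n) = 3 * i + n * 3 by ring, T_add, T_add, map_mul C] at h
    rw [show C a * T i * (C b * T n) = C a * C b * (T i * T n) by ring, ← h]
    congr 1
    ring

theorem trisect_mul_aeval_of_not_dvd (a : ℤ) {i : ℤ} (hi : ¬ 3 ∣ i) (p : Polynomial ℤ) :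
    trisect (C a * T i * Polynomial.aeval (T 3 : LaurentPolynomial ℤ) p) = 0 := by
  induction p using Polynomial.induction_on' with
  | add p q hp hq => rw [map_add, mul_add, map_add, hp, hq, add_zero]
  | monomial n b =>
    rw [Polynomial.aeval_monomial, ← C_eq_algebraMap, T_pow]
    have h := trisect_C_mul_T_of_not_dvd (a * b) (i := i + n * 3) (by omega)
    rw [T_add, map_mul C] at h
    rw [← h]
    congr 1
    ring

theorem prod_neg_T (n : ℕ) :
    ∏ i ∈ range n, (-T (-(3 * i + 2)) : LaurentPolynomial ℤ) =
      (-1) ^ n * T (-(3 * n.choose 2 + 2 * n)) := by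
  induction n with
  | zero => simp
  | succ n ih =>
    rw [prod_range_succ, ih, Nat.choose_succ_succ' n 1, Nat.choose_one_right, pow_succ]
    rw [show (-(3 * ((n + n.choose (1 + 1) : ℕ) : ℤ) + 2 * ((n + 1 : ℕ) : ℤ))) =
      -(3 * n.choose 2 + 2 * n) + -(3 * n + 2) by push_cast; ring, T_add]
    ring

theorem prod_one_sub_T (n : ℕ) :
    ∏ i ∈ range (2 * n), (1 + -T (1 - 3 * n) * T 3 ^ i : LaurentPolynomial ℤ) =
      (-1) ^ n * T (-(3 * n.choose 2 + 2 * n)) * (bp n).toLaurent := by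
  have h : (bp n).toLaurent = ∏ i ∈ range n, (1 - T (3 * i + 1) : LaurentPolynomial ℤ) *
      (1 - T (3 * i + 2)) := by
    simp [bp, map_prod]
  rw [two_mul, prod_range_add, ← prod_range_reflect, h, ← prod_neg_T, ← prod_mul_distrib,
    ← prod_mul_distrib]
  refine prod_congr rfl fun i hi => ?_
  have hi' : i < n := mem_range.1 hi
  have h1 : (T (1 - 3 * n) * T 3 ^ (n - 1 - i) : LaurentPolynomial ℤ) = T (-(3 * i + 2)) := by
    rw [T_pow, ← T_add]
    congr 1
    rw [Nat.cast_sub (by omega), Nat.cast_sub (by omega)]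
    push_cast
    ring
  have h2 : (T (1 - 3 * n) * T 3 ^ (n + i) : LaurentPolynomial ℤ) = T (3 * i + 1) := by
    rw [T_pow, ← T_add]
    congr 1
    push_cast
    ring
  have h3 : (T (-(3 * i + 2)) * T (3 * i + 2) : LaurentPolynomial ℤ) = 1 := by
    rw [← T_add, neg_add_cancel, T_zero]
  rw [neg_mul, neg_mul, h1, h2]
  linear_combination (T (3 * i + 1) - 1 : LaurentPolynomial ℤ) * h3

theorem toLaurent_bp (n : ℕ) : (bp n).toLaurent = ∑ k ∈ range (2 * n + 1),
    C ((-1) ^ (n + k)) * T (3 * n.choose 2 + 2 * n + 3 * k.choose 2 + k * (1 - 3 * n)) *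
      Polynomial.aeval (T 3 : LaurentPolynomial ℤ) (gb (2 * n) k) := by
  have h := prod_one_sub_T n
  rw [prod_one_add_mul_pow] at h
  have h3 : ((-1) ^ n * T (3 * n.choose 2 + 2 * n) * ((-1) ^ n * T (-(3 * n.choose 2 + 2 * n))) :
      LaurentPolynomial ℤ) = 1 := by
    rw [mul_mul_mul_comm, ← mul_pow, ← T_add, add_neg_cancel, T_zero]
    simp
  rw [← one_mul (bp n).toLaurent, ← h3, mul_assoc, ← h, mul_sum]
  refine sum_congr rfl fun k _ => ?_
  rw [neg_pow (T (1 - 3 * n) : LaurentPolynomial ℤ), T_pow, T_pow, pow_add, map_mul, map_pow,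
      map_pow, map_neg, map_one,
    T_add (3 * n.choose 2 + 2 * n + 3 * k.choose 2), T_add (3 * n.choose 2 + 2 * n),
    mul_comm (3 : ℤ) (k.choose 2)]
  ring

theorem toLaurent_contract_bp (n : ℕ) : (Polynomial.contract 3 (bp n)).toLaurent =
    ∑ᶠ j : ℤ, ((Int.negOnePow j : ℤ) : LaurentPolynomial ℤ) * T (j * (9 * j + 1) / 2) *
      qbin (2 * n) ((n : ℤ) - 3 * j) := by
  have hsupp : (Function.support fun j : ℤ => ((Int.negOnePow j : ℤ) : LaurentPolynomial ℤ) *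
      T (j * (9 * j + 1) / 2) * qbin (2 * n) ((n : ℤ) - 3 * j)) ⊆
      ((Icc (-n : ℤ) n).filter fun j => 0 ≤ (n : ℤ) - 3 * j ∧ (n : ℤ) - 3 * j ≤ 2 * n : Finset ℤ)
          := by
    intro j hj
    rw [Function.mem_support] at hj
    by_contra hj'
    refine hj ?_
    rw [qbin, if_neg, mul_zero]
    intro h
    apply hj'
    rw [mem_coe, mem_filter, mem_Icc]
    exact ⟨by omega, h⟩
  have hchoose : ∀ k : ℕ, (2 * k.choose 2 : ℤ) = k * (k - 1) := fun k => by
    induction k with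
    | zero => simp
    | succ k ih =>
      rw [Nat.choose_succ_succ' k 1, Nat.choose_one_right]
      push_cast at ih ⊢
      linarith
  rw [finsum_eq_sum_of_support_subset _ hsupp, ← trisect_toLaurent, toLaurent_bp, map_sum]
  symm
  refine sum_of_injOn (fun j : ℤ => ((n : ℤ) - 3 * j).toNat) ?_ ?_ ?_ ?_
  · intro i hi j hj hij
    have hi' := (mem_filter.1 hi).2
    have hj' := (mem_filter.1 hj).2
    dsimp only at hij
    omega
  · intro j hj
    have hj' := (mem_filter.1 hj).2
    simp only [coe_range, Set.mem_Iio]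
    omega
  · intro k hk hk'
    rw [mem_range] at hk
    apply trisect_mul_aeval_of_not_dvd
    intro hdvd
    apply hk'
    obtain ⟨j, hj⟩ : (3 : ℤ) ∣ n - k := by
      have h1 : (k : ℤ) * (1 - 3 * n) = k - 3 * (k * n) := by ring
      omega
    refine ⟨j, mem_coe.2 (mem_filter.2 ⟨mem_Icc.2 ⟨by omega, by omega⟩, by omega, by omega⟩), ?_⟩
    dsimp only
    omega
  · intro j hj
    have hj' := (mem_filter.1 hj).2
    obtain ⟨k, hk⟩ := Int.eq_ofNat_of_zero_le hj'.1
    have hexp : (3 * n.choose 2 + 2 * n + 3 * k.choose 2 + k * (1 - 3 * n) : ℤ) =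
        3 * (j * (9 * j + 1) / 2) := by
      have h1 := hchoose n
      have h2 := hchoose k
      have h3 : (k : ℤ) = n - 3 * j := hk.symm
      rw [h3] at h2 ⊢
      have h4 : (2 * (n.choose 2 + n + k.choose 2 - n * (n - 3 * j) - j) : ℤ) =
          j * (9 * j + 1) - 2 * (n - n) := by linarith
      have h5 : j * (9 * j + 1) / 2 = n.choose 2 + n + k.choose 2 - n * (n - 3 * j) - j := by omega
      rw [h5]
      ring
    have hsign : ((-1) ^ (n + k) : ℤ) = (Int.negOnePow j : ℤ) := by
      rcases Int.even_or_odd j with h | h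
      · rw [Int.negOnePow_even j h, Even.neg_one_pow (by
          rw [Nat.even_iff]; rw [Int.even_iff] at h; omega)]
        rfl
      · rw [Int.negOnePow_odd j h, Odd.neg_one_pow (by
          rw [Nat.odd_iff]; rw [Int.odd_iff] at h; omega)]
        rfl
    rw [hk, Int.toNat_natCast, hexp, trisect_mul_aeval, hsign, qbin,
      if_pos (by omega), Int.toNat_natCast, eq_intCast]
    rfl

/-- Borwein's conjecture (Wang's theorem):
`G(N,N;4/3,5/3,3) = ∑_{j ∈ ℤ} (-1)^j q^{j(9j+1)/2} [2N choose N-3j]_q` has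
nonnegative coefficients for every `N ≥ 0`. -/
theorem borwein_conjecture (N : ℕ) :
    IsNonneg (∑ᶠ j : ℤ,
      ((Int.negOnePow j : ℤ) : LaurentPolynomial ℤ) * T (j * (9 * j + 1) / 2) *
        qbin (2 * N) ((N : ℤ) - 3 * j)) := by
  refine ⟨Polynomial.contract 3 (bp N), fun n => ?_, toLaurent_contract_bp N⟩
  rw [Polynomial.coeff_contract (by norm_num), mul_comm]
  exact coeff_bp_nonneg N n
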